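/- Consider 3-dimensional cubes of symmetric (16,6,2) designs, i.e. functions C : Fin 16 → Fin 16 → Fin 16 → {0,1} all of whose slices M satisfy M·Mᵀ = 4·I + 2·J. Up to paratopy, exactly 27 such cubes are difference cubes — cubes paratopic to one of the form (i₁,i₂,i₃) ↦ [g(i₁)·g(i₂)·g(i₃) ∈ D] for some group G of order 16, bijection g : Fin 16 → G, and (16,6,2) difference set D ⊆ G — and exactly 946 further paratopy classes consist of group cubes that are not difference cubes, where a group cube is one paratopic to a cube of the form (i₁,i₂,i₃) ↦ [g(i₂)·g(i₃) ∈ B(i₁)] for a family B : Fin 16 → Finset G in which every B(i) is a (16,6,2) difference set in G and every pair of distinct elements of G lies in exactly two of the sets B(i). -/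

import Mathlib

/-- `C` is an `n`-dimensional cube of symmetric `(v,k,λ)` designs: a `{0,1}`-valued function on
`(Fin n → Fin v)` all of whose 2-dimensional slices `M` satisfy `M·Mᵀ = (k−λ)·I + λ·J`. -/
def IsCubeOfDesigns (v k l n : ℕ) (C : (Fin n → Fin v) → ℤ) : Prop :=
  (∀ i, C i = 0 ∨ C i = 1) ∧
  ∀ x y : Fin n, x ≠ y → ∀ fixed : Fin n → Fin v,
    (Matrix.of fun a b : Fin v =>
        C (fun t => if t = x then a else if t = y then b else fixed t)) *
      (Matrix.of fun a b : Fin v =>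
        C (fun t => if t = x then a else if t = y then b else fixed t)).transpose =
      ((k : ℤ) - (l : ℤ)) • 1 + (l : ℤ) • Matrix.of (fun _ _ => 1)

/-- Two `n`-cubes of order `v` are paratopic if one is mapped onto the other by permuting each
of the `n` index sets independently combined with permuting the coordinate positions. -/
def Paratopic (v n : ℕ) (C₁ C₂ : (Fin n → Fin v) → ℤ) : Prop :=
  ∃ (γ : Equiv.Perm (Fin n)) (α : Fin n → Equiv.Perm (Fin v)),
    ∀ i, C₂ i = C₁ (fun t => α t (i (γ t)))

/-- `C` is paratopic to a difference cube over `G`, i.e. to a `3`-cube of the form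
`(i₁,i₂,i₃) ↦ [g(i₁)·g(i₂)·g(i₃) ∈ D]` for a `(v,k,λ)` difference set `D ⊆ G`. -/
def IsDifferenceCubeOver (v k l : ℕ) (G : Type) [Group G] [Fintype G] [DecidableEq G]
    (C : (Fin 3 → Fin v) → ℤ) : Prop :=
  Fintype.card G = v ∧
  ∃ (g : Fin v ≃ G) (D : Finset G),
    D.card = k ∧
    (∀ h : G, h ≠ 1 → ((D ×ˢ D).filter (fun p => p.1⁻¹ * p.2 = h)).card = l) ∧
    Paratopic v 3 C (fun i => if g (i 0) * g (i 1) * g (i 2) ∈ D then 1 else 0)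

/-- `C` is a difference cube for some group of order `v`. -/
def IsDifferenceCube (v k l : ℕ) (C : (Fin 3 → Fin v) → ℤ) : Prop :=
  ∃ (G : Type) (iG : Group G) (iF : Fintype G) (iD : DecidableEq G),
    @IsDifferenceCubeOver v k l G iG iF iD C

/-- `C` is paratopic to a group cube over `G`: a `3`-cube `(i₁,i₂,i₃) ↦ [g(i₂)·g(i₃) ∈ B(i₁)]`
where every block `B(i)` is a `(v,k,λ)` difference set in `G` and the blocks form a symmetric
`(v,k,λ)` design over `G`. -/
def IsGroupCubeOver (v k l : ℕ) (G : Type) [Group G] [Fintype G] [DecidableEq G]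
    (C : (Fin 3 → Fin v) → ℤ) : Prop :=
  Fintype.card G = v ∧
  ∃ (g : Fin v ≃ G) (B : Fin v → Finset G),
    (∀ i, (B i).card = k) ∧
    (∀ i, ∀ h : G, h ≠ 1 →
      (((B i) ×ˢ (B i)).filter (fun p => p.1⁻¹ * p.2 = h)).card = l) ∧
    (∀ x y : G, x ≠ y →
      (Finset.univ.filter (fun i : Fin v => x ∈ B i ∧ y ∈ B i)).card = l) ∧
    Paratopic v 3 C (fun i => if g (i 1) * g (i 2) ∈ B (i 0) then 1 else 0)

/-- `C` is a group cube for some group of order `v`. -/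
def IsGroupCube (v k l : ℕ) (C : (Fin 3 → Fin v) → ℤ) : Prop :=
  ∃ (G : Type) (iG : Group G) (iF : Fintype G) (iD : DecidableEq G),
    @IsGroupCubeOver v k l G iG iF iD C

namespace GroupCubes

section Paratopy

variable {v n : ℕ}

theorem Paratopic.refl (C : (Fin n → Fin v) → ℤ) : Paratopic v n C C :=
  ⟨1, fun _ => 1, fun _ => rfl⟩

theorem Paratopic.symm {C₁ C₂ : (Fin n → Fin v) → ℤ} (h : Paratopic v n C₁ C₂) :
    Paratopic v n C₂ C₁ := by
  obtain ⟨γ, α, h⟩ := h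
  refine ⟨γ⁻¹, fun t => (α (γ⁻¹ t))⁻¹, fun i => ?_⟩
  rw [h]
  congr 1
  funext t
  simp

theorem Paratopic.trans {C₁ C₂ C₃ : (Fin n → Fin v) → ℤ} (h : Paratopic v n C₁ C₂)
    (h' : Paratopic v n C₂ C₃) : Paratopic v n C₁ C₃ := by
  obtain ⟨γ, α, h⟩ := h
  obtain ⟨γ', α', h'⟩ := h'
  refine ⟨γ' * γ, fun t => α t * α' (γ t), fun i => ?_⟩
  rw [h', h]
  rfl

theorem IsDifferenceCube.of_paratopic {k l : ℕ} {C₁ C₂ : (Fin 3 → Fin v) → ℤ}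
    (h : Paratopic v 3 C₁ C₂) (hC : IsDifferenceCube v k l C₂) : IsDifferenceCube v k l C₁ := by
  obtain ⟨G, iG, iF, iD, hG, g, D, hD, hd, hp⟩ := hC
  exact ⟨G, iG, iF, iD, hG, g, D, hD, hd, Paratopic.trans h hp⟩

/-- The cube has at most `v` different lines in direction `d`. -/
def Thin (C : (Fin n → Fin v) → ℤ) (d : Fin n) : Prop :=
  ∃ key : (Fin n → Fin v) → Fin v, ∀ i j, key i = key j →
    ∀ t, C (Function.update i d t) = C (Function.update j d t)

theorem Thin.of_paratopic {C₁ C₂ : (Fin n → Fin v) → ℤ} {γ : Equiv.Perm (Fin n)}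
    {α : Fin n → Equiv.Perm (Fin v)} (h : ∀ i, C₂ i = C₁ (fun t => α t (i (γ t)))) {d : Fin n}
    (hd : Thin C₁ d) : Thin C₂ (γ d) := by
  obtain ⟨key, hk⟩ := hd
  refine ⟨fun i => key fun t => α t (i (γ t)), fun i j hij t => ?_⟩
  have e : ∀ i : Fin n → Fin v, (fun s => α s (Function.update i (γ d) t (γ s))) =
      Function.update (fun s => α s (i (γ s))) d (α d t) := by
    intro i
    funext s
    by_cases hs : s = d
    · subst hs; simp
    · simp [Function.update_of_ne hs, Function.update_of_ne (fun h => hs (γ.injective h))]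
  rw [h, h, e, e]
  exact hk _ _ hij _

end Paratopy

section Heap

variable {G₁ G₂ G₃ : Type} [Group G₁] [Group G₂] [Group G₃]

/-- Maps that respect the ternary operation `x y⁻¹ z`. -/
def IsHeap (h : G₁ → G₂) : Prop := ∀ x y z, h (x * y⁻¹ * z) = h x * (h y)⁻¹ * h z

/-- Maps that reverse the ternary operation `x y⁻¹ z`. -/
def IsAnti (h : G₁ → G₂) : Prop := ∀ x y z, h (x * y⁻¹ * z) = h z * (h y)⁻¹ * h x

def Heapish (h : G₁ → G₂) : Prop := IsHeap h ∨ IsAnti h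

theorem Heapish.comp {g : G₂ → G₃} {h : G₁ → G₂} (hg : Heapish g) (hh : Heapish h) :
    Heapish (fun x => g (h x)) := by
  rcases hg with hg | hg <;> rcases hh with hh | hh
  · exact Or.inl fun x y z => (congrArg g (hh x y z)).trans (hg _ _ _)
  · exact Or.inr fun x y z => (congrArg g (hh x y z)).trans (hg _ _ _)
  · exact Or.inr fun x y z => (congrArg g (hh x y z)).trans (hg _ _ _)
  · exact Or.inl fun x y z => (congrArg g (hh x y z)).trans (hg _ _ _)

theorem Heapish.symm {h : G₁ ≃ G₂} (hh : Heapish h) : Heapish h.symm := by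
  rcases hh with hh | hh
  · exact Or.inl fun x y z => h.injective (by rw [hh]; simp)
  · exact Or.inr fun x y z => h.injective (by rw [hh]; simp)

theorem Heapish.id : Heapish (fun x : G₁ => x) := Or.inl fun _ _ _ => rfl

theorem Heapish.mul_left (a : G₁) : Heapish (Equiv.mulLeft a) :=
  Or.inl fun x y z => by simp [mul_assoc]

theorem Heapish.mul_right (a : G₁) : Heapish (Equiv.mulRight a) :=
  Or.inl fun x y z => by simp [mul_assoc]

theorem IsHeap.map_mul {h : G₁ → G₂} (hh : IsHeap h) (x y : G₁) :
    h (x * y) = h x * (h 1)⁻¹ * h y := by simpa using hh x 1 y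

theorem IsAnti.map_mul {h : G₁ → G₂} (hh : IsAnti h) (x y : G₁) :
    h (x * y) = h y * (h 1)⁻¹ * h x := by simpa using hh x 1 y

theorem IsHeap.of_map_mul {h : G₁ → G₂} (hh : ∀ x y, h (x * y) = h x * (h 1)⁻¹ * h y) :
    IsHeap h := by
  intro x y z
  have e : h y⁻¹ = h 1 * (h y)⁻¹ * h 1 := by
    have := hh y y⁻¹
    rw [mul_inv_cancel] at this
    have h2 : h y⁻¹ = (h y * (h 1)⁻¹)⁻¹ * (h y * (h 1)⁻¹ * h y⁻¹) := by group
    rw [h2, ← this]; group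
  rw [hh, hh, e]; group

theorem IsAnti.of_map_mul {h : G₁ → G₂} (hh : ∀ x y, h (x * y) = h y * (h 1)⁻¹ * h x) :
    IsAnti h := by
  intro x y z
  have e : h y⁻¹ = h 1 * (h y)⁻¹ * h 1 := by
    have := hh y⁻¹ y
    rw [inv_mul_cancel] at this
    have h2 : h y⁻¹ = (h y * (h 1)⁻¹)⁻¹ * (h y * (h 1)⁻¹ * h y⁻¹) := by group
    rw [h2, ← this]; group
  rw [hh, hh, e]; group

/-- A heap isomorphism gives a group isomorphism. -/
theorem Heapish.mulEquiv {h : G₁ ≃ G₂} (hh : Heapish h) : Nonempty (G₁ ≃* G₂) := by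
  rcases hh with hh | hh
  · exact ⟨⟨h.trans (Equiv.mulRight (h 1)⁻¹), fun x y => by
      simp [hh.map_mul x y, mul_assoc]⟩⟩
  · refine ⟨⟨(Equiv.inv G₁).trans (h.trans (Equiv.mulRight (h 1)⁻¹)), fun x y => ?_⟩⟩
    simp [hh.map_mul y⁻¹ x⁻¹, mul_assoc]

theorem isHeap_of_isotopy {X Y : Type} {F₁ : X → G₁ → Bool} {F₂ : Y → G₂ → Bool} {α : Y → X}
    (hα : Function.Surjective α) {u v : G₂ → G₁}
    (sep : ∀ p q, (∀ a, F₁ a p = F₁ a q) → p = q)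
    (h : ∀ a y z, F₂ a (y * z) = F₁ (α a) (u y * v z)) :
    IsHeap (fun p => u p * v 1) ∧ ∀ a p, F₂ a p = F₁ (α a) (u p * v 1) := by
  have h1 : ∀ a p, F₂ a p = F₁ (α a) (u p * v 1) := fun a p => by simpa using h a p 1
  refine ⟨IsHeap.of_map_mul fun x y => ?_, h1⟩
  have e1 : u (x * y) * v 1 = u x * v y := sep _ _ fun a => by
    obtain ⟨b, rfl⟩ := hα a
    rw [← h1, h]
  have e2 : u y * v 1 = u 1 * v y := sep _ _ fun a => by
    obtain ⟨b, rfl⟩ := hα a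
    rw [← h1, ← h, one_mul]
  show u (x * y) * v 1 = u x * v 1 * (u 1 * v 1)⁻¹ * (u y * v 1)
  rw [e1, e2]; group

theorem isAnti_of_isotopy {X Y : Type} {F₁ : X → G₁ → Bool} {F₂ : Y → G₂ → Bool} {α : Y → X}
    (hα : Function.Surjective α) {u v : G₂ → G₁}
    (sep : ∀ p q, (∀ a, F₁ a p = F₁ a q) → p = q)
    (h : ∀ a y z, F₂ a (y * z) = F₁ (α a) (u z * v y)) :
    IsAnti (fun p => u p * v 1) ∧ ∀ a p, F₂ a p = F₁ (α a) (u p * v 1) := by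
  have h1 : ∀ a p, F₂ a p = F₁ (α a) (u p * v 1) := fun a p => by simpa using h a 1 p
  refine ⟨IsAnti.of_map_mul fun x y => ?_, h1⟩
  have e1 : u (x * y) * v 1 = u y * v x := sep _ _ fun a => by
    obtain ⟨b, rfl⟩ := hα a
    rw [← h1, h]
  have e2 : u x * v 1 = u 1 * v x := sep _ _ fun a => by
    obtain ⟨b, rfl⟩ := hα a
    rw [← h1, ← h, mul_one]
  show u (x * y) * v 1 = u y * v 1 * (u 1 * v 1)⁻¹ * (u x * v 1)
  rw [e1, e2]; group

end Heap

end GroupCubes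

namespace GroupCubes

section Designs

/-- number of points with a given property -/
def count {α : Type} [Fintype α] (p : α → Bool) : ℕ := (Finset.univ.filter fun x => p x = true).card

theorem count_congr {α β : Type} [Fintype α] [Fintype β] (e : α ≃ β) {p : α → Bool} {q : β → Bool}
    (h : ∀ x, p x = q (e x)) : count p = count q := by
  unfold count
  refine Finset.card_bij (fun x _ => e x) ?_ (fun _ _ _ _ h => e.injective h) fun y hy => ?_
  · intro x hx; simpa [h] using hx
  · exact ⟨e.symm y, by simpa [h] using hy, by simp⟩

theorem count_eq_sum {R α : Type} [Fintype α] [CommRing R] (p : α → Bool) :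
    (count p : R) = ∑ x, if p x then 1 else 0 := by
  unfold count
  rw [Finset.card_filter, Nat.cast_sum]
  exact Finset.sum_congr rfl fun x _ => by cases p x <;> simp

theorem count_and_eq_sum {R α : Type} [Fintype α] [CommRing R] (p q : α → Bool) :
    (count (fun x => p x && q x) : R) =
      ∑ x, (if p x then 1 else 0) * (if q x then 1 else 0) := by
  rw [count_eq_sum]
  exact Finset.sum_congr rfl fun x _ => by cases p x <;> cases q x <;> simp

/-- The dual of a symmetric `(16,6,2)` design is one as well. -/
theorem count_dual {α β : Type} [Fintype α] [Fintype β]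
    (e : α ≃ β) (m : α → β → Bool) (h6 : ∀ a, count (m a) = 6)
    (h2 : ∀ a a', a ≠ a' → count (fun b => m a b && m a' b) = 2) :
    (∀ b, count (fun a => m a b) = 6) ∧
      ∀ b b', b ≠ b' → count (fun a => m a b && m a b') = 2 := by
  classical
  set M : Matrix α α ℚ := Matrix.of (fun a b => if m a (e b) then 1 else 0) with hMdef
  set J : Matrix α α ℚ := Matrix.of (fun _ _ => 1) with hJ
  have hand : ∀ a a', ∑ b, M a b * M a' b = (count (fun b => m a b && m a' b) : ℚ) := by
    intro a a'
    rw [count_and_eq_sum, ← e.sum_comp]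
    rfl
  have hrow : ∀ a, ∑ b, M a b = 6 := by
    intro a
    have : ((count (m a) : ℕ) : ℚ) = ∑ b, M a b := by
      rw [count_eq_sum, ← e.sum_comp]; rfl
    rw [← this, h6]; norm_num
  have hM : M * M.transpose = (4 : ℚ) • 1 + (2 : ℚ) • J := by
    ext a a'
    rw [Matrix.mul_apply]
    simp only [Matrix.transpose_apply, hand]
    by_cases h : a = a'
    · subst h
      simp [h6, hJ]; norm_num
    · simp [h2 a a' h, hJ, h]
  have hMJ : M * J = (6 : ℚ) • J := by
    ext a b
    simp [Matrix.mul_apply, hJ, hrow]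
  have h1 : M * ((1/4 : ℚ) • (M.transpose - (1/3 : ℚ) • J)) = 1 := by
    rw [Matrix.mul_smul, Matrix.mul_sub, Matrix.mul_smul, hM, hMJ]
    ext a b
    simp [hJ]
    ring
  have h2 := mul_eq_one_comm.mp h1
  rw [Matrix.smul_mul, Matrix.sub_mul, Matrix.smul_mul] at h2
  have h3 : M.transpose * M = (4 : ℚ) • 1 + (1/3 : ℚ) • (J * M) := by
    rw [← h2]
    module
  have h4 : ∀ b b', ∑ a, M a b * M a b' = (if b = b' then 4 else 0) + (1/3) * ∑ a, M a b' :=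
    fun b b' => by
      have := congrFun (congrFun h3 b) b'
      simpa [Matrix.mul_apply, hJ, Matrix.one_apply] using this
  have hcol : ∀ b, ∑ a, M a b = 6 := by
    intro b
    have h5 := h4 b b
    have h6 : ∑ a, M a b * M a b = ∑ a, M a b :=
      Finset.sum_congr rfl fun a _ => by simp [hMdef]
    rw [h6] at h5
    simp only [if_true] at h5
    linarith
  constructor
  · intro b
    have h5 := hcol (e.symm b)
    have : ((count fun a => m a b : ℕ) : ℚ) = ∑ a, M a (e.symm b) := by
      rw [count_eq_sum]; simp [hMdef]
    rw [h5] at this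
    exact_mod_cast this
  · intro b b' hb
    have h5 := h4 (e.symm b) (e.symm b')
    have : ((count fun a => m a b && m a b' : ℕ) : ℚ) = ∑ a, M a (e.symm b) * M a (e.symm b') := by
      rw [count_and_eq_sum]; simp [hMdef]
    rw [← this, hcol, if_neg (fun h => hb (e.symm.injective h))] at h5
    norm_num at h5
    exact_mod_cast h5

variable {G H : Type} [Group G] [Group H] [Fintype G] [Fintype H]

/-- the property of being a `(16,6,2)` difference set, apart from the order of the group -/
structure IsDiffSet (b : G → Bool) : Prop where
  card : count b = 6
  right : ∀ g, g ≠ 1 → count (fun x => b x && b (x * g)) = 2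

theorem IsDiffSet.left {b : G → Bool} (hb : IsDiffSet b) :
    ∀ g, g ≠ 1 → count (fun x => b x && b (g * x)) = 2 := by
  intro g hg
  have h := (count_dual (Equiv.refl G) (fun x y => b (y * x))
    (fun x => (count_congr (Equiv.mulRight x) fun y => rfl).trans hb.card)
    (fun x x' hx => ?_)).2 1 g hg.symm
  · simpa using h
  · rw [← hb.right (x⁻¹ * x') (fun h => hx (inv_mul_eq_one.mp h))]
    exact count_congr (Equiv.mulRight x) fun y => by simp [mul_assoc]

theorem IsDiffSet.comp {b : H → Bool} (hb : IsDiffSet b) (h : G ≃ H)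
    (hh : Heapish h) : IsDiffSet (fun x => b (h x)) := by
  refine ⟨(count_congr h fun _ => rfl).trans hb.card, fun g hg => ?_⟩
  rcases hh with hh | hh
  · rw [← hb.right ((h 1)⁻¹ * h g) fun e => hg (h.injective (inv_mul_eq_one.mp e)).symm]
    exact count_congr h fun x => by simp [hh.map_mul, mul_assoc]
  · rw [← hb.left (h g * (h 1)⁻¹) fun e => hg (h.injective (mul_inv_eq_one.mp e))]
    exact count_congr h fun x => by simp [hh.map_mul, mul_assoc]

/-- Difference sets that form a symmetric `(16,6,2)` design. -/
structure IsDesign (f : Fin 16 → G → Bool) : Prop where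
  ds : ∀ i, IsDiffSet (f i)
  inter : ∀ i j, i ≠ j → count (fun x => f i x && f j x) = 2

theorem IsDesign.cover (hG : Fintype.card G = 16) {f : Fin 16 → G → Bool} (hf : IsDesign f) :
    (∀ x, count (fun i => f i x) = 6) ∧ ∀ x y, x ≠ y → count (fun i => f i x && f i y) = 2 :=
  count_dual (Fintype.equivOfCardEq (by simp [hG])) f (fun i => (hf.ds i).card) hf.inter

theorem IsDesign.of_cover (hG : Fintype.card G = 16) {f : Fin 16 → G → Bool}
    (hf : ∀ i, IsDiffSet (f i)) (h2 : ∀ x y, x ≠ y → count (fun i => f i x && f i y) = 2) :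
    IsDesign f := by
  classical
  have h6 : ∀ x, count (fun i => f i x) = 6 := by
    intro x
    have e : ∀ y, (count (fun i => f i x && f i y) : ℚ) =
        2 + if x = y then (count (fun i => f i x) - 2 : ℚ) else 0 := by
      intro y
      by_cases h : x = y
      · subst h; simp
      · simp [h2 x y h, h]
    have s1 : ∑ y, (count (fun i => f i x && f i y) : ℚ) = 6 * count (fun i => f i x) := by
      simp only [count_and_eq_sum]
      rw [Finset.sum_comm, count_eq_sum, Finset.mul_sum]
      refine Finset.sum_congr rfl fun i _ => ?_
      rw [← Finset.mul_sum, ← count_eq_sum, show count (fun y => f i y) = 6 from (hf i).card]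
      push_cast; ring
    simp only [e, Finset.sum_add_distrib, Finset.sum_const, Finset.sum_ite_eq, Finset.mem_univ,
      if_true, Finset.card_univ, hG] at s1
    have s2 : (5 : ℚ) * count (fun i => f i x) = 5 * 6 := by
      simp only [nsmul_eq_mul] at s1
      push_cast at s1
      linarith
    have s3 := mul_left_cancel₀ (by norm_num) s2
    exact_mod_cast s3
  exact ⟨hf, (count_dual (Fintype.equivOfCardEq (by simp [hG])) (fun x i => f i x) h6 h2).2⟩

theorem IsDesign.comp {f : Fin 16 → H → Bool} (hf : IsDesign f)
    (σ : Equiv.Perm (Fin 16)) (h : G ≃ H) (hh : Heapish h) : IsDesign (fun i x => f (σ i) (h x)) :=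
  ⟨fun _ => (hf.ds _).comp h hh, fun _ _ hij =>
    (count_congr h fun _ => rfl).trans (hf.inter _ _ fun e => hij (σ.injective e))⟩

/-- translates of a difference set form a design -/
theorem IsDiffSet.translates (e : Fin 16 ≃ G) {b : G → Bool}
    (hb : IsDiffSet b) : IsDesign (fun i x => b (e i * x)) := by
  refine ⟨fun i => hb.comp (Equiv.mulLeft (e i)) (Heapish.mul_left _), fun i j hij => ?_⟩
  rw [← hb.left (e j * (e i)⁻¹) fun h => hij (e.injective (mul_inv_eq_one.mp h)).symm]
  exact count_congr (Equiv.mulLeft (e i)) fun x => by simp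

/-- the cube of a family of blocks -/
def cubeOf (e : Fin 16 ≃ G) (f : Fin 16 → G → Bool) : (Fin 3 → Fin 16) → ℤ :=
  fun i => if f (i 0) (e (i 1) * e (i 2)) then 1 else 0

theorem slice_of_count (m : Fin 16 → Fin 16 → Bool) (h6 : ∀ a, count (m a) = 6)
    (h2 : ∀ a a', a ≠ a' → count (fun b => m a b && m a' b) = 2) :
    (Matrix.of fun a b : Fin 16 => if m a b then (1 : ℤ) else 0) *
      (Matrix.of fun a b : Fin 16 => if m a b then (1 : ℤ) else 0).transpose =
      (((6 : ℕ) : ℤ) - ((2 : ℕ) : ℤ)) • 1 + ((2 : ℕ) : ℤ) • Matrix.of (fun _ _ => 1) := by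
  ext a a'
  rw [Matrix.mul_apply]
  simp only [Matrix.transpose_apply, Matrix.of_apply]
  rw [← count_and_eq_sum, Matrix.add_apply, Matrix.smul_apply, Matrix.smul_apply, Matrix.one_apply]
  by_cases h : a = a'
  · subst h
    simp [h6]
  · simp [h2 a a' h, h]

theorem IsDesign.isCubeOfDesigns (hG : Fintype.card G = 16) (e : Fin 16 ≃ G) {f : Fin 16 → G → Bool}
    (hf : IsDesign f) : IsCubeOfDesigns 16 6 2 3 (cubeOf e f) := by
  refine ⟨fun i => ?_, fun x y hxy c => ?_⟩
  · unfold cubeOf; cases f (i 0) (e (i 1) * e (i 2)) <;> simp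
  · have hl : ∀ i z, count (fun b => f i (z * e b)) = 6 := fun i z =>
      (count_congr (e.trans (Equiv.mulLeft z)) fun _ => rfl).trans (hf.ds i).card
    have hr : ∀ i z, count (fun b => f i (e b * z)) = 6 := fun i z =>
      (count_congr (e.trans (Equiv.mulRight z)) fun _ => rfl).trans (hf.ds i).card
    fin_cases x <;> fin_cases y <;> simp at hxy
    · refine slice_of_count (fun a b => f a (e b * e (c 2))) (fun a => hr _ _) fun a a' h => ?_
      exact (count_congr (e.trans (Equiv.mulRight (e (c 2)))) fun _ => rfl).trans (hf.inter a a' h)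
    · refine slice_of_count (fun a b => f a (e (c 1) * e b)) (fun a => hl _ _) fun a a' h => ?_
      exact (count_congr (e.trans (Equiv.mulLeft (e (c 1)))) fun _ => rfl).trans (hf.inter a a' h)
    · exact slice_of_count (fun a b => f b (e a * e (c 2))) (fun a => (hf.cover hG).1 _)
        fun a a' h => (hf.cover hG).2 _ _ fun h' => h (e.injective (mul_right_cancel h'))
    · refine slice_of_count (fun a b => f (c 0) (e a * e b)) (fun a => hl _ _) fun a a' h => ?_
      exact (count_congr (e.trans (Equiv.mulLeft (e a))) fun x => by simp).trans
        ((hf.ds (c 0)).left (e a' * (e a)⁻¹)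
          fun h' => h (e.injective (mul_inv_eq_one.mp h')).symm)
    · exact slice_of_count (fun a b => f b (e (c 1) * e a)) (fun a => (hf.cover hG).1 _)
        fun a a' h => (hf.cover hG).2 _ _ fun h' => h (e.injective (mul_left_cancel h'))
    · refine slice_of_count (fun a b => f (c 0) (e b * e a)) (fun a => hr _ _) fun a a' h => ?_
      exact (count_congr (e.trans (Equiv.mulRight (e a))) fun x => by simp).trans
        ((hf.ds (c 0)).right ((e a)⁻¹ * e a')
          fun h' => h (e.injective (inv_mul_eq_one.mp h')))

theorem IsDiffSet.of_finset [DecidableEq G] {D : Finset G} (h6 : D.card = 6)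
    (h2 : ∀ h : G, h ≠ 1 → ((D ×ˢ D).filter (fun p => p.1⁻¹ * p.2 = h)).card = 2) :
    IsDiffSet (fun x => decide (x ∈ D)) := by
  refine ⟨by simpa [count] using h6, fun g hg => ?_⟩
  rw [← h2 g hg]
  unfold count
  refine Finset.card_bij (fun x _ => (x, x * g)) ?_ (fun _ _ _ _ h => (Prod.ext_iff.mp h).1) ?_
  · intro x hx; simpa using hx
  · rintro ⟨x, y⟩ hx
    simp only [Finset.mem_filter, Finset.mem_product] at hx
    exact ⟨x, by simp [hx.1.1, ← hx.2, hx.1.2], by simp [← hx.2]⟩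

theorem IsDiffSet.card_finset [DecidableEq G] {b : G → Bool} (hb : IsDiffSet b) (h : G) (hh : h ≠ 1) :
    (((Finset.univ.filter fun x => b x = true) ×ˢ (Finset.univ.filter fun x => b x = true)).filter
      (fun p => p.1⁻¹ * p.2 = h)).card = 2 := by
  rw [← hb.right h hh]
  unfold count
  symm
  refine Finset.card_bij (fun x _ => (x, x * h)) ?_ (fun _ _ _ _ h => (Prod.ext_iff.mp h).1) ?_
  · intro x hx; simpa using hx
  · rintro ⟨x, y⟩ hx
    simp only [Finset.mem_filter, Finset.mem_product, Finset.mem_univ, true_and] at hx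
    exact ⟨x, by simp [hx.1.1, ← hx.2, hx.1.2], by simp [← hx.2]⟩

theorem IsDesign.isGroupCube (hG : Fintype.card G = 16) (e : Fin 16 ≃ G) {f : Fin 16 → G → Bool}
    (hf : IsDesign f) : IsGroupCube 16 6 2 (cubeOf e f) := by
  classical
  refine ⟨G, inferInstance, inferInstance, inferInstance, hG, e,
    fun i => Finset.univ.filter fun x => f i x = true, fun i => (hf.ds i).card,
    fun i => (hf.ds i).card_finset, fun x y h => ?_, ?_⟩
  · rw [← (hf.cover hG).2 x y h]; simp [count]
  · convert Paratopic.refl _ using 1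
    funext i
    simp [cubeOf]

theorem exists_design_of_isGroupCube {C : (Fin 3 → Fin 16) → ℤ} (hC : IsGroupCube 16 6 2 C) :
    ∃ (G : Type) (_ : Group G) (_ : Fintype G) (e : Fin 16 ≃ G) (f : Fin 16 → G → Bool),
      Fintype.card G = 16 ∧ IsDesign f ∧ Paratopic 16 3 C (cubeOf e f) := by
  obtain ⟨G, iG, iF, iD, hG, g, B, h6, hd, hc, hp⟩ := hC
  refine ⟨G, iG, iF, g, fun i x => decide (x ∈ B i), hG,
    IsDesign.of_cover hG (fun i => IsDiffSet.of_finset (h6 i) (hd i)) fun x y h => ?_, ?_⟩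
  · simpa [count] using hc x y h
  · convert hp using 2 with i
    simp [cubeOf]

/-- the difference cube of a difference set -/
def diffCube (e : Fin 16 ≃ G) (b : G → Bool) : (Fin 3 → Fin 16) → ℤ :=
  cubeOf e (fun i x => b (e i * x))

theorem IsDiffSet.isDifferenceCube (hG : Fintype.card G = 16) (e : Fin 16 ≃ G) {b : G → Bool}
    (hb : IsDiffSet b) : IsDifferenceCube 16 6 2 (diffCube e b) := by
  classical
  refine ⟨G, inferInstance, inferInstance, inferInstance, hG, e,
    Finset.univ.filter fun x => b x = true, hb.card, hb.card_finset, ?_⟩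
  convert Paratopic.refl _ using 1
  funext i
  simp [cubeOf, diffCube, mul_assoc]

theorem exists_diffSet_of_isDifferenceCube {C : (Fin 3 → Fin 16) → ℤ}
    (hC : IsDifferenceCube 16 6 2 C) :
    ∃ (G : Type) (_ : Group G) (_ : Fintype G) (e : Fin 16 ≃ G) (b : G → Bool),
      Fintype.card G = 16 ∧ IsDiffSet b ∧ Paratopic 16 3 C (diffCube e b) := by
  obtain ⟨G, iG, iF, iD, hG, g, D, h6, hd, hp⟩ := hC
  refine ⟨G, iG, iF, g, fun x => decide (x ∈ D), hG, IsDiffSet.of_finset h6 hd, ?_⟩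
  convert hp using 2 with i
  simp [cubeOf, diffCube, mul_assoc]

end Designs

end GroupCubes

namespace GroupCubes

section Equivalence

variable {G₁ G₂ : Type} [Group G₁] [Group G₂]

theorem paratopic_cubeOf (e₁ : Fin 16 ≃ G₁) (e₂ : Fin 16 ≃ G₂) {f₁ : Fin 16 → G₁ → Bool}
    {f₂ : Fin 16 → G₂ → Bool} (h : G₂ ≃ G₁) (hh : Heapish h) (σ : Equiv.Perm (Fin 16))
    (hf : ∀ i p, f₂ i p = f₁ (σ i) (h p)) : Paratopic 16 3 (cubeOf e₁ f₁) (cubeOf e₂ f₂) := by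
  rcases hh with hh | hh
  · refine ⟨1, ![σ, e₂.trans ((h.trans (Equiv.mulRight (h 1)⁻¹)).trans e₁.symm),
      e₂.trans (h.trans e₁.symm)], fun i => ?_⟩
    simp [cubeOf, hf, hh.map_mul (e₂ (i 1))]
  · refine ⟨Equiv.swap 1 2, ![σ, e₂.trans ((h.trans (Equiv.mulRight (h 1)⁻¹)).trans e₁.symm),
      e₂.trans (h.trans e₁.symm)], fun i => ?_⟩
    simp [cubeOf, hf, hh.map_mul (e₂ (i 1)), Equiv.swap_apply_of_ne_of_ne]

theorem paratopic_diffCube (e₁ : Fin 16 ≃ G₁) (e₂ : Fin 16 ≃ G₂) {b₁ : G₁ → Bool}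
    {b₂ : G₂ → Bool} (h : G₂ ≃ G₁) (hh : Heapish h) (hb : ∀ p, b₂ p = b₁ (h p)) :
    Paratopic 16 3 (diffCube e₁ b₁) (diffCube e₂ b₂) := by
  set m : Equiv.Perm (Fin 16) :=
    e₂.trans (((h.trans (Equiv.mulRight (h 1)⁻¹)).trans (Equiv.mulLeft (h 1)⁻¹)).trans e₁.symm)
  rcases hh with hh | hh
  · refine ⟨1, ![e₂.trans (h.trans e₁.symm), m, e₂.trans (h.trans e₁.symm)], fun i => ?_⟩
    simp [diffCube, cubeOf, hb, hh.map_mul (e₂ (i 0)), hh.map_mul (e₂ (i 1)), m, mul_assoc]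
  · refine ⟨Equiv.swap 0 2, ![e₂.trans (h.trans e₁.symm), m, e₂.trans (h.trans e₁.symm)],
      fun i => ?_⟩
    simp [diffCube, cubeOf, hb, hh.map_mul (e₂ (i 0)), hh.map_mul (e₂ (i 1)), m, mul_assoc,
      Equiv.swap_apply_of_ne_of_ne]

variable {G : Type} [Group G]

theorem heapish_inv : Heapish (Equiv.inv G) := Or.inr fun x y z => by simp [mul_assoc]

theorem thin_cubeOf (e : Fin 16 ≃ G) (f : Fin 16 → G → Bool) : Thin (cubeOf e f) 0 := by
  refine ⟨fun i => e.symm (e (i 1) * e (i 2)), fun i j h t => ?_⟩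
  have h' := e.symm.injective h
  simp [cubeOf, h']

theorem thin_diffCube (e : Fin 16 ≃ G) (b : G → Bool) : Thin (diffCube e b) 2 := by
  refine ⟨fun i => e.symm (e (i 0) * e (i 1)), fun i j h t => ?_⟩
  have h' := e.symm.injective h
  simp [cubeOf, diffCube, ← mul_assoc, h']

variable [Fintype G]

theorem eq_of_imp_of_count {α : Type} [Fintype α] {p q : α → Bool} (h : count p = count q)
    (hpq : ∀ x, p x = true → q x = true) : p = q := by
  have := Finset.eq_of_subset_of_card_le
    (s := Finset.univ.filter fun x => p x = true) (t := Finset.univ.filter fun x => q x = true)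
    (fun x hx => by simp only [Finset.mem_filter, Finset.mem_univ, true_and] at hx ⊢; exact hpq x hx)
    h.ge
  funext x
  have hx := Finset.ext_iff.mp this x
  simp only [Finset.mem_filter, Finset.mem_univ, true_and] at hx
  exact Bool.eq_iff_iff.mpr hx

theorem IsDiffSet.eq_one_of_mul_right {b : G → Bool} (hb : IsDiffSet b) {g : G}
    (h : ∀ x, b (x * g) = b x) : g = 1 := by
  by_contra hg
  have := hb.right g hg
  simp [h, hb.card] at this

theorem IsDiffSet.eq_one_of_mul_left {b : G → Bool} (hb : IsDiffSet b) {g : G}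
    (h : ∀ x, b (g * x) = b x) : g = 1 := by
  by_contra hg
  have := hb.left g hg
  simp [h, hb.card] at this

theorem IsDesign.injective {f : Fin 16 → G → Bool} (hf : IsDesign f) : Function.Injective f := by
  intro i j h
  by_contra hij
  have := hf.inter i j hij
  rw [h] at this
  simp [show count (fun x => f j x) = 6 from (hf.ds j).card] at this

/-- All right translates of a block are blocks. -/
theorem IsDesign.isDifferenceCube_of_right (hG : Fintype.card G = 16) (e : Fin 16 ≃ G)
    {f : Fin 16 → G → Bool} (hf : IsDesign f) {b : G → Bool} (hb : IsDiffSet b)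
    (h : ∀ a, ∃ i, ∀ d, b d = true → f i (d * a) = true) :
    IsDifferenceCube 16 6 2 (cubeOf e f) := by
  choose τ hτ using h
  have hτ' : ∀ a x, f (τ a) x = b (x * a⁻¹) := by
    intro a x
    have := eq_of_imp_of_count (p := b) (q := fun d => f (τ a) (d * a))
      (hb.card.trans ((hf.ds (τ a)).comp (Equiv.mulRight a) (Heapish.mul_right a)).card.symm) (hτ a)
    rw [this]; simp
  have hinj : Function.Injective τ := by
    intro a a' h
    have h1 : ∀ x, b (x * (a * a'⁻¹)) = b x := fun x => by
      have h2 := hτ' a (x * a)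
      rw [h, hτ'] at h2
      simpa [mul_assoc] using h2
    exact mul_inv_eq_one.mp (hb.eq_one_of_mul_right h1)
  have hbij : Function.Bijective τ :=
    (Fintype.bijective_iff_injective_and_card τ).mpr ⟨hinj, by simp [hG]⟩
  refine IsDifferenceCube.of_paratopic ?_ (hb.isDifferenceCube hG e)
  refine ⟨(Equiv.swap 0 2).trans (Equiv.swap 0 1),
    ![e.trans ((Equiv.inv G).trans (Equiv.ofBijective τ hbij)), 1, 1], fun i => ?_⟩
  have e0 : ((Equiv.swap 0 2).trans (Equiv.swap 0 1)) (0 : Fin 3) = 2 := by decide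
  have e1 : ((Equiv.swap 0 2).trans (Equiv.swap 0 1)) (1 : Fin 3) = 0 := by decide
  have e2 : ((Equiv.swap 0 2).trans (Equiv.swap 0 1)) (2 : Fin 3) = 1 := by decide
  simp only [diffCube, cubeOf, e0, e1, e2]
  simp [hτ', mul_assoc]

/-- All left translates of a block are blocks. -/
theorem IsDesign.isDifferenceCube_of_left (hG : Fintype.card G = 16) (e : Fin 16 ≃ G)
    {f : Fin 16 → G → Bool} (hf : IsDesign f) {b : G → Bool} (hb : IsDiffSet b)
    (h : ∀ a, ∃ i, ∀ d, b d = true → f i (a * d) = true) :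
    IsDifferenceCube 16 6 2 (cubeOf e f) := by
  have h1 : IsDifferenceCube 16 6 2 (cubeOf e fun i x => f i (Equiv.inv G x)) := by
    refine (hf.comp 1 (Equiv.inv G) heapish_inv).isDifferenceCube_of_right hG e
      (hb.comp (Equiv.inv G) heapish_inv) fun a => ?_
    obtain ⟨i, hi⟩ := h a⁻¹
    exact ⟨i, fun d hd => by simpa using hi d⁻¹ hd⟩
  exact IsDifferenceCube.of_paratopic
    (paratopic_cubeOf e e (Equiv.inv G) heapish_inv 1 fun i p => rfl) h1

/-- Neither all left nor all right translates of `b` lie in blocks. -/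
def Rigid (f : Fin 16 → G → Bool) (b : G → Bool) : Prop :=
  (∃ a, ∀ i, ∃ d, b d = true ∧ f i (d * a) = false) ∧
    ∃ a, ∀ i, ∃ d, b d = true ∧ f i (a * d) = false

theorem IsDesign.rigid (hG : Fintype.card G = 16) (e : Fin 16 ≃ G)
    {f : Fin 16 → G → Bool} (hf : IsDesign f) (hd : ¬ IsDifferenceCube 16 6 2 (cubeOf e f))
    {b : G → Bool} (hb : IsDiffSet b) : Rigid f b := by
  constructor
  · by_contra! h
    exact hd (hf.isDifferenceCube_of_right hG e hb (by simpa using h))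
  · by_contra! h
    exact hd (hf.isDifferenceCube_of_left hG e hb (by simpa using h))

/-- A key with 16 values that separates 16 functions. -/
theorem exists_of_key {β : Type} (F : Fin 16 → β) (hF : Function.Injective F) (k : Fin 16 → Fin 16)
    (hk : ∀ i j, k i = k j → F i = F j) (c : Fin 16) : ∃ i, k i = c :=
  (Finite.injective_iff_surjective.mp fun _ _ h => hF (hk _ _ h)) c

theorem IsDesign.not_thin (e : Fin 16 ≃ G) {f : Fin 16 → G → Bool}
    (hf : IsDesign f) {i₀ : Fin 16} (h : Rigid f (f i₀)) {d : Fin 3} (hd : d ≠ 0) :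
    ¬ Thin (cubeOf e f) d := by
  rintro ⟨key, hk⟩
  have hd' : d = 1 ∨ d = 2 := by omega
  have hite : ∀ b c : Bool, (if b then (1 : ℤ) else 0) = (if c then 1 else 0) → b = c := by decide
  rcases hd' with rfl | rfl
  · obtain ⟨⟨a, ha⟩, -⟩ := h
    have h1 : ∀ i j z w, key ![i, 0, z] = key ![j, 0, w] →
        ∀ p, f i (p * e z) = f j (p * e w) := by
      intro i j z w h p
      have := hk _ _ h (e.symm p)
      exact hite _ _ (by simpa [cubeOf] using this)
    obtain ⟨i, hi⟩ := exists_of_key (fun i p => f i (p * e (e.symm 1)))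
      (fun i j h => hf.injective (by simpa using h)) (fun i => key ![i, 0, e.symm 1])
      (fun i j h => funext (h1 i j _ _ h)) (key ![i₀, 0, e.symm a⁻¹])
    obtain ⟨d, hd1, hd2⟩ := ha i
    have := h1 _ _ _ _ hi (d * a)
    simp [hd1, hd2] at this
  · obtain ⟨-, ⟨a, ha⟩⟩ := h
    have h1 : ∀ i j z w, key ![i, z, 0] = key ![j, w, 0] →
        ∀ p, f i (e z * p) = f j (e w * p) := by
      intro i j z w h p
      have := hk _ _ h (e.symm p)
      exact hite _ _ (by simpa [cubeOf] using this)
    obtain ⟨i, hi⟩ := exists_of_key (fun i p => f i (e (e.symm 1) * p))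
      (fun i j h => hf.injective (by simpa using h)) (fun i => key ![i, e.symm 1, 0])
      (fun i j h => funext (h1 i j _ _ h)) (key ![i₀, e.symm a⁻¹, 0])
    obtain ⟨d, hd1, hd2⟩ := ha i
    have := h1 _ _ _ _ hi (a * d)
    simp [hd1, hd2] at this

theorem IsDesign.not_isDifferenceCube (e : Fin 16 ≃ G) {f : Fin 16 → G → Bool}
    (hf : IsDesign f) {i₀ : Fin 16} (h : Rigid f (f i₀)) :
    ¬ IsDifferenceCube 16 6 2 (cubeOf e f) := by
  intro hd
  obtain ⟨G', _, _, e', b, hG, hb, hp⟩ := exists_diffSet_of_isDifferenceCube hd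
  obtain ⟨γ, α, hα⟩ := Paratopic.symm hp
  have h0 := Thin.of_paratopic hα (thin_cubeOf e' _)
  have h2 := Thin.of_paratopic hα (thin_diffCube e' b)
  have h0' : γ 0 = 0 := by_contra fun h' => hf.not_thin e h h' h0
  have h2' : γ 2 = 0 := by_contra fun h' => hf.not_thin e h h' h2
  exact absurd (γ.injective (h0'.trans h2'.symm)) (by decide)

theorem exists_heapish_of_paratopic_cubeOf [Fintype G₁] [Fintype G₂]
    (hG₁ : Fintype.card G₁ = 16) (e₁ : Fin 16 ≃ G₁) (e₂ : Fin 16 ≃ G₂)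
    {f₁ : Fin 16 → G₁ → Bool} {f₂ : Fin 16 → G₂ → Bool} (hf₁ : IsDesign f₁) (hf₂ : IsDesign f₂)
    {i₂ : Fin 16} (hr₂ : Rigid f₂ (f₂ i₂))
    (hp : Paratopic 16 3 (cubeOf e₁ f₁) (cubeOf e₂ f₂)) :
    ∃ (h : G₂ ≃ G₁) (σ : Equiv.Perm (Fin 16)), Heapish h ∧ ∀ i p, f₂ i p = f₁ (σ i) (h p) := by
  obtain ⟨γ, α, hα⟩ := hp
  have h0 : γ 0 = 0 := by_contra fun h' => hf₂.not_thin e₂ hr₂ h'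
    (Thin.of_paratopic hα (thin_cubeOf e₁ _))
  have hite : ∀ b c : Bool, (if b then (1 : ℤ) else 0) = (if c then 1 else 0) → b = c := by decide
  have sep : ∀ p q, (∀ a, f₁ a p = f₁ a q) → p = q := by
    intro p q h
    by_contra hpq
    have := (hf₁.cover hG₁).2 p q hpq
    simp [h, (hf₁.cover hG₁).1] at this
  have h12 : (γ 1 = 1 ∧ γ 2 = 2) ∨ (γ 1 = 2 ∧ γ 2 = 1) := by
    have h1 : γ 1 ≠ γ 0 := fun h => absurd (γ.injective h) (by decide)
    have h2 : γ 2 ≠ γ 0 := fun h => absurd (γ.injective h) (by decide)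
    have h3 : γ 1 ≠ γ 2 := fun h => absurd (γ.injective h) (by decide)
    omega
  set u : G₂ ≃ G₁ := e₂.symm.trans ((α 1).trans e₁) with hu
  set v : G₂ ≃ G₁ := e₂.symm.trans ((α 2).trans e₁) with hv
  have key : ∀ i : Fin 3 → Fin 16, f₂ (i 0) (e₂ (i 1) * e₂ (i 2)) =
      f₁ (α 0 (i (γ 0))) (u (e₂ (i (γ 1))) * v (e₂ (i (γ 2)))) := fun i => hite _ _ (by
    simpa [cubeOf, hu, hv] using hα i)
  rcases h12 with ⟨h1, h2⟩ | ⟨h1, h2⟩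
  · obtain ⟨hh, hf⟩ := isHeap_of_isotopy (F₁ := f₁) (F₂ := f₂) (α 0).surjective (u := u) (v := v) sep
      fun a y z => by simpa [h0, h1, h2] using key ![a, e₂.symm y, e₂.symm z]
    exact ⟨u.trans (Equiv.mulRight (v 1)), α 0, Or.inl hh, hf⟩
  · obtain ⟨hh, hf⟩ := isAnti_of_isotopy (F₁ := f₁) (F₂ := f₂) (α 0).surjective (u := u) (v := v) sep
      fun a y z => by simpa [h0, h1, h2] using key ![a, e₂.symm y, e₂.symm z]
    exact ⟨u.trans (Equiv.mulRight (v 1)), α 0, Or.inr hh, hf⟩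

theorem exists_heapish_of_paratopic_diffCube [Fintype G₁] (e₁ : Fin 16 ≃ G₁) (e₂ : Fin 16 ≃ G₂)
    {b₁ : G₁ → Bool} {b₂ : G₂ → Bool} (hb₁ : IsDiffSet b₁)
    (hp : Paratopic 16 3 (diffCube e₁ b₁) (diffCube e₂ b₂)) :
    ∃ h : G₂ ≃ G₁, Heapish h ∧ ∀ p, b₂ p = b₁ (h p) := by
  obtain ⟨γ, α, hα⟩ := hp
  have hite : ∀ b c : Bool, (if b then (1 : ℤ) else 0) = (if c then 1 else 0) → b = c := by decide
  set A : Fin 3 → (G₂ ≃ G₁) := fun t => e₂.symm.trans ((α t).trans e₁) with hA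
  have key : ∀ x : Fin 3 → G₂, b₂ (x 0 * x 1 * x 2) =
      b₁ (A 0 (x (γ 0)) * A 1 (x (γ 1)) * A 2 (x (γ 2))) := fun x => hite _ _ (by
    simpa [diffCube, cubeOf, mul_assoc, hA] using hα fun t => e₂.symm (x t))
  have sepl : ∀ p q, (∀ a, b₁ (a * p) = b₁ (a * q)) → p = q := fun p q h =>
    inv_mul_eq_one.mp (hb₁.eq_one_of_mul_right fun x => by simpa [mul_assoc] using (h (x * p⁻¹)).symm)
  have sepr : ∀ p q, (∀ a, b₁ (p * a) = b₁ (q * a)) → p = q := fun p q h =>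
    mul_inv_eq_one.mp (hb₁.eq_one_of_mul_left fun x => by simpa [mul_assoc] using (h (q⁻¹ * x)))
  have h01 : γ 0 ≠ γ 1 := fun h => absurd (γ.injective h) (by decide)
  have h02 : γ 0 ≠ γ 2 := fun h => absurd (γ.injective h) (by decide)
  have h12 : γ 1 ≠ γ 2 := fun h => absurd (γ.injective h) (by decide)
  have hcases : (γ 0 = 0 ∧ γ 1 = 1 ∧ γ 2 = 2) ∨ (γ 0 = 0 ∧ γ 1 = 2 ∧ γ 2 = 1) ∨
      (γ 0 = 2 ∧ γ 1 = 1 ∧ γ 2 = 0) ∨ (γ 0 = 1 ∧ γ 1 = 2 ∧ γ 2 = 0) ∨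
      (γ 0 = 1 ∧ γ 1 = 0 ∧ γ 2 = 2) ∨ (γ 0 = 2 ∧ γ 1 = 0 ∧ γ 2 = 1) := by omega
  have left : ∀ (u v C : G₂ ≃ G₁), Heapish (fun p => u p * v 1) →
      (∀ a p, b₂ (a * p) = b₁ (C a * (u p * v 1))) → ∃ h : G₂ ≃ G₁, Heapish h ∧ ∀ p, b₂ p = b₁ (h p) :=
    fun u v C hh hf => ⟨(u.trans (Equiv.mulRight (v 1))).trans (Equiv.mulLeft (C 1)),
      (Heapish.mul_left (C 1)).comp hh, fun p => by simpa using hf 1 p⟩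
  have left' : ∀ (u v C : G₂ ≃ G₁), Heapish (fun p => u p * v 1) →
      (∀ a p, b₂ (p * a) = b₁ (C a * (u p * v 1))) → ∃ h : G₂ ≃ G₁, Heapish h ∧ ∀ p, b₂ p = b₁ (h p) :=
    fun u v C hh hf => ⟨(u.trans (Equiv.mulRight (v 1))).trans (Equiv.mulLeft (C 1)),
      (Heapish.mul_left (C 1)).comp hh, fun p => by simpa using hf 1 p⟩
  have right : ∀ (u v C : G₂ ≃ G₁), Heapish (fun p => u p * v 1) →
      (∀ a p, b₂ (a * p) = b₁ (u p * v 1 * C a)) → ∃ h : G₂ ≃ G₁, Heapish h ∧ ∀ p, b₂ p = b₁ (h p) :=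
    fun u v C hh hf => ⟨(u.trans (Equiv.mulRight (v 1))).trans (Equiv.mulRight (C 1)),
      (Heapish.mul_right (C 1)).comp hh, fun p => by simpa using hf 1 p⟩
  have right' : ∀ (u v C : G₂ ≃ G₁), Heapish (fun p => u p * v 1) →
      (∀ a p, b₂ (p * a) = b₁ (u p * v 1 * C a)) → ∃ h : G₂ ≃ G₁, Heapish h ∧ ∀ p, b₂ p = b₁ (h p) :=
    fun u v C hh hf => ⟨(u.trans (Equiv.mulRight (v 1))).trans (Equiv.mulRight (C 1)),
      (Heapish.mul_right (C 1)).comp hh, fun p => by simpa using hf 1 p⟩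
  rcases hcases with ⟨h0, h1, h2⟩ | ⟨h0, h1, h2⟩ | ⟨h0, h1, h2⟩ | ⟨h0, h1, h2⟩ | ⟨h0, h1, h2⟩ |
    ⟨h0, h1, h2⟩ <;> rw [h0, h1, h2] at key
  · obtain ⟨hh, hf⟩ := isHeap_of_isotopy (F₁ := fun a p => b₁ (a * p)) (F₂ := fun a p => b₂ (a * p))
      (A 0).surjective (u := A 1) (v := A 2) sepl
      fun a y z => by simpa [mul_assoc] using key ![a, y, z]
    exact left _ _ _ (Or.inl hh) hf
  · obtain ⟨hh, hf⟩ := isAnti_of_isotopy (F₁ := fun a p => b₁ (a * p)) (F₂ := fun a p => b₂ (a * p))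
      (A 0).surjective (u := A 1) (v := A 2) sepl
      fun a y z => by simpa [mul_assoc] using key ![a, y, z]
    exact left _ _ _ (Or.inr hh) hf
  · obtain ⟨hh, hf⟩ := isAnti_of_isotopy (F₁ := fun a p => b₁ (p * a)) (F₂ := fun a p => b₂ (a * p))
      (A 2).surjective (u := A 0) (v := A 1) sepr
      fun a y z => by simpa [mul_assoc] using key ![a, y, z]
    exact right _ _ _ (Or.inr hh) hf
  · obtain ⟨hh, hf⟩ := isHeap_of_isotopy (F₁ := fun a p => b₁ (p * a)) (F₂ := fun a p => b₂ (a * p))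
      (A 2).surjective (u := A 0) (v := A 1) sepr
      fun a y z => by simpa [mul_assoc] using key ![a, y, z]
    exact right _ _ _ (Or.inl hh) hf
  · obtain ⟨hh, hf⟩ := isAnti_of_isotopy (F₁ := fun a p => b₁ (p * a)) (F₂ := fun a p => b₂ (p * a))
      (A 2).surjective (u := A 0) (v := A 1) sepr
      fun a y z => by simpa [mul_assoc] using key ![y, z, a]
    exact right' _ _ _ (Or.inr hh) hf
  · obtain ⟨hh, hf⟩ := isHeap_of_isotopy (F₁ := fun a p => b₁ (a * p)) (F₂ := fun a p => b₂ (p * a))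
      (A 0).surjective (u := A 1) (v := A 2) sepl
      fun a y z => by simpa [mul_assoc] using key ![y, z, a]
    exact left' _ _ _ (Or.inl hh) hf

end Equivalence

end GroupCubes

noncomputable section

namespace GroupCubes

local notation "sel(" b "," t "," e ")" => @Bool.rec (fun _ => _) e t b

/-- `force n f = f n`, arranged so that the kernel evaluates `n` to a literal first. -/
def force {α : Type} (n : ℕ) (f : ℕ → α) : α :=
  @Nat.rec (fun _ => α) (f 0) (fun k _ => f k) (Nat.succ n)

def kmap {α β : Type} (f : α → β) (l : List α) : List β :=
  @List.rec α (fun _ => List β) [] (fun a _ ih => f a :: ih) l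

def kapp {α : Type} (l l' : List α) : List α :=
  @List.rec α (fun _ => List α) l' (fun a _ ih => a :: ih) l

def kflat {α β : Type} (f : α → List β) (l : List α) : List β :=
  @List.rec α (fun _ => List β) [] (fun a _ ih => kapp (f a) ih) l

def kall {α : Type} (f : α → Bool) (l : List α) : Bool :=
  @List.rec α (fun _ => Bool) true (fun a _ ih => sel(f a, ih, false)) l

def kany {α : Type} (f : α → Bool) (l : List α) : Bool :=
  @List.rec α (fun _ => Bool) false (fun a _ ih => sel(f a, true, ih)) l

def kfilter {α : Type} (f : α → Bool) (l : List α) : List α :=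
  @List.rec α (fun _ => List α) [] (fun a _ ih => sel(f a, a :: ih, ih)) l

def ksum {α : Type} (f : α → ℕ) (l : List α) : ℕ :=
  @List.rec α (fun _ => ℕ) 0 (fun a _ ih => Nat.lor (f a) ih) l

def klen {α : Type} (l : List α) : ℕ :=
  @List.rec α (fun _ => ℕ) 0 (fun _ _ ih => Nat.succ ih) l

/-- evaluate all entries of a list before continuing -/
def forceList {α : Type} (l : List ℕ) : (List ℕ → α) → α :=
  @List.rec ℕ (fun _ => (List ℕ → α) → α) (fun k => k [])
    (fun a _ ih k => force a fun a' => ih fun l' => k (a' :: l')) l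

/-- evaluate all entries of a list, each with a given evaluator -/
def forceAll {α β : Type} (fa : α → (α → β) → β) (l : List α) : (List α → β) → β :=
  @List.rec α (fun _ => (List α → β) → β) (fun k => k [])
    (fun a _ ih k => fa a fun a' => ih fun l' => k (a' :: l')) l

def pts : List ℕ := [0,1,2,3,4,5,6,7,8,9,10,11,12,13,14,15]

def tmul (T x y : ℕ) : ℕ :=
  Nat.land (Nat.shiftRight T (Nat.add (Nat.mul 64 x) (Nat.mul 4 y))) 15

def app (h x : ℕ) : ℕ := Nat.land (Nat.shiftRight h (Nat.mul 4 x)) 15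

def bit (n : ℕ) : ℕ := Nat.shiftLeft 1 n

def mem (m x : ℕ) : Bool := Nat.beq (Nat.land (Nat.shiftRight m x) 1) 1

def code (f : ℕ → ℕ) : ℕ := ksum (fun x => Nat.shiftLeft (f x) (Nat.mul 4 x)) pts

def maskOf (l : List ℕ) : ℕ := ksum bit l

/-- bits at which exactly two of the words are set -/
def exactTwo (ws : List ℕ) : ℕ :=
  @List.rec ℕ (fun _ => ℕ → ℕ → ℕ → ℕ) (fun _ b c => Nat.xor b c)
    (fun w _ ih a b c => force (Nat.lor c (Nat.land b w)) fun c' =>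
      force (Nat.lor b (Nat.land a w)) fun b' => force (Nat.lor a w) fun a' => ih a' b' c')
    ws 0 0 0

structure Word where
  v : ℕ
  x : ℕ
  y : ℕ
  z : ℕ

/-- `x y⁻¹ z` -/
def tern (T I x y z : ℕ) : ℕ := tmul T (tmul T x (app I y)) z

def invCode (T : ℕ) : ℕ :=
  ksum (fun x => ksum (fun y => sel(Nat.beq (tmul T x y) 0, Nat.shiftLeft y (Nat.mul 4 x), 0)) pts) pts

def setv (h v i : ℕ) : ℕ := Nat.lor h (Nat.shiftLeft i (Nat.mul 4 v))

def extend (T I A B : ℕ) (anti : Bool) (ws : List Word) : ℕ → List ℕ :=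
  @List.rec Word (fun _ => ℕ → List ℕ) (fun h => [h])
    (fun w _ ih h =>
      force (sel(anti, tern T I (app h w.z) (app h w.y) (app h w.x),
          tern T I (app h w.x) (app h w.y) (app h w.z))) fun i =>
        sel(Nat.beq (Nat.land (Nat.shiftRight A w.v) 1) (Nat.land (Nat.shiftRight B i) 1),
          force (setv h w.v i) ih, [])) ws

def search (T I A B : ℕ) (imgs : List ℕ) (ws : List Word) (anti : Bool) (base : List ℕ) : ℕ → List ℕ :=
  @List.rec ℕ (fun _ => ℕ → List ℕ) (extend T I A B anti ws)
    (fun b _ ih h => kflat (fun i => force (setv h b i) ih) imgs) base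

def isPerm (h : ℕ) : Bool := Nat.beq (ksum (fun x => bit (app h x)) pts) 65535

def isHeapMap (T I h : ℕ) (anti : Bool) : Bool :=
  kall (fun x => kall (fun y => Nat.beq (app h (tmul T x y))
    (sel(anti, tern T I (app h y) (app h 0) (app h x), tern T I (app h x) (app h 0) (app h y)))) pts) pts

def commTable (T : ℕ) : Bool :=
  kall (fun x => kall (fun y => Nat.beq (tmul T x y) (tmul T y x)) pts) pts

def modes (T : ℕ) : List Bool := sel(commTable T, [false], [false, true])

structure S3 where
  a : ℕ
  b : ℕ
  c : ℕ

/-- A difference set with points `Dl`, maps `trans` used to list its images, the pairs of its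
points, and auxiliary choices for the computations. -/
structure Orbit where
  D : ℕ
  Dl : List ℕ
  trans : List ℕ
  pairs : List ℕ
  key : List S3
  base : List ℕ
  words : List Word

structure Ent where
  mask : ℕ
  els : List ℕ
  us : List ℕ

structure Item where
  bit : ℕ
  adj : ℕ
  contrib : ℕ
  us : List (List ℕ)

def forceEnt {α : Type} (e : Ent) (k : Ent → α) : α :=
  force e.mask fun m => forceList e.els fun l => forceList e.us fun u => k ⟨m, l, u⟩

def entries (T : ℕ) (o : Orbit) (flag : Bool) : List Ent :=
  kflat (fun p => kmap (fun a => force (code fun x => tmul T (app p x) a) fun u =>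
    Ent.mk (ksum (fun x => bit (app u x)) o.Dl) (kmap (app u) o.Dl) (sel(flag, [u], []))) pts) o.trans

structure BEnt where
  bit : ℕ
  ent : Ent

/-- attach the bits `b, 2b, 4b, …` -/
def enum (l : List Ent) : ℕ → List BEnt :=
  @List.rec Ent (fun _ => ℕ → List BEnt) (fun _ => [])
    (fun e _ ih b => BEnt.mk b e :: force (Nat.mul 2 b) ih) l

def forceBEnt {α : Type} (e : BEnt) (k : BEnt → α) : α :=
  force e.bit fun b => forceEnt e.ent fun e' => k ⟨b, e'⟩

def column (V : List BEnt) (x : ℕ) : ℕ :=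
  ksum (fun e => sel(mem e.ent.mask x, e.bit, 0)) V

def nth (l : List ℕ) (n : ℕ) : ℕ :=
  @List.rec ℕ (fun _ => ℕ → ℕ) (fun _ => 0)
    (fun a _ ih n => @Nat.rec (fun _ => ℕ) a (fun k _ => ih k) n) l n

def position (x : ℕ) : ℕ := Nat.add 64 (Nat.mul 16 x)

def shifts (u : ℕ) : List ℕ := kmap (fun x => position (app u x)) pts

/-- block `lab` with elements `els` inside an incidence word; the 64 low bits are a mere tag -/
def contribution (lab : ℕ) (els : List ℕ) (tag : ℕ) : ℕ :=
  Nat.lor (Nat.land tag 18446744073709551615)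
    (Nat.shiftLeft (ksum (fun x => bit (Nat.add (Nat.mul 16 x) lab)) els) 64)

def mkItem (cols : List ℕ) (lab : ℕ) (e : BEnt) : Item :=
  ⟨e.bit, exactTwo (kmap (nth cols) e.ent.els),
    contribution lab e.ent.els (Nat.shiftLeft (Nat.mod e.ent.mask 16) (Nat.mul 4 lab)), kmap shifts e.ent.us⟩

def forceItem {α : Type} (e : Item) (k : Item → α) : α :=
  force e.bit fun b => force e.adj fun a => force e.contrib fun c =>
    forceAll forceList e.us fun u => k ⟨b, a, c, u⟩

/-- the parts, the first one with the smallest label -/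
def parts (V : List BEnt) (cols : List ℕ) (D : ℕ) (prs : List ℕ) : ℕ → List (List Item) :=
  @List.rec ℕ (fun _ => ℕ → List (List Item)) (fun _ => [])
    (fun p _ ih lab => kmap (mkItem cols lab) (kfilter (fun e => Nat.beq (Nat.land e.ent.mask D) p) V)
      :: force (Nat.succ lab) ih) prs

def dfs {β : Type} (leaf : ℕ → List (List ℕ) → List β) (ps : List (List Item)) :
    ℕ → ℕ → List (List ℕ) → List β :=
  @List.rec (List Item) (fun _ => ℕ → ℕ → List (List ℕ) → List β) (fun _ P us => leaf P us)
    (fun part _ ih c P us => @List.rec Item (fun _ => List β) []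
      (fun it _ rest => @Nat.rec (fun _ => List β) rest
        (fun _ _ => kapp (force (Nat.land c it.adj) fun c' => force (Nat.lor P it.contrib) fun P' =>
          ih c' P' (kapp it.us us)) rest) (Nat.land c it.bit)) part) ps

/-- the incidence word with points renamed -/
def rename (P : ℕ) (us : List ℕ) : ℕ :=
  Nat.lor (Nat.land P 18446744073709551615) (Nat.shiftLeft (@List.rec ℕ (fun _ => ℕ) 0
    (fun s _ ih => Nat.lor (Nat.land (Nat.shiftRight P s) 65535) (Nat.shiftLeft ih 16)) us) 64)

def keyBit (Q : ℕ) (s : S3) : Bool :=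
  Nat.beq (Nat.land (Nat.land (Nat.shiftRight Q s.a) (Nat.shiftRight Q s.b))
    (Nat.land (Nat.shiftRight Q s.c) 65535)) 0

def keyLt (Q : ℕ) (ss : List S3) : List Bool → Bool :=
  @List.rec S3 (fun _ => List Bool → Bool) (fun _ => false)
    (fun s _ ih own => @List.rec Bool (fun _ => Bool) false
      (fun b bs _ => sel(keyBit Q s, sel(b, ih bs, false), sel(b, true, ih bs))) own) ss

def canonical (keys : List (List S3)) (own : List Bool) (P : ℕ) (us : List (List ℕ)) : Bool :=
  kall (fun u => force (rename P u) fun Q => kall (fun ss => sel(keyLt Q ss own, false, true)) keys) us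

/-- some block contains the points at the given shifts -/
def blockOn (P : ℕ) (l : List ℕ) : Bool :=
  sel(Nat.beq (@List.rec ℕ (fun _ => ℕ) 65535 (fun s _ ih => Nat.land (Nat.shiftRight P s) ih) l) 0,
    false, true)

def nondiff (tr tl : List (List ℕ)) (P : ℕ) : Bool :=
  sel(kall (blockOn P) tr, false, sel(kall (blockOn P) tl, false, true))

def forceS3 {α : Type} (e : S3) (k : S3 → α) : α :=
  force e.a fun a => force e.b fun b => force e.c fun c => k ⟨a, b, c⟩

/-- the maps that respect or reverse `x y⁻¹ z` and send the first difference set to the second -/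
def transporters (T I : ℕ) (o o' : Orbit) : List ℕ :=
  kflat (fun m => kfilter (fun h => sel(isPerm h, sel(isHeapMap T I h m,
      kall (fun x => Nat.beq (Nat.land (Nat.shiftRight o.D x) 1)
        (Nat.land (Nat.shiftRight o'.D (app h x)) 1)) pts, false), false))
    (search T I o.D o'.D o'.Dl o.words m o.base 0)) (modes T)

def triples (key : List S3) (k : ℕ) : List S3 :=
  kmap (fun s => S3.mk (position (app k s.a)) (position (app k s.b)) (position (app k s.c))) key

def leaf (key : List S3) (keys : List (List S3)) (tr tl : List (List ℕ)) (P : ℕ)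
    (us : List (List ℕ)) : List ℕ :=
  sel(canonical keys (kmap (keyBit P) key) P us, sel(nondiff tr tl P, [P], []), [])

def identity : ℕ := code fun x => x

/-- Incidence words for the designs with blocks in the orbits `o :: later`, one of which is the
first difference set itself. -/
def reps (T : ℕ) (o : Orbit) (later : List Orbit) : List ℕ :=
  forceAll forceBEnt (enum (kapp (entries T o true)
    (kflat (fun o' => entries T o' false) later)) 1) fun V =>
  forceList (kmap (column V) pts) fun cols =>
  forceAll (forceAll forceItem) (parts V cols o.D o.pairs 0) fun ps =>
  force (invCode T) fun I =>
  forceList (transporters T I o o) fun K =>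
  forceAll (forceAll forceS3) (kmap (triples o.key) K) fun keys =>
  forceAll forceS3 (triples o.key identity) fun key =>
  forceAll forceList (kmap (fun a => kmap (fun d => position (tmul T d a)) o.Dl) pts) fun tr =>
  forceAll forceList (kmap (fun a => kmap (fun d => position (tmul T a d)) o.Dl) pts) fun tl =>
  force (ksum (fun e => e.bit) V) fun c =>
  forceList (shifts identity) fun i0 =>
  dfs (leaf key keys tr tl) ps c (contribution 15 o.Dl 0) [i0]

def keyNum (key : List S3) (P : ℕ) : ℕ :=
  @List.rec S3 (fun _ => ℕ) 1 (fun s _ ih => Nat.add (Nat.mul 2 ih) (sel(keyBit P s, 1, 0))) key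

def distinct (l : List ℕ) : Bool :=
  @List.rec ℕ (fun _ => Bool) true
    (fun a l ih => sel(kall (fun b => sel(Nat.beq a b, false, true)) l, ih, false)) l

def checkRun (T : ℕ) (o : Orbit) (later : List Orbit) (n : ℕ) : Bool :=
  forceList (kmap (keyNum (triples o.key identity)) (reps T o later)) fun l =>
    sel(Nat.beq (klen l) n, distinct l, false)

/-- the word whose bit `m`, for `m < 2 ^ n`, is bit `x` of `m` -/
def bitTable (x n : ℕ) : ℕ :=
  @Nat.rec (fun _ => ℕ) 0 (fun k ih => force ih fun w =>
    sel(Nat.beq k x, Nat.shiftLeft (Nat.sub (Nat.pow 2 (Nat.pow 2 x)) 1) (Nat.pow 2 x),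
      Nat.lor w (Nat.shiftLeft w (Nat.pow 2 k)))) n

/-- the word whose bit `m` tells whether the set with mask `m` is a difference set -/
def diffSetTable (T : ℕ) : ℕ :=
  forceList (kmap (fun x => bitTable x 16) pts) fun V =>
    @List.rec ℕ (fun _ => ℕ) (Nat.sub (Nat.pow 2 65536) 1)
      (fun g _ ih => Nat.land (exactTwo (kmap (fun x => Nat.land (nth V x) (nth V (tmul T x g))) pts)) ih)
      [1,2,3,4,5,6,7,8,9,10,11,12,13,14,15]

def validTable (T : ℕ) : Bool :=
  force (invCode T) fun I => kall (fun x =>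
    sel(Nat.beq (tmul T 0 x) x, sel(Nat.beq (tmul T x 0) x, sel(Nat.beq (tmul T (app I x) x) 0,
      kall (fun y => force (tmul T x y) fun xy => kall (fun z =>
        Nat.beq (tmul T xy z) (tmul T x (tmul T y z))) pts) pts, false), false), false)) pts

/-- every point is obtained from the known ones by the words -/
def wordsOk (T I : ℕ) (ws : List Word) : ℕ → Bool :=
  @List.rec Word (fun _ => ℕ → Bool) (fun known => Nat.beq known 65535)
    (fun w _ ih known => sel(mem known w.x, sel(mem known w.y, sel(mem known w.z,
      sel(Nat.beq (tern T I w.x w.y w.z) w.v, force (Nat.lor known (bit w.v)) ih, false),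
      false), false), false)) ws

def orbitOk (T I : ℕ) (o : Orbit) : Bool :=
  sel(Nat.beq (maskOf o.Dl) o.D, sel(distinct o.Dl, sel(Nat.beq (klen o.Dl) 6,
  sel(kall (fun x => Nat.blt x 16) o.Dl,
  sel(kall (fun p => sel(isPerm p, sel(isHeapMap T I p false, true, isHeapMap T I p true), false))
    o.trans,
  sel(distinct o.pairs, sel(Nat.beq (klen o.pairs) 15,
  sel(kall (fun p => kany (fun a => kany (fun b => sel(Nat.beq a b, false,
    Nat.beq p (Nat.lor (bit a) (bit b)))) o.Dl) o.Dl) o.pairs,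
  sel(kall (fun s => sel(Nat.blt s.a 16, sel(Nat.blt s.b 16, Nat.blt s.c 16, false), false)) o.key,
  sel(kall (mem o.D) o.base, wordsOk T I o.words (maskOf o.base), false), false), false), false),
  false), false), false), false), false), false)

/-- the orbits are pairwise different and cover all difference sets -/
def orbitsOk (T : ℕ) (os : List Orbit) : Bool :=
  force (invCode T) fun I => sel(kall (orbitOk T I) os,
    sel(@List.rec Orbit (fun _ => Bool) true (fun o os ih =>
      sel(kall (fun o' => @List.rec ℕ (fun _ => Bool) true (fun _ _ _ => false)
        (transporters T I o o')) os, ih, false)) os,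
      Nat.beq (diffSetTable T) (ksum (fun o => ksum (fun e => bit e.mask) (entries T o false)) os),
      false), false)

def table0 : ℕ :=
  11332695836517795792476032630904196393912297908610046869244532278608350611111126337584351325330412323323857750160425534146747600449609013127307951211487622509405540403493066490671197921302404410988532278806760192553359385032687856607639809372800435327499715930759536504665237303522130017675196974010922709520

def table1 : ℕ :=
  83093371600454168580691816681585574524154650355161477883268256427874411921770368907189382439546514424965845220326551668635492903425187821500612927806069208370419702252691552071631029166252401175530385681562163358946304185358651389521421218281321015049402593727647121408891526581775911331906096644949001122320

def table2 : ℕ :=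
  11373478871667377269191434703482586488030283279249305695549444795845812091389459736052405861169742612645604613261551312110355485894609889736067509643691141248591814811377960753748274295435926405708748874218870287644963027692678796933068028644123023381205515681148178479761314677055992726088816252129100706320

def table3 : ℕ :=
  24581846811245409650922088293221278041717778398008375515133256367134762255871550499888399801604329343028081828141693053138329124793902712322453480598125458136477359570133116703055646103483267991047784242064583222455247394953650913328385496179744795244048010953384310382312247129017352538122580238862369698320

def table4 : ℕ :=
  35156189599717092124023018514216091475502370391418728506761772292685952839543235459000022608444320056998008729948969534834920346539209567772047207047994744051584562029065850841000660534821371702056338186082399929935242753014033617435202279926120213547762604949435448594740776664684220680350073516963906466320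

def table5 : ℕ :=
  48735995370139169549377088458200479561226913409584029704459292130403863654801451860715708068027436782161733904815848654679019053579935463653075985084735682708656872475624505189994793508867341417009590577548352691642658243717487378997625984861469204660391642685626797492688155346185518886297102889939511816720

def table6 : ℕ :=
  59310660866867156949081302449095987122192874042148010655906501581851247090440273182119391181536379029204776064296536509501444585516045881608050459571711925365802437463304130087839855851851214552178844943854034097848986606375077172729412757563624459379274147231299587589864056968247502150616579175642704392720

def table7 : ℕ :=
  11373478871667377269191434703482586488070191215840223273331833505273042785645524124900973921707525807692282209411941183883498226832634502695745844708254504526899407440182330496443125413155001324236893866866549375426412680501103771326188361417720260535218642178619551402208724715090817176661613273909438984720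

def table8 : ℕ :=
  799136083195694796090504482487773054276766486367719848576088197273947748276650627860246310786152559346434615336651425746894124726665463134842065977957166005352168992638403023933136997295373361002719138321225910903400707556899845969155289960142248422689351902080873303864643795033117575456363259537900450320

def table9 : ℕ :=
  35156350951383175981482630039640606166869463051819018581728075218038820747114397441497567646634121692598502655835532756216782171966787468572453847577267965933999038152150246176909747830573803008570483214066164850234123978529140739974022269195891734168769436531985437168016723144932262472161325767532725154320

def table10 : ℕ :=
  11373640223333461126651046228907101179397375939649595770515747721198679998960621718549950899359544248246098539148114533492217311322187790536474150172964363130982222253139419789554714242375611841080168811383753908732877621721863486158719745321795057320924513325107781719491605641181879143603316282825045717520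

def table11 : ℕ :=
  799136083195694796090504482487773054347749623487404571013636233680504683091499543034634143359845228859489830770560427868365969022396852535275002176394652748986496586016240371467665784190321312736268605950265658297689516377824598525714430177945219495220605346413320882016677238571335099357472742181002555920

def table12 : ℕ :=
  11373640223333461126651046228907101179397375939649595770515747721198679998960530393956307414939053062041719254549256531749696958817916519269212597276059142449848232733779193527727026251976285649103684366919653389333105321089694531701247607947315924046875984724004426985637648311438919586808347688850618069520

def table13 : ℕ :=
  798974726605473726946832238011593618400339158202517049033210936078539962612148351302787556971974837864606271200763683943951953866025539096785282858647326000342156170857478456413950631519959977197563975844721619162716127815821009475742892049151496040916675244806998969647283770674449648040311876430683451920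

def orbit0 : Orbit where
  D := 44192
  Dl := [5, 7, 10, 11, 13, 15]
  trans := [18364758544493064720, 14839267968517681680, 17283857396557689360,
    14843452855801885200, 9924524951695798800, 12364896507102769680, 11005351624898261520,
    12360637145085653520]
  pairs := [9216, 40960, 10240, 34816, 1056, 2080, 2176, 1152, 33792, 32800, 32896, 3072, 8320,
    160, 8224]
  key := [⟨13, 7, 2⟩, ⟨13, 10, 1⟩, ⟨11, 7, 2⟩, ⟨13, 5, 8⟩, ⟨11, 7, 0⟩, ⟨15, 11, 3⟩, ⟨15, 13, 0⟩,
    ⟨11, 5, 1⟩, ⟨13, 11, 8⟩, ⟨10, 5, 3⟩]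
  base := [5, 10, 13]
  words := [⟨11, 5, 10, 5⟩, ⟨15, 10, 13, 10⟩, ⟨7, 5, 13, 15⟩, ⟨0, 5, 10, 13⟩, ⟨4, 5, 10, 11⟩, ⟨2,
    5, 10, 15⟩, ⟨8, 5, 10, 7⟩, ⟨12, 5, 10, 0⟩, ⟨14, 5, 10, 2⟩, ⟨6, 5, 10, 8⟩, ⟨1, 5, 10, 12⟩, ⟨3,
    5, 10, 14⟩, ⟨9, 5, 10, 6⟩]

def orbit1 : Orbit where
  D := 27808
  Dl := [5, 7, 10, 11, 13, 14]
  trans := [18364758544493064720, 15924370431987167760, 17283857396557689360,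
    15920111069970051600, 9924524951695798800, 13441554721270936080, 11005351624898261520,
    13445739608555139600]
  pairs := [2176, 160, 9216, 10240, 3072, 24576, 2080, 17408, 1152, 16512, 1056, 16416, 18432,
    8224, 8320]
  key := [⟨10, 5, 1⟩, ⟨14, 11, 0⟩, ⟨13, 5, 9⟩]
  base := [5, 10, 13]
  words := [⟨11, 5, 10, 5⟩, ⟨14, 10, 13, 11⟩, ⟨7, 5, 14, 13⟩, ⟨0, 5, 10, 13⟩, ⟨4, 5, 10, 11⟩, ⟨3,
    5, 10, 14⟩, ⟨8, 5, 10, 7⟩, ⟨12, 5, 10, 0⟩, ⟨15, 5, 10, 3⟩, ⟨6, 5, 10, 8⟩, ⟨1, 5, 10, 12⟩, ⟨2,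
    5, 10, 15⟩, ⟨9, 5, 10, 6⟩]

def orbit2 : Orbit where
  D := 47240
  Dl := [3, 7, 11, 12, 13, 15]
  trans := [18364758544493064720, 17279672509273485840, 18364741987394138640,
    17279655952174559760, 15924333259045220880, 14839247223825642000, 15924316701946294800,
    14839230666726715920, 13445776910346105360, 12360690875126526480, 13445760353247179280,
    12360674318027600400, 11005351624898261520, 9920265589678682640, 11005335067799335440,
    9920249032579756560, 15924370495843480080, 14839284460623901200, 15924353938744554000,
    14839267903524975120, 18364721306558411280, 17279635271338832400, 18364704749459485200,
    17279618714239906320, 11005388861696520720, 9920302826476941840, 11005372304597594640,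
    9920286269378015760, 13445739672411451920, 12360653637191873040, 13445723115312525840,
    12360637080092946960]
  pairs := [10240, 8320, 40960, 8200, 12288, 32776, 2056, 2176, 136, 34816, 36864, 32896, 4224,
    6144, 4104]
  key := [⟨15, 3, 4⟩, ⟨12, 7, 0⟩, ⟨13, 3, 6⟩, ⟨11, 3, 0⟩, ⟨15, 11, 0⟩, ⟨13, 12, 14⟩, ⟨15, 3, 0⟩,
    ⟨12, 3, 1⟩, ⟨15, 12, 5⟩, ⟨15, 13, 0⟩, ⟨15, 7, 10⟩, ⟨15, 11, 10⟩, ⟨13, 12, 5⟩, ⟨15, 12, 8⟩,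
    ⟨12, 7, 4⟩, ⟨7, 3, 4⟩, ⟨7, 3, 9⟩, ⟨15, 12, 4⟩, ⟨13, 7, 1⟩, ⟨13, 3, 8⟩]
  base := [3, 7, 11, 12]
  words := [⟨15, 3, 7, 11⟩, ⟨13, 3, 12, 3⟩, ⟨6, 3, 7, 3⟩, ⟨9, 3, 7, 12⟩, ⟨10, 3, 7, 15⟩, ⟨8, 3, 7,
    13⟩, ⟨2, 3, 7, 6⟩, ⟨14, 3, 7, 10⟩, ⟨4, 3, 11, 12⟩, ⟨0, 3, 7, 4⟩, ⟨5, 3, 7, 0⟩, ⟨1, 3, 7, 5⟩]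

def orbit3 : Orbit where
  D := 27328
  Dl := [6, 7, 9, 11, 13, 14]
  trans := [18364758544493064720, 17279672509273485840, 13445776910346105360,
    12360690875126526480, 18364683486789906960, 17279597451570328080, 8526720218495988240,
    7441634183276409360, 13445626794939789840, 12360540759720210960, 8526645160792830480,
    7441559125573251600]
  pairs := [2560, 8704, 16512, 24576, 10240, 18432, 16896, 192, 8320, 8256, 16448, 2112, 2176,
    576, 640]
  key := [⟨13, 6, 3⟩, ⟨14, 7, 2⟩, ⟨14, 13, 0⟩, ⟨11, 9, 2⟩, ⟨13, 11, 3⟩, ⟨13, 6, 1⟩, ⟨13, 7, 15⟩,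
    ⟨11, 6, 3⟩, ⟨9, 7, 5⟩]
  base := [6, 9, 11, 13]
  words := [⟨7, 9, 6, 9⟩, ⟨14, 9, 13, 11⟩, ⟨8, 6, 9, 6⟩, ⟨4, 6, 9, 11⟩, ⟨3, 6, 9, 13⟩, ⟨0, 6, 9,
    14⟩, ⟨10, 6, 9, 4⟩, ⟨12, 6, 9, 3⟩, ⟨15, 6, 9, 0⟩, ⟨5, 6, 9, 10⟩, ⟨2, 6, 9, 12⟩, ⟨1, 6, 9, 15⟩]

def orbit4 : Orbit where
  D := 27328
  Dl := [6, 7, 9, 11, 13, 14]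
  trans := [18364758544493064720, 17279672509273485840, 13445776910346105360, 12360690875126526480]
  pairs := [8256, 16448, 2176, 640, 192, 2112, 16512, 576, 24576, 8320, 2560, 10240, 16896, 18432,
    8704]
  key := [⟨14, 6, 3⟩, ⟨13, 9, 8⟩, ⟨9, 7, 2⟩, ⟨11, 7, 3⟩, ⟨11, 7, 1⟩, ⟨13, 9, 0⟩, ⟨13, 11, 1⟩, ⟨11,
    9, 5⟩, ⟨14, 9, 2⟩, ⟨14, 7, 0⟩]
  base := [6, 9, 13]
  words := [⟨11, 6, 9, 6⟩, ⟨14, 9, 13, 11⟩, ⟨7, 13, 6, 14⟩, ⟨3, 6, 9, 13⟩, ⟨4, 6, 9, 11⟩, ⟨0, 6,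
    9, 14⟩, ⟨10, 6, 9, 7⟩, ⟨15, 6, 9, 3⟩, ⟨12, 6, 9, 0⟩, ⟨5, 6, 9, 10⟩, ⟨1, 6, 9, 15⟩, ⟨2, 6, 9,
    12⟩, ⟨8, 6, 9, 5⟩]

def orbit5 : Orbit where
  D := 27808
  Dl := [5, 7, 10, 11, 13, 14]
  trans := [18364758544493064720, 17279672509273485840, 13445776910346105360, 12360690875126526480]
  pairs := [1152, 2176, 8224, 16512, 8320, 16416, 1056, 160, 24576, 10240, 17408, 3072, 2080,
    18432, 9216]
  key := [⟨11, 5, 1⟩, ⟨10, 7, 3⟩, ⟨14, 13, 1⟩, ⟨11, 5, 2⟩, ⟨14, 10, 2⟩, ⟨11, 7, 9⟩, ⟨13, 5, 2⟩,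
    ⟨14, 10, 1⟩]
  base := [5, 10, 13]
  words := [⟨7, 10, 5, 10⟩, ⟨11, 13, 10, 13⟩, ⟨8, 5, 10, 5⟩, ⟨14, 10, 13, 8⟩, ⟨3, 5, 10, 13⟩, ⟨4,
    5, 10, 11⟩, ⟨0, 5, 10, 14⟩, ⟨15, 5, 10, 3⟩, ⟨9, 5, 10, 4⟩, ⟨12, 5, 10, 0⟩, ⟨1, 5, 10, 15⟩, ⟨6,
    5, 10, 9⟩, ⟨2, 5, 10, 12⟩]

def orbit6 : Orbit where
  D := 44128
  Dl := [5, 6, 10, 11, 13, 15]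
  trans := [18364758544493064720, 17279672509273485840, 13445776910346105360, 12360690875126526480]
  pairs := [8224, 1088, 96, 2112, 2080, 32832, 1056, 32800, 9216, 8256, 34816, 40960, 10240,
    33792, 3072]
  key := [⟨15, 11, 1⟩, ⟨10, 6, 0⟩, ⟨10, 6, 7⟩, ⟨13, 6, 7⟩, ⟨11, 10, 0⟩, ⟨15, 5, 3⟩]
  base := [5, 10, 13]
  words := [⟨15, 5, 13, 5⟩, ⟨11, 13, 10, 13⟩, ⟨6, 10, 5, 11⟩, ⟨8, 5, 10, 5⟩, ⟨3, 5, 10, 13⟩, ⟨1,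
    5, 10, 15⟩, ⟨4, 5, 10, 11⟩, ⟨7, 5, 10, 8⟩, ⟨9, 5, 10, 4⟩, ⟨2, 5, 13, 10⟩, ⟨14, 5, 10, 2⟩, ⟨0,
    5, 10, 14⟩, ⟨12, 5, 10, 0⟩]

def orbit7 : Orbit where
  D := 42688
  Dl := [6, 7, 9, 10, 13, 15]
  trans := [18364758544493064720, 15924333259045220880, 18297128461571469600,
    17076915818847547680, 13306278126926176560, 12229652769257824560]
  pairs := [8256, 33792, 32896, 40960, 9216, 8320, 32832, 33280, 1536, 192, 8704, 576, 1152, 1088,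
    640]
  key := [⟨15, 7, 0⟩, ⟨13, 6, 1⟩, ⟨10, 7, 1⟩, ⟨10, 9, 0⟩, ⟨9, 6, 2⟩, ⟨13, 9, 4⟩, ⟨15, 10, 1⟩, ⟨9,
    7, 1⟩, ⟨13, 9, 0⟩, ⟨13, 7, 12⟩, ⟨10, 9, 5⟩, ⟨15, 6, 2⟩]
  base := [6, 9, 13]
  words := [⟨10, 6, 9, 6⟩, ⟨15, 6, 13, 6⟩, ⟨3, 6, 9, 13⟩, ⟨7, 9, 3, 15⟩, ⟨5, 6, 9, 10⟩, ⟨1, 6, 9,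
    15⟩, ⟨14, 6, 9, 3⟩, ⟨11, 6, 9, 7⟩, ⟨12, 6, 9, 1⟩, ⟨0, 6, 9, 14⟩, ⟨4, 6, 9, 11⟩, ⟨2, 6, 9, 12⟩,
    ⟨8, 6, 9, 4⟩]

def orbit8 : Orbit where
  D := 27328
  Dl := [6, 7, 9, 11, 13, 14]
  trans := [18364758544493064720, 15924333259045220880]
  pairs := [16896, 10240, 192, 2560, 640, 576, 8704, 2112, 18432, 2176, 8256, 16512, 16448, 8320,
    24576]
  key := [⟨9, 6, 1⟩, ⟨13, 9, 2⟩, ⟨13, 7, 0⟩]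
  base := [6, 9, 13]
  words := [⟨10, 6, 9, 6⟩, ⟨14, 9, 10, 13⟩, ⟨7, 13, 6, 14⟩, ⟨11, 6, 9, 7⟩, ⟨3, 6, 9, 13⟩, ⟨5, 6,
    9, 10⟩, ⟨0, 6, 9, 14⟩, ⟨4, 6, 9, 11⟩, ⟨8, 6, 9, 4⟩, ⟨15, 6, 13, 6⟩, ⟨1, 6, 9, 15⟩, ⟨12, 6, 9,
    1⟩, ⟨2, 6, 9, 12⟩]

def orbit9 : Orbit where
  D := 50848
  Dl := [5, 7, 9, 10, 14, 15]
  trans := [18364758544493064720, 17279655952174559760, 13441538292769366800, 12364912935101014800]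
  pairs := [1536, 32896, 160, 32800, 16416, 49152, 16512, 544, 1152, 16896, 33280, 640, 17408,
    1056, 33792]
  key := [⟨15, 5, 0⟩, ⟨14, 10, 1⟩, ⟨10, 7, 0⟩]
  base := [5, 9, 14]
  words := [⟨10, 5, 9, 5⟩, ⟨15, 9, 14, 9⟩, ⟨7, 14, 5, 14⟩, ⟨3, 5, 9, 14⟩, ⟨6, 5, 9, 10⟩, ⟨2, 5, 9,
    15⟩, ⟨8, 5, 9, 7⟩, ⟨13, 5, 9, 3⟩, ⟨12, 5, 9, 2⟩, ⟨4, 5, 9, 8⟩, ⟨0, 5, 9, 13⟩, ⟨1, 5, 9, 12⟩,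
    ⟨11, 5, 9, 4⟩]

def orbit10 : Orbit where
  D := 27328
  Dl := [6, 7, 9, 11, 13, 14]
  trans := [18364758544493064720, 17283878141249729040]
  pairs := [10240, 192, 24576, 18432, 16896, 8704, 2176, 2560, 576, 16448, 16512, 8320, 8256,
    2112, 640]
  key := [⟨14, 7, 5⟩, ⟨9, 7, 3⟩, ⟨11, 7, 1⟩, ⟨13, 9, 0⟩, ⟨11, 6, 3⟩, ⟨14, 9, 5⟩, ⟨13, 6, 3⟩, ⟨14,
    11, 4⟩, ⟨14, 9, 0⟩, ⟨13, 6, 5⟩]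
  base := [6, 9, 11]
  words := [⟨12, 6, 9, 6⟩, ⟨14, 9, 11, 12⟩, ⟨13, 9, 12, 9⟩, ⟨7, 6, 12, 13⟩, ⟨4, 6, 9, 11⟩, ⟨2, 6,
    9, 12⟩, ⟨0, 6, 9, 14⟩, ⟨3, 6, 9, 13⟩, ⟨8, 6, 9, 2⟩, ⟨10, 6, 9, 0⟩, ⟨5, 6, 9, 10⟩, ⟨15, 6, 9,
    5⟩, ⟨1, 6, 9, 15⟩]

def orbit11 : Orbit where
  D := 39616
  Dl := [6, 7, 9, 11, 12, 15]
  trans := [18364758544493064720, 17283878141249729040]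
  pairs := [576, 640, 192, 34816, 32832, 32896, 4608, 2176, 4160, 2112, 33280, 6144, 4224, 36864,
    2560]
  key := [⟨11, 6, 1⟩, ⟨15, 7, 4⟩, ⟨11, 9, 2⟩]
  base := [6, 9, 11]
  words := [⟨12, 6, 9, 6⟩, ⟨15, 6, 11, 6⟩, ⟨4, 6, 9, 11⟩, ⟨7, 9, 11, 4⟩, ⟨2, 6, 9, 12⟩, ⟨1, 6, 9,
    15⟩, ⟨14, 6, 9, 4⟩, ⟨13, 6, 9, 7⟩, ⟨8, 6, 9, 2⟩, ⟨0, 6, 9, 14⟩, ⟨3, 6, 9, 13⟩, ⟨10, 6, 9, 0⟩,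
    ⟨5, 6, 9, 10⟩]

def orbit12 : Orbit where
  D := 27808
  Dl := [5, 7, 10, 11, 13, 14]
  trans := [18364758544493064720, 17279655952174559760, 13445776910093464080,
    12360674317774959120, 17283878140998066960, 18360536355166233360, 12364896507101782800,
    13441554721269949200]
  pairs := [2080, 160, 24576, 18432, 3072, 17408, 9216, 2176, 10240, 16416, 16512, 8224, 1056,
    8320, 1152]
  key := [⟨13, 5, 2⟩, ⟨13, 11, 2⟩, ⟨10, 7, 2⟩, ⟨14, 5, 8⟩, ⟨14, 7, 1⟩, ⟨13, 5, 4⟩, ⟨11, 5, 0⟩,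
    ⟨14, 7, 0⟩, ⟨14, 11, 3⟩, ⟨7, 5, 3⟩, ⟨11, 7, 1⟩, ⟨13, 10, 0⟩]
  base := [5, 7, 10]
  words := [⟨14, 5, 10, 5⟩, ⟨11, 14, 10, 14⟩, ⟨13, 5, 11, 7⟩, ⟨8, 5, 7, 10⟩, ⟨12, 5, 7, 14⟩, ⟨9,
    5, 7, 11⟩, ⟨15, 5, 7, 13⟩, ⟨0, 5, 10, 14⟩, ⟨2, 5, 7, 0⟩, ⟨4, 5, 10, 11⟩, ⟨6, 5, 7, 4⟩, ⟨3, 5,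
    10, 13⟩, ⟨1, 5, 7, 3⟩]

def orbit13 : Orbit where
  D := 27328
  Dl := [6, 7, 9, 11, 13, 14]
  trans := [18364758544493064720, 15924333259045220880, 13445776910093464080, 11005351624645620240]
  pairs := [192, 18432, 8256, 8320, 16896, 2560, 8704, 10240, 16512, 16448, 640, 2176, 24576, 576,
    2112]
  key := [⟨9, 7, 1⟩, ⟨13, 6, 4⟩, ⟨13, 11, 0⟩, ⟨14, 9, 4⟩, ⟨13, 7, 2⟩, ⟨13, 9, 5⟩, ⟨11, 7, 5⟩, ⟨14,
    11, 1⟩, ⟨9, 6, 2⟩, ⟨14, 7, 3⟩]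
  base := [6, 9, 11]
  words := [⟨13, 6, 9, 6⟩, ⟨14, 9, 13, 11⟩, ⟨7, 11, 6, 14⟩, ⟨4, 6, 9, 11⟩, ⟨3, 6, 9, 13⟩, ⟨0, 6,
    9, 14⟩, ⟨12, 6, 9, 7⟩, ⟨15, 6, 9, 4⟩, ⟨8, 6, 9, 3⟩, ⟨2, 6, 9, 12⟩, ⟨1, 6, 9, 15⟩, ⟨10, 6, 9,
    1⟩, ⟨5, 6, 9, 10⟩]

def orbit14 : Orbit where
  D := 11048
  Dl := [3, 5, 8, 9, 11, 13]
  trans := [18364758544493064720, 17279655952174559760, 11014884390710096400, 9929781798391591440]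
  pairs := [8704, 520, 768, 8448, 288, 264, 544, 2304, 8224, 40, 2560, 10240, 2080, 2056, 8200]
  key := [⟨13, 5, 14⟩, ⟨8, 3, 1⟩, ⟨8, 5, 6⟩, ⟨11, 9, 0⟩, ⟨11, 5, 6⟩, ⟨11, 9, 14⟩, ⟨13, 9, 6⟩, ⟨13,
    8, 14⟩, ⟨8, 3, 7⟩]
  base := [3, 8, 11]
  words := [⟨15, 3, 8, 3⟩, ⟨5, 3, 8, 15⟩, ⟨9, 3, 8, 5⟩, ⟨13, 3, 5, 11⟩, ⟨0, 3, 8, 11⟩, ⟨2, 3, 8,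
    9⟩, ⟨7, 3, 8, 13⟩, ⟨12, 3, 8, 0⟩, ⟨14, 3, 8, 2⟩, ⟨6, 3, 8, 12⟩, ⟨4, 3, 8, 14⟩, ⟨10, 3, 8, 6⟩,
    ⟨1, 3, 8, 10⟩]

def orbit15 : Orbit where
  D := 59432
  Dl := [3, 5, 11, 13, 14, 15]
  trans := [18364758544493064720, 17279655952174559760, 11014884390710096400, 9929781798391591440]
  pairs := [49152, 40, 16392, 32776, 24576, 10240, 18432, 16416, 32800, 34816, 8224, 2080, 8200,
    2056, 40960]
  key := [⟨14, 3, 7⟩, ⟨14, 13, 1⟩, ⟨11, 3, 9⟩]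
  base := [3, 11, 14]
  words := [⟨5, 14, 3, 14⟩, ⟨13, 3, 5, 11⟩, ⟨10, 3, 11, 3⟩, ⟨15, 11, 14, 10⟩, ⟨6, 3, 11, 14⟩, ⟨12,
    3, 11, 5⟩, ⟨2, 3, 11, 10⟩, ⟨7, 3, 11, 15⟩, ⟨4, 3, 11, 12⟩, ⟨9, 3, 14, 3⟩, ⟨1, 3, 11, 9⟩, ⟨8,
    3, 11, 1⟩, ⟨0, 3, 11, 8⟩]

def orbit16 : Orbit where
  D := 27328
  Dl := [6, 7, 9, 11, 13, 14]
  trans := [18364758544493064720, 17283878141249729040, 17279672509020844560,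
    18360519926915346960, 18336047660493215760, 17255167257249880080, 17250961625020995600,
    18331809042915498000, 9905346540628934160, 10986193958523436560, 10981988326797868560,
    9901107923554532880]
  pairs := [2176, 640, 16512, 16448, 8320, 576, 8256, 2112, 192, 18432, 8704, 16896, 2560, 24576,
    10240]
  key := [⟨14, 6, 1⟩, ⟨9, 7, 2⟩, ⟨9, 7, 1⟩, ⟨14, 7, 5⟩, ⟨13, 6, 2⟩, ⟨11, 7, 10⟩, ⟨14, 13, 4⟩, ⟨14,
    13, 3⟩, ⟨11, 9, 12⟩, ⟨14, 9, 4⟩, ⟨13, 7, 5⟩, ⟨13, 6, 0⟩, ⟨14, 11, 1⟩]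
  base := [6, 9, 11, 13]
  words := [⟨14, 9, 13, 11⟩, ⟨7, 11, 6, 11⟩, ⟨4, 6, 9, 11⟩, ⟨3, 6, 9, 13⟩, ⟨0, 6, 9, 14⟩, ⟨8, 6,
    9, 7⟩, ⟨10, 6, 11, 6⟩, ⟨5, 6, 9, 10⟩, ⟨1, 6, 11, 13⟩, ⟨15, 6, 9, 1⟩, ⟨2, 6, 11, 14⟩, ⟨12, 6,
    9, 2⟩]

def orbit17 : Orbit where
  D := 45608
  Dl := [3, 5, 9, 12, 13, 15]
  trans := [18364758544493064720, 17283878141249729040, 18360536355417895440,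
    17279655952174559760, 9920265589678682640, 11001113007573185040, 9924487649904833040,
    11005335067799335440]
  pairs := [4104, 4128, 12288, 40960, 8704, 8200, 36864, 4608, 32800, 8224, 544, 40, 33280, 32776,
    520]
  key := [⟨9, 5, 6⟩, ⟨12, 3, 6⟩, ⟨12, 3, 1⟩, ⟨15, 12, 7⟩, ⟨12, 5, 1⟩, ⟨15, 5, 0⟩, ⟨15, 13, 11⟩,
    ⟨13, 5, 7⟩]
  base := [3, 5, 9, 12]
  words := [⟨15, 3, 5, 9⟩, ⟨13, 9, 12, 9⟩, ⟨4, 3, 5, 3⟩, ⟨11, 3, 5, 12⟩, ⟨8, 3, 5, 15⟩, ⟨10, 3, 5,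
    13⟩, ⟨2, 3, 5, 4⟩, ⟨14, 3, 5, 8⟩, ⟨6, 3, 9, 12⟩, ⟨0, 3, 5, 6⟩, ⟨7, 3, 5, 0⟩, ⟨1, 3, 5, 7⟩]

def orbit18 : Orbit where
  D := 27808
  Dl := [5, 7, 10, 11, 13, 14]
  trans := [18364758544493064720, 17279672509273485840, 12364896506851107600, 13441538292769366800]
  pairs := [8320, 8224, 1152, 2176, 16416, 2080, 24576, 1056, 3072, 160, 17408, 9216, 10240,
    18432, 16512]
  key := [⟨10, 5, 3⟩, ⟨14, 11, 3⟩, ⟨13, 5, 2⟩, ⟨14, 5, 3⟩, ⟨7, 5, 2⟩, ⟨10, 5, 8⟩, ⟨14, 11, 1⟩,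
    ⟨14, 10, 15⟩, ⟨11, 7, 8⟩, ⟨11, 5, 4⟩, ⟨13, 11, 0⟩, ⟨14, 7, 4⟩, ⟨14, 13, 1⟩]
  base := [5, 10, 13]
  words := [⟨7, 13, 5, 13⟩, ⟨11, 5, 10, 7⟩, ⟨9, 5, 10, 5⟩, ⟨14, 10, 13, 9⟩, ⟨2, 5, 10, 13⟩, ⟨4, 5,
    10, 11⟩, ⟨6, 5, 10, 9⟩, ⟨1, 5, 10, 14⟩, ⟨8, 5, 10, 4⟩, ⟨15, 5, 13, 5⟩, ⟨0, 5, 10, 15⟩, ⟨12, 5,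
    10, 0⟩, ⟨3, 5, 10, 12⟩]

def orbit19 : Orbit where
  D := 27328
  Dl := [6, 7, 9, 11, 13, 14]
  trans := [18364758544493064720, 17279672509273485840]
  pairs := [16512, 576, 8256, 640, 8320, 2176, 192, 16448, 2112, 10240, 24576, 8704, 18432, 2560,
    16896]
  key := [⟨13, 7, 0⟩, ⟨13, 11, 4⟩, ⟨13, 6, 2⟩, ⟨9, 7, 4⟩, ⟨9, 6, 2⟩, ⟨14, 7, 4⟩, ⟨13, 9, 2⟩]
  base := [6, 9, 13]
  words := [⟨10, 6, 9, 6⟩, ⟨14, 9, 13, 10⟩, ⟨7, 13, 6, 14⟩, ⟨11, 6, 9, 7⟩, ⟨2, 6, 9, 13⟩, ⟨5, 6,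
    9, 10⟩, ⟨1, 6, 9, 14⟩, ⟨4, 6, 9, 11⟩, ⟨8, 6, 9, 4⟩, ⟨15, 6, 13, 6⟩, ⟨0, 6, 9, 15⟩, ⟨12, 6, 9,
    0⟩, ⟨3, 6, 9, 12⟩]

def orbit20 : Orbit where
  D := 50848
  Dl := [5, 7, 9, 10, 14, 15]
  trans := [18364758544493064720, 18364741987394138640, 12364896506851107600, 12364912935101014800]
  pairs := [16896, 1056, 33792, 544, 640, 17408, 1152, 16416, 32896, 33280, 1536, 16512, 32800,
    160, 49152]
  key := [⟨15, 7, 2⟩, ⟨14, 10, 2⟩, ⟨15, 10, 11⟩, ⟨15, 9, 1⟩, ⟨7, 5, 3⟩, ⟨9, 5, 0⟩]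
  base := [5, 9, 14]
  words := [⟨10, 5, 9, 5⟩, ⟨7, 14, 5, 14⟩, ⟨2, 5, 9, 14⟩, ⟨15, 5, 2, 9⟩, ⟨6, 5, 9, 10⟩, ⟨8, 5, 9,
    7⟩, ⟨13, 5, 9, 2⟩, ⟨3, 5, 9, 15⟩, ⟨4, 5, 9, 8⟩, ⟨1, 5, 9, 13⟩, ⟨12, 5, 9, 3⟩, ⟨11, 5, 9, 4⟩,
    ⟨0, 5, 9, 12⟩]

def orbit21 : Orbit where
  D := 42688
  Dl := [6, 7, 9, 10, 13, 15]
  trans := [18364758544493064720, 17279672509273485840]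
  pairs := [576, 40960, 1536, 1152, 640, 9216, 8704, 1088, 192, 32896, 8256, 32832, 33792, 8320,
    33280]
  key := [⟨13, 6, 2⟩, ⟨15, 10, 2⟩, ⟨9, 6, 1⟩]
  base := [6, 9, 13]
  words := [⟨10, 6, 9, 6⟩, ⟨15, 6, 13, 6⟩, ⟨2, 6, 9, 13⟩, ⟨7, 9, 13, 2⟩, ⟨5, 6, 9, 10⟩, ⟨0, 6, 9,
    15⟩, ⟨14, 6, 9, 2⟩, ⟨11, 6, 9, 7⟩, ⟨12, 6, 9, 0⟩, ⟨1, 6, 9, 14⟩, ⟨4, 6, 9, 11⟩, ⟨3, 6, 9, 12⟩,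
    ⟨8, 6, 9, 4⟩]

def orbit22 : Orbit where
  D := 27808
  Dl := [5, 7, 10, 11, 13, 14]
  trans := [18364758544493064720, 17279655952174559760, 13445776910346105360,
    12360674318027600400, 17283878140998066960, 18360536355166233360, 12364896506851107600,
    13441554721019274000, 18355225778678027280, 17270123186359522320, 15895734961604547600,
    14810632369286042640, 17274345375183029520, 18351003589351195920, 14814854558109549840,
    15891512772277716240, 15905304964213405200, 14820202371894900240, 18345655774928336400,
    17260553182609831440, 14824424560718407440, 15901082774886573840, 17264775371433338640,
    18341433585601505040]
  pairs := [3072, 16416, 2176, 24576, 8224, 1152, 1056, 2080, 8320, 160, 18432, 16512, 10240,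
    9216, 17408]
  key := [⟨10, 7, 2⟩, ⟨11, 7, 1⟩, ⟨14, 11, 2⟩, ⟨13, 11, 12⟩, ⟨7, 5, 0⟩, ⟨14, 13, 6⟩, ⟨14, 11, 4⟩,
    ⟨11, 7, 9⟩, ⟨13, 10, 1⟩, ⟨11, 10, 4⟩, ⟨14, 13, 4⟩, ⟨11, 7, 2⟩, ⟨13, 10, 3⟩, ⟨14, 7, 15⟩, ⟨14,
    10, 12⟩, ⟨14, 13, 8⟩, ⟨11, 5, 0⟩, ⟨14, 7, 3⟩, ⟨13, 5, 6⟩]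
  base := [5, 7, 10, 13]
  words := [⟨11, 5, 10, 5⟩, ⟨14, 5, 13, 7⟩, ⟨8, 5, 7, 10⟩, ⟨15, 5, 7, 13⟩, ⟨9, 5, 7, 11⟩, ⟨12, 5,
    7, 14⟩, ⟨2, 5, 10, 13⟩, ⟨0, 5, 7, 2⟩, ⟨4, 5, 10, 11⟩, ⟨6, 5, 7, 4⟩, ⟨1, 5, 10, 14⟩, ⟨3, 5, 7,
    1⟩]

def orbit23 : Orbit where
  D := 27328
  Dl := [6, 7, 9, 11, 13, 14]
  trans := [18364758544493064720, 15924333259045220880, 13445776910346105360, 11005351624898261520]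
  pairs := [16448, 16512, 8256, 2176, 576, 640, 24576, 2560, 8320, 192, 8704, 10240, 2112, 18432,
    16896]
  key := [⟨13, 11, 5⟩, ⟨11, 6, 0⟩, ⟨14, 6, 2⟩, ⟨14, 11, 2⟩, ⟨13, 7, 3⟩, ⟨13, 6, 0⟩]
  base := [6, 9, 11, 13]
  words := [⟨7, 9, 6, 9⟩, ⟨8, 6, 9, 6⟩, ⟨14, 11, 13, 8⟩, ⟨4, 6, 9, 11⟩, ⟨2, 6, 9, 13⟩, ⟨1, 6, 9,
    14⟩, ⟨10, 6, 9, 4⟩, ⟨12, 6, 9, 2⟩, ⟨15, 6, 9, 1⟩, ⟨5, 6, 9, 10⟩, ⟨3, 6, 9, 12⟩, ⟨0, 6, 9, 15⟩]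

def orbit24 : Orbit where
  D := 27328
  Dl := [6, 7, 9, 11, 13, 14]
  trans := [18364758544493064720, 17279672509273485840, 18364683486789906960,
    17279597451570328080, 17283878140998066960, 18360519926916326160, 17283803083294909200,
    18360444869213168400]
  pairs := [2176, 8320, 8256, 16512, 576, 16448, 24576, 640, 192, 2560, 2112, 18432, 10240, 16896,
    8704]
  key := [⟨9, 6, 1⟩, ⟨13, 7, 0⟩, ⟨14, 6, 3⟩, ⟨14, 11, 5⟩, ⟨9, 7, 0⟩, ⟨14, 11, 1⟩, ⟨11, 7, 3⟩, ⟨13,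
    11, 8⟩, ⟨14, 7, 1⟩, ⟨13, 6, 4⟩, ⟨14, 13, 0⟩]
  base := [6, 9, 11, 13]
  words := [⟨7, 9, 6, 9⟩, ⟨8, 6, 9, 6⟩, ⟨14, 11, 13, 8⟩, ⟨4, 6, 9, 11⟩, ⟨2, 6, 9, 13⟩, ⟨1, 6, 9,
    14⟩, ⟨10, 6, 9, 4⟩, ⟨12, 6, 9, 2⟩, ⟨15, 6, 9, 1⟩, ⟨5, 6, 9, 10⟩, ⟨3, 6, 9, 12⟩, ⟨0, 6, 9, 15⟩]

def orbit25 : Orbit where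
  D := 50848
  Dl := [5, 7, 9, 10, 14, 15]
  trans := [18364758544493064720, 18364741987394138640, 18364683486789906960, 18364666929690980880]
  pairs := [16416, 17408, 16512, 16896, 33792, 32800, 1536, 49152, 160, 32896, 1152, 640, 544,
    1056, 33280]
  key := [⟨14, 5, 2⟩, ⟨9, 7, 13⟩, ⟨14, 9, 0⟩, ⟨14, 10, 12⟩, ⟨14, 5, 13⟩, ⟨14, 9, 12⟩, ⟨9, 5, 2⟩]
  base := [5, 7, 9, 14]
  words := [⟨10, 5, 9, 7⟩, ⟨11, 5, 7, 9⟩, ⟨15, 14, 10, 11⟩, ⟨12, 5, 7, 14⟩, ⟨8, 5, 7, 10⟩, ⟨13, 5,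
    7, 15⟩, ⟨2, 5, 9, 14⟩, ⟨0, 5, 7, 2⟩, ⟨6, 5, 9, 10⟩, ⟨4, 5, 7, 6⟩, ⟨3, 5, 9, 15⟩, ⟨1, 5, 7, 3⟩]

def orbit26 : Orbit where
  D := 27328
  Dl := [6, 7, 9, 11, 13, 14]
  trans := [18364758544493064720, 15924333259045220880, 13445776910346105360,
    11005351624898261520, 18364683486789906960, 15924258201342063120, 8526720218495988240,
    6086294933048144400, 13445626794939789840, 11005201509491946000, 8526645160792830480,
    6086219875344986640, 18355113192123290640, 13474262621227602960, 8517149923829371920,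
    3636299352933684240, 15895584846198232080, 11014734275302544400, 8517112394977793040,
    3636261824082105360, 15905117612008830480, 13464692326560986640, 6067154343714911760,
    3626729058267067920, 18345505659522020880, 11024304277911402000, 6067191580513170960,
    3626691820332414480]
  pairs := [576, 8256, 192, 16448, 2112, 8704, 2176, 2560, 18432, 24576, 10240, 640, 16896, 16512,
    8320]
  key := [⟨13, 7, 15⟩, ⟨13, 9, 0⟩, ⟨13, 6, 10⟩, ⟨9, 7, 3⟩, ⟨11, 6, 5⟩, ⟨14, 7, 12⟩]
  base := [6, 7, 9, 11, 13]
  words := [⟨8, 6, 7, 9⟩, ⟨14, 11, 13, 8⟩, ⟨10, 6, 7, 11⟩, ⟨12, 6, 7, 13⟩, ⟨15, 6, 7, 14⟩, ⟨4, 6,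
    9, 11⟩, ⟨5, 6, 7, 4⟩, ⟨2, 6, 9, 13⟩, ⟨3, 6, 7, 2⟩, ⟨1, 6, 9, 14⟩, ⟨0, 6, 7, 1⟩]

def orbits0 : List Orbit := [orbit0, orbit1]

def orbits1 : List Orbit := []

def orbits2 : List Orbit := [orbit2, orbit3]

def orbits3 : List Orbit := [orbit4, orbit5, orbit6]

def orbits4 : List Orbit := [orbit7, orbit8, orbit9]

def orbits5 : List Orbit := [orbit10, orbit11]

def orbits6 : List Orbit := [orbit12, orbit13]

def orbits7 : List Orbit := [orbit14, orbit15]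

def orbits8 : List Orbit := [orbit16, orbit17]

def orbits9 : List Orbit := [orbit18, orbit19, orbit20, orbit21]

def orbits10 : List Orbit := [orbit22, orbit23]

def orbits11 : List Orbit := []

def orbits12 : List Orbit := [orbit24, orbit25]

def orbits13 : List Orbit := [orbit26]

end GroupCubes

end

namespace GroupCubes

section Kernel

variable {α β : Type}

theorem rec_bool (b : Bool) (t e : α) : @Bool.rec (fun _ => α) e t b = bif b then t else e := by
  cases b <;> rfl

theorem and_rec (a b : Bool) : (a && b) = @Bool.rec (fun _ => Bool) false b a := by
  cases a <;> rfl

theorem beq_iff {a b : ℕ} : Nat.beq a b = true ↔ a = b :=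
  ⟨Nat.eq_of_beq_eq_true, fun h => h ▸ Nat.beq_refl a⟩

theorem force_eq (n : ℕ) (f : ℕ → α) : force n f = f n := by
  cases n <;> rfl

theorem kmap_eq (f : α → β) (l : List α) : kmap f l = l.map f := by
  induction l with
  | nil => rfl
  | cons a l ih => exact congrArg (f a :: ·) ih

theorem kapp_eq (l l' : List α) : kapp l l' = l ++ l' := by
  induction l with
  | nil => rfl
  | cons a l ih => exact congrArg (a :: ·) ih

theorem kflat_eq (f : α → List β) (l : List α) : kflat f l = l.flatMap f := by
  induction l with
  | nil => rfl
  | cons a l ih =>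
    rw [List.flatMap_cons, ← ih, ← kapp_eq]
    rfl

theorem kall_eq (f : α → Bool) (l : List α) : kall f l = l.all f := by
  induction l with
  | nil => rfl
  | cons a l ih =>
    rw [List.all_cons, ← ih]
    change @Bool.rec (fun _ => Bool) false (kall f l) (f a) = _
    cases f a <;> rfl

theorem kany_eq (f : α → Bool) (l : List α) : kany f l = l.any f := by
  induction l with
  | nil => rfl
  | cons a l ih =>
    rw [List.any_cons, ← ih]
    change @Bool.rec (fun _ => Bool) (kany f l) true (f a) = _
    cases f a <;> rfl

theorem kfilter_eq (f : α → Bool) (l : List α) : kfilter f l = l.filter f := by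
  induction l with
  | nil => rfl
  | cons a l ih =>
    rw [List.filter_cons, ← ih]
    change @Bool.rec (fun _ => List α) (kfilter f l) (a :: kfilter f l) (f a) = _
    cases f a <;> rfl

theorem klen_eq (l : List α) : klen l = l.length := by
  induction l with
  | nil => rfl
  | cons a l ih => exact congrArg Nat.succ ih

theorem forceAll_eq {γ : Type} {fa : α → (α → γ) → γ} (h : ∀ a k, fa a k = k a) (l : List α)
    (k : List α → γ) : forceAll fa l k = k l := by
  induction l generalizing k with
  | nil => rfl
  | cons a l ih =>
    change fa a (fun a' => forceAll fa l fun l' => k (a' :: l')) = _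
    rw [h, ih]

theorem forceList_eq (l : List ℕ) (k : List ℕ → α) : forceList l k = k l :=
  forceAll_eq (fun a k => force_eq a k) l k

theorem testBit_ksum (f : α → ℕ) (l : List α) (j : ℕ) :
    (ksum f l).testBit j = l.any fun x => (f x).testBit j := by
  induction l with
  | nil => exact Nat.zero_testBit j
  | cons a l ih =>
    rw [List.any_cons, ← ih]
    exact Nat.testBit_or _ _ _

theorem distinct_iff (l : List ℕ) : distinct l = true ↔ l.Nodup := by
  induction l with
  | nil => simp [distinct]
  | cons a l ih =>
    change @Bool.rec (fun _ => Bool) false (distinct l) (kall _ l) = true ↔ _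
    rw [rec_bool, kall_eq, List.nodup_cons, ← ih]
    have : (l.all fun b => @Bool.rec (fun _ => Bool) true false (Nat.beq a b)) = decide (a ∉ l) := by
      rw [Bool.eq_iff_iff, List.all_eq_true, decide_eq_true_iff]
      refine ⟨fun h ha => ?_, fun h b hb => ?_⟩
      · have := h a ha
        rw [Nat.beq_refl] at this
        exact absurd this (by simp)
      · rw [rec_bool, Bool.eq_false_iff.2 (fun e : Nat.beq a b = true => h (Nat.eq_of_beq_eq_true e ▸ hb))]
        rfl
    rw [this]
    by_cases h : a ∈ l <;> simp [h]

end Kernel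

theorem mem_pts {x : ℕ} : x ∈ pts ↔ x < 16 := by
  rw [show pts = List.range 16 from rfl, List.mem_range]

theorem kall_pts {f : ℕ → Bool} : kall f pts = true ↔ ∀ x : Fin 16, f x = true := by
  rw [kall_eq, List.all_eq_true]
  exact ⟨fun h x => h x (mem_pts.2 x.2), fun h x hx => h ⟨x, mem_pts.1 hx⟩⟩

section Bits

theorem testBit_bit (n j : ℕ) : (bit n).testBit j = decide (n = j) := by
  change (1 <<< n).testBit j = _
  rw [Nat.one_shiftLeft, Nat.testBit_two_pow]

theorem land_one (n : ℕ) : Nat.land n 1 = (n.testBit 0).toNat := by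
  change n &&& 1 = _
  rw [Nat.and_one_is_mod, Nat.testBit_zero]
  rcases Nat.mod_two_eq_zero_or_one n with h | h <;> simp [h]

theorem mem_eq (m x : ℕ) : mem m x = m.testBit x := by
  have h : Nat.land (Nat.shiftRight m x) 1 = (m.testBit x).toNat := by
    rw [land_one]
    change ((m >>> x).testBit 0).toNat = _
    rw [Nat.testBit_shiftRight, Nat.add_zero]
  rw [mem, h]
  cases m.testBit x <;> rfl

theorem beq_bits (m x m' x' : ℕ) :
    Nat.beq (Nat.land (Nat.shiftRight m x) 1) (Nat.land (Nat.shiftRight m' x') 1) =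
      (m.testBit x == m'.testBit x') := by
  rw [← mem_eq, ← mem_eq, mem, mem, land_one, land_one]
  cases Nat.testBit (m.shiftRight x) 0 <;> cases Nat.testBit (m'.shiftRight x') 0 <;> rfl

theorem app_lt (h x : ℕ) : app h x < 16 := lt_of_le_of_lt Nat.and_le_right (by norm_num)

theorem testBit_fifteen (j : ℕ) : Nat.testBit 15 j = decide (j < 4) := by
  rw [show 15 = 2 ^ 4 - 1 from rfl, Nat.testBit_two_pow_sub_one]

theorem testBit_app (h x j : ℕ) : (app h x).testBit j = (decide (j < 4) && h.testBit (4 * x + j)) := by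
  change ((h >>> (4 * x)) &&& 15).testBit j = _
  rw [Nat.testBit_and, Nat.testBit_shiftRight, testBit_fifteen, Bool.and_comm]

theorem app_or (a b x : ℕ) : app (a ||| b) x = app a x ||| app b x := by
  refine Nat.eq_of_testBit_eq fun j => ?_
  rw [Nat.testBit_or]
  simp only [testBit_app, Nat.testBit_or, Bool.and_or_distrib_left]

theorem app_shiftLeft {i : ℕ} (hi : i < 16) (v x : ℕ) :
    app (i <<< (4 * v)) x = if x = v then i else 0 := by
  refine Nat.eq_of_testBit_eq fun j => ?_
  have hi' : ∀ k, 4 ≤ k → i.testBit k = false := fun k hk =>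
    Nat.testBit_lt_two_pow (lt_of_lt_of_le hi (Nat.pow_le_pow_right (n := 2) (by norm_num) hk))
  rw [testBit_app, Nat.testBit_shiftLeft]
  split_ifs with h
  · subst h
    by_cases hj : j < 4
    · simp [hj]
    · simp [hj, hi' j (by omega)]
  · rw [Nat.zero_testBit]
    by_cases hj : j < 4
    · rcases lt_or_gt_of_ne h with h | h
      · simp only [Bool.and_eq_false_imp, decide_eq_true_eq]
        intro _ _
        omega
      · rw [hi' _ (by omega)]
        simp
    · simp [hj]

theorem app_ksum {f : ℕ → ℕ} (hf : ∀ x, f x < 16) (l : List ℕ) (x : ℕ) :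
    app (ksum (fun y => Nat.shiftLeft (f y) (Nat.mul 4 y)) l) x = if x ∈ l then f x else 0 := by
  induction l with
  | nil => simp [ksum, app]
  | cons a l ih =>
    change app (f a <<< (4 * a) ||| ksum (fun y => Nat.shiftLeft (f y) (Nat.mul 4 y)) l) x = _
    rw [app_or, ih, app_shiftLeft (hf a)]
    by_cases h : x = a
    · subst h
      by_cases h' : x ∈ l <;> simp [h']
    · by_cases h' : x ∈ l <;> simp [h, h']

theorem app_code {f : ℕ → ℕ} (hf : ∀ x, f x < 16) (x : Fin 16) : app (code f) x = f x := by
  rw [code, app_ksum hf, if_pos (mem_pts.2 x.2)]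

theorem tmul_lt (T x y : ℕ) : tmul T x y < 16 := lt_of_le_of_lt Nat.and_le_right (by norm_num)

theorem testBit_maskOf (l : List ℕ) (j : ℕ) : (maskOf l).testBit j = decide (j ∈ l) := by
  rw [maskOf, testBit_ksum, Bool.eq_iff_iff]
  simp only [List.any_eq_true, testBit_bit, decide_eq_true_eq, exists_eq_right]

end Bits

end GroupCubes

namespace GroupCubes

/-- The code of the multiplication table of a group with elements `0, …, 15` and identity `0`. -/
structure Table where
  code : ℕ
  valid : validTable code = true

def Table.El (_ : Table) : Type := Fin 16

namespace Table

variable {t t' : Table}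

def inv (t : Table) : ℕ := invCode t.code

def enum (t : Table) : Fin 16 ≃ t.El := Equiv.refl _

def val (x : t.El) : ℕ := (t.enum.symm x).val

instance : Fintype t.El := Fintype.ofEquiv _ t.enum

instance : DecidableEq t.El := t.enum.symm.decidableEq

theorem card_el : Fintype.card t.El = 16 := (Fintype.card_congr t.enum.symm).trans (Fintype.card_fin 16)

theorem val_lt (x : t.El) : val x < 16 := (t.enum.symm x).2

theorem val_inj {x y : t.El} : val x = val y ↔ x = y := by
  rw [val, val, Fin.val_inj, t.enum.symm.apply_eq_iff_eq]

theorem val_enum (x : Fin 16) : val (t.enum x) = x := by rw [val, Equiv.symm_apply_apply]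

def ofLt {x : ℕ} (hx : x < 16) : t.El := t.enum ⟨x, hx⟩

theorem val_ofLt {x : ℕ} (hx : x < 16) : val (ofLt hx : t.El) = x := val_enum _

theorem kall_pts {f : ℕ → Bool} (t : Table) : kall f pts = true ↔ ∀ x : t.El, f (val x) = true := by
  rw [GroupCubes.kall_pts]
  exact ⟨fun h x => h _, fun h x => val_enum (t := t) x ▸ h (t.enum x)⟩

theorem valid_iff {T : ℕ} (h : validTable T = true) (x : Fin 16) :
    tmul T 0 x = x ∧ tmul T x 0 = x ∧ tmul T (app (invCode T) x) x = 0 ∧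
      ∀ y z : Fin 16, tmul T (tmul T x y) z = tmul T x (tmul T y z) := by
  rw [validTable, force_eq, GroupCubes.kall_pts] at h
  have := h x
  simp only [rec_bool, Bool.cond_false_right, Bool.and_eq_true, beq_iff,
    GroupCubes.kall_pts, force_eq] at this
  exact ⟨this.1, this.2.1, this.2.2.1, this.2.2.2⟩

instance : Group t.El :=
  letI : Mul t.El := ⟨fun x y => ofLt (tmul_lt t.code (val x) (val y))⟩
  letI : One t.El := ⟨ofLt (x := 0) (by norm_num)⟩
  letI : Inv t.El := ⟨fun x => ofLt (app_lt t.inv (val x))⟩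
  have mul (x y : t.El) : val (x * y) = tmul t.code (val x) (val y) := val_ofLt _
  have one : val (1 : t.El) = 0 := val_ofLt _
  have inv (x : t.El) : val x⁻¹ = app t.inv (val x) := val_ofLt _
  Group.ofLeftAxioms
    (fun x y z => by
      rw [← val_inj]
      simp only [mul]
      exact (valid_iff t.valid (t.enum.symm x)).2.2.2 (t.enum.symm y) (t.enum.symm z))
    (fun x => by
      rw [← val_inj, mul, one]
      exact (valid_iff t.valid (t.enum.symm x)).1)
    (fun x => by
      rw [← val_inj, mul, one, inv]
      exact (valid_iff t.valid (t.enum.symm x)).2.2.1)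

theorem val_mul (x y : t.El) : val (x * y) = tmul t.code (val x) (val y) := val_ofLt _

theorem val_one : val (1 : t.El) = 0 := val_ofLt _

theorem val_inv (x : t.El) : val x⁻¹ = app t.inv (val x) := val_ofLt _

theorem val_tern (x y z : t.El) :
    val (x * y⁻¹ * z) = tern t.code t.inv (val x) (val y) (val z) := by
  rw [val_mul, val_mul, val_inv, tern]

/-- The number `h` encodes the map `φ`. -/
def Codes (h : ℕ) (φ : t.El → t'.El) : Prop := ∀ x, val (φ x) = app h (val x)

theorem Codes.ext {h : ℕ} {φ ψ : t.El → t'.El} (h₁ : Codes h φ) (h₂ : Codes h ψ) : φ = ψ :=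
  funext fun x => val_inj.1 ((h₁ x).trans (h₂ x).symm)

/-- the set with mask `m` -/
def pred (m : ℕ) (x : t.El) : Bool := m.testBit (val x)

def decode (t t' : Table) (h : ℕ) (x : t.El) : t'.El := ofLt (app_lt h (val x))

theorem codes_decode (h : ℕ) : Codes h (decode t t' h) := fun _ => val_ofLt _

theorem codes_code (φ : t.El → t'.El) (f : ℕ → ℕ) (h : ∀ x, val (φ x) = f (val x)) (hf : ∀ x, f x < 16) :
    Codes (GroupCubes.code f) φ :=
  fun x => (h x).trans (app_code hf (t.enum.symm x)).symm

theorem isPerm_iff {h : ℕ} {φ : t.El → t'.El} (hc : Codes h φ) :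
    isPerm h = true ↔ Function.Bijective φ := by
  have hb : Function.Bijective φ ↔ Function.Surjective φ :=
    ⟨fun h => h.2, fun h => (Fintype.bijective_iff_surjective_and_card φ).2
      ⟨h, card_el.trans card_el.symm⟩⟩
  rw [hb, isPerm, beq_iff]
  have key : ∀ j, (ksum (fun x => bit (app h x)) pts).testBit j = true ↔ ∃ x : t.El, val (φ x) = j := by
    intro j
    rw [testBit_ksum, List.any_eq_true]
    simp only [testBit_bit, decide_eq_true_eq]
    refine ⟨fun ⟨x, hx, e⟩ => ⟨ofLt (mem_pts.1 hx), ?_⟩, fun ⟨x, e⟩ => ⟨val x, mem_pts.2 (val_lt x), ?_⟩⟩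
    · rw [hc, val_ofLt, e]
    · rw [← hc, e]
  have full : ∀ j, Nat.testBit 65535 j = decide (j < 16) := fun j => by
    rw [show 65535 = 2 ^ 16 - 1 from rfl, Nat.testBit_two_pow_sub_one]
  refine ⟨fun e y => ?_, fun hs => Nat.eq_of_testBit_eq fun j => ?_⟩
  · have : (ksum (fun x => bit (app h x)) pts).testBit (val y) = true := by
      rw [e, full, decide_eq_true (val_lt y)]
    obtain ⟨x, hx⟩ := (key _).1 this
    exact ⟨x, val_inj.1 hx⟩
  · rw [full, Bool.eq_iff_iff, key, decide_eq_true_iff]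
    refine ⟨fun ⟨x, hx⟩ => hx ▸ val_lt _, fun hj => ?_⟩
    obtain ⟨x, hx⟩ := hs (ofLt hj)
    exact ⟨x, by rw [hx, val_ofLt]⟩

theorem isHeapMap_iff {h : ℕ} {φ : t.El → t.El} (hc : Codes h φ) :
    (isHeapMap t.code t.inv h false = true ↔ IsHeap φ) ∧
      (isHeapMap t.code t.inv h true = true ↔ IsAnti φ) := by
  have e1 : ∀ x y, app h (tmul t.code (val x) (val y)) = val (φ (x * y)) := fun x y => by
    rw [hc, val_mul]
  have e2 : ∀ x y, tern t.code t.inv (app h (val x)) (app h 0) (app h (val y)) =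
      val (φ x * (φ 1)⁻¹ * φ y) := fun x y => by
    rw [val_tern, hc, hc, hc, val_one]
  constructor
  · simp only [isHeapMap, kall_pts t, beq_iff]
    refine ⟨fun hh => IsHeap.of_map_mul fun x y => val_inj.1 ?_, fun hh x y => ?_⟩
    · rw [← e1, ← e2]
      exact hh x y
    · rw [e1, hh.map_mul, ← e2]
  · simp only [isHeapMap, kall_pts t, beq_iff]
    refine ⟨fun hh => IsAnti.of_map_mul fun x y => val_inj.1 ?_, fun hh x y => ?_⟩
    · rw [← e1, ← e2]
      exact hh x y
    · rw [e1, hh.map_mul, ← e2]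

theorem mem_modes_of_isAnti {φ : t.El → t.El} (h : IsAnti φ) :
    IsHeap φ ∨ true ∈ modes t.code := by
  rw [modes, rec_bool]
  rcases hc : commTable t.code with _ | _
  · exact Or.inr (by simp)
  · refine Or.inl fun x y z => ?_
    have comm : ∀ a b : t.El, a * b = b * a := by
      simp only [commTable, kall_pts t, beq_iff] at hc
      exact fun a b => val_inj.1 (by rw [val_mul, val_mul, hc])
    rw [h x y z, mul_assoc, comm, comm (φ y)⁻¹]

theorem false_mem_modes (T : ℕ) : false ∈ modes T := by
  rw [modes, rec_bool]
  cases commTable T <;> simp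

end Table

end GroupCubes

namespace GroupCubes

namespace Table

variable {t : Table}

/-- `φ` is a map of the kind selected by `m`. -/
def Mode (m : Bool) (φ : t.El → t.El) : Prop := bif m then IsAnti φ else IsHeap φ

theorem exists_mode {φ : t.El → t.El} (h : Heapish φ) : ∃ m ∈ modes t.code, Mode m φ := by
  rcases h with h | h
  · exact ⟨false, false_mem_modes _, h⟩
  · rcases mem_modes_of_isAnti h with h' | h'
    · exact ⟨false, false_mem_modes _, h'⟩
    · exact ⟨true, h', h⟩

/-- `h` encodes the restriction of `φ` to the set with mask `S`. -/
def Part (φ : t.El → t.El) (S h : ℕ) : Prop :=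
  (∀ j, S.testBit j = true → j < 16) ∧
    ∀ x, app h (val x) = bif S.testBit (val x) then val (φ x) else 0

theorem Part.setv {φ : t.El → t.El} {S h : ℕ} (hp : Part φ S h) (x : t.El) :
    Part φ (Nat.lor S (bit (val x))) (setv h (val x) (val (φ x))) := by
  constructor
  · intro j hj
    change (S ||| bit (val x)).testBit j = true at hj
    rw [Nat.testBit_or, testBit_bit, Bool.or_eq_true, decide_eq_true_iff] at hj
    rcases hj with hj | rfl
    · exact hp.1 j hj
    · exact val_lt x
  · intro y
    change app (h ||| val (φ x) <<< (4 * val x)) _ = bif (S ||| bit (val x)).testBit _ then _ else _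
    rw [app_or, app_shiftLeft (val_lt _), hp.2, Nat.testBit_or, testBit_bit]
    by_cases e : val y = val x
    · rw [val_inj.1 e]
      cases S.testBit (val x) <;> simp
    · rw [if_neg e, decide_eq_false (Ne.symm e)]
      simp

theorem Part.apply {φ : t.El → t.El} {S h : ℕ} (hp : Part φ S h) {j : ℕ} (hj : mem S j = true) :
    ∃ x : t.El, val x = j ∧ app h j = val (φ x) := by
  rw [mem_eq] at hj
  refine ⟨ofLt (hp.1 j hj), val_ofLt _, ?_⟩
  have := hp.2 (ofLt (hp.1 j hj))
  rwa [val_ofLt, hj] at this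

theorem wordsOk_cons (T I : ℕ) (w : Word) (ws : List Word) (S : ℕ) :
    wordsOk T I (w :: ws) S = (mem S w.x && (mem S w.y && (mem S w.z &&
      (Nat.beq (tern T I w.x w.y w.z) w.v && wordsOk T I ws (Nat.lor S (bit w.v)))))) := by
  rw [← force_eq (Nat.lor S (bit w.v)) (wordsOk T I ws)]
  simp only [and_rec]
  rfl

theorem extend_cons (T I A B : ℕ) (m : Bool) (w : Word) (ws : List Word) (h : ℕ) {i : ℕ}
    (hi : (bif m then tern T I (app h w.z) (app h w.y) (app h w.x) else
      tern T I (app h w.x) (app h w.y) (app h w.z)) = i) :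
    extend T I A B m (w :: ws) h =
      bif A.testBit w.v == B.testBit i then extend T I A B m ws (setv h w.v i) else [] := by
  rw [← hi, ← rec_bool m, ← beq_bits, ← rec_bool,
    ← force_eq (setv h w.v _) (extend T I A B m ws)]
  exact force_eq _ _

theorem exists_mem_extend {m : Bool} {φ : t.El → t.El} (hm : Mode m φ) {A B : ℕ}
    (hAB : ∀ x : t.El, A.testBit (val x) = B.testBit (val (φ x))) (ws : List Word) {S h : ℕ}
    (hw : wordsOk t.code t.inv ws S = true) (hp : Part φ S h) :
    ∃ h' ∈ extend t.code t.inv A B m ws h, Codes h' φ := by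
  induction ws generalizing S h with
  | nil =>
    have hS : S = 65535 := beq_iff.1 hw
    refine ⟨h, List.mem_singleton.2 rfl, fun x => ?_⟩
    rw [hp.2, hS, show 65535 = 2 ^ 16 - 1 from rfl, Nat.testBit_two_pow_sub_one,
      decide_eq_true (val_lt x), cond_true]
  | cons w ws ih =>
    simp only [wordsOk_cons, Bool.and_eq_true, beq_iff] at hw
    obtain ⟨hx, hy, hz, hv, hw⟩ := hw
    obtain ⟨x, ex', ex⟩ := hp.apply hx
    obtain ⟨y, ey', ey⟩ := hp.apply hy
    obtain ⟨z, ez', ez⟩ := hp.apply hz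
    have hv' : w.v = val (x * y⁻¹ * z) := by rw [val_tern, ← hv, ey', ez', ex']
    have hi : (bif m then tern t.code t.inv (app h w.z) (app h w.y) (app h w.x) else
        tern t.code t.inv (app h w.x) (app h w.y) (app h w.z)) = val (φ (x * y⁻¹ * z)) := by
      rw [ex, ey, ez, ← val_tern, ← val_tern]
      cases m
      · rw [cond_false, show φ _ = _ from hm x y z]
      · rw [cond_true, show φ _ = _ from hm x y z]
    obtain ⟨h', hh', hc⟩ := ih hw (h := setv h w.v (val (φ (x * y⁻¹ * z))))
      (by rw [hv']; exact hp.setv _)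
    refine ⟨h', ?_, hc⟩
    rw [extend_cons _ _ _ _ _ _ _ _ hi, hv', hAB, beq_self_eq_true, cond_true, ← hv']
    exact hh'

theorem exists_mem_search {m : Bool} {φ : t.El → t.El} (hm : Mode m φ) {A B : ℕ}
    (hAB : ∀ x : t.El, A.testBit (val x) = B.testBit (val (φ x))) (ws : List Word)
    {imgs base : List ℕ} {S h : ℕ} (hb : ∀ b ∈ base, ∃ x : t.El, val x = b ∧ val (φ x) ∈ imgs)
    (hw : wordsOk t.code t.inv ws (Nat.lor S (maskOf base)) = true) (hp : Part φ S h) :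
    ∃ h' ∈ search t.code t.inv A B imgs ws m base h, Codes h' φ := by
  induction base generalizing S h with
  | nil =>
    refine exists_mem_extend hm hAB ws (S := S) ?_ hp
    rw [← hw]
    exact congrArg _ (Nat.or_zero S).symm
  | cons b base ih =>
    obtain ⟨x, rfl, hx⟩ := hb b List.mem_cons_self
    obtain ⟨h', hh', hc⟩ := ih (S := Nat.lor S (bit (val x))) (h := setv h (val x) (val (φ x)))
      (fun b' hb' => hb b' (List.mem_cons_of_mem _ hb'))
      (by
        rw [← hw]
        exact congrArg _ (Nat.or_assoc S _ _)) (hp.setv x)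
    refine ⟨h', ?_, hc⟩
    change h' ∈ kflat _ _
    rw [kflat_eq, List.mem_flatMap]
    refine ⟨_, hx, ?_⟩
    rw [force_eq]
    exact hh'

end Table

open Table

/-- What `orbitOk` verifies. -/
structure Orbit.Ok (t : Table) (o : Orbit) : Prop where
  mask : maskOf o.Dl = o.D
  nodup : o.Dl.Nodup
  length : o.Dl.length = 6
  lt : ∀ x ∈ o.Dl, x < 16
  trans : ∀ p ∈ o.trans, ∃ φ : t.El ≃ t.El, Codes p φ ∧ Heapish φ
  pairs_nodup : o.pairs.Nodup
  pairs_length : o.pairs.length = 15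
  pairs : ∀ p ∈ o.pairs, ∃ a ∈ o.Dl, ∃ b ∈ o.Dl, a ≠ b ∧ p = bit a ||| bit b
  key : ∀ s ∈ o.key, s.a < 16 ∧ s.b < 16 ∧ s.c < 16
  base : ∀ b ∈ o.base, o.D.testBit b = true
  words : wordsOk t.code t.inv o.words (maskOf o.base) = true

variable {t : Table} {o o' : Orbit}

theorem orbitOk_ok (h : orbitOk t.code t.inv o = true) : o.Ok t := by
  simp only [orbitOk, rec_bool, Bool.cond_false_right, Bool.and_eq_true, beq_iff, distinct_iff,
    klen_eq, kall_eq, kany_eq, List.all_eq_true, List.any_eq_true, mem_eq, Nat.blt_eq,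
    Bool.cond_true_left, Bool.or_eq_true, Bool.cond_false_left, Bool.not_eq_true'] at h
  obtain ⟨h1, h2, h3, h4, h5, h6, h7, h8, h9, h10, h11⟩ := h
  refine ⟨h1, h2, h3, h4, fun p hp => ?_, h6, h7, fun p hp => ?_, h9, h10, h11⟩
  · obtain ⟨ha, hb⟩ := h5 p hp
    have hc := codes_decode (t := t) (t' := t) p
    refine ⟨Equiv.ofBijective _ ((isPerm_iff hc).1 ha), hc, ?_⟩
    exact hb.imp (isHeapMap_iff hc).1.1 (isHeapMap_iff hc).2.1
  · obtain ⟨a, ha, b, hb, hab, e⟩ := h8 p hp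
    exact ⟨a, ha, b, hb, fun h => by rw [h, Nat.beq_refl] at hab; exact absurd hab (by simp), e⟩

theorem Orbit.Ok.testBit (ho : o.Ok t) (j : ℕ) : o.D.testBit j = decide (j ∈ o.Dl) := by
  rw [← ho.mask, testBit_maskOf]

theorem Orbit.Ok.exists_el (ho : o.Ok t) {j : ℕ} (hj : j ∈ o.Dl) : ∃ x : t.El, val x = j :=
  ⟨ofLt (ho.lt j hj), val_ofLt _⟩

theorem exists_mem_transporters (ho : o.Ok t) (ho' : o'.Ok t) {φ : t.El ≃ t.El} (hφ : Heapish φ)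
    (h : ∀ x, pred o.D x = pred o'.D (φ x)) :
    ∃ c ∈ transporters t.code t.inv o o', Codes c φ := by
  obtain ⟨m, hm, hmode⟩ := exists_mode hφ
  have hbase : ∀ b ∈ o.base, ∃ x : t.El, val x = b ∧ val (φ x) ∈ o'.Dl := fun b hb => by
    have hb' := ho.base b hb
    have hlt : b < 16 := ho.lt b (of_decide_eq_true ((ho.testBit b).symm.trans hb'))
    refine ⟨ofLt hlt, val_ofLt _, ?_⟩
    have := h (ofLt hlt)
    rw [pred, val_ofLt, hb', pred, ho'.testBit] at this
    exact of_decide_eq_true this.symm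
  obtain ⟨c, hc, hcodes⟩ := exists_mem_search (S := 0) (h := 0) hmode h o.words hbase
    (by rw [← ho.words]; exact congrArg _ (Nat.zero_or _)) ⟨by simp, by simp [app]⟩
  refine ⟨c, ?_, hcodes⟩
  rw [transporters, kflat_eq, List.mem_flatMap]
  refine ⟨m, hm, ?_⟩
  rw [kfilter_eq, List.mem_filter]
  refine ⟨hc, ?_⟩
  simp only [rec_bool, (isPerm_iff hcodes).2 φ.bijective]
  have : isHeapMap t.code t.inv c m = true := by
    cases m
    · exact (isHeapMap_iff hcodes).1.2 hmode
    · exact (isHeapMap_iff hcodes).2.2 hmode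
  rw [this, cond_true, Table.kall_pts t]
  intro x
  rw [beq_bits, ← hcodes, beq_iff_eq]
  exact h x

theorem of_mem_transporters {c : ℕ} (hc : c ∈ transporters t.code t.inv o o') :
    ∃ φ : t.El ≃ t.El, Codes c φ ∧ Heapish φ ∧ ∀ x, pred o.D x = pred o'.D (φ x) := by
  rw [transporters, kflat_eq, List.mem_flatMap] at hc
  obtain ⟨m, -, hc⟩ := hc
  rw [kfilter_eq, List.mem_filter] at hc
  simp only [rec_bool, Bool.cond_false_right, Bool.and_eq_true, Table.kall_pts t, beq_bits,
    beq_iff_eq] at hc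
  obtain ⟨-, hperm, hheap, hD⟩ := hc
  have hcodes := codes_decode (t := t) (t' := t) c
  refine ⟨Equiv.ofBijective _ ((isPerm_iff hcodes).1 hperm), hcodes, ?_, fun x => ?_⟩
  · cases m
    · exact Or.inl ((isHeapMap_iff hcodes).1.1 hheap)
    · exact Or.inr ((isHeapMap_iff hcodes).2.1 hheap)
  · rw [pred, hD, ← hcodes]
    rfl

/-- The properties of a block that is an image of the difference set of `o`. -/
structure IsEntry (t : Table) (o : Orbit) (flag : Bool) (e : Ent) : Prop where
  mask : e.mask = maskOf e.els
  nodup : e.els.Nodup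
  length : e.els.length = 6
  lt : ∀ x ∈ e.els, x < 16
  map : ∃ (c : ℕ) (u : t.El ≃ t.El), Codes c u ∧ Heapish u ∧
    (∀ x, pred o.D x = pred e.mask (u x)) ∧ e.us = bif flag then [c] else []

theorem isEntry_of_mem (ho : o.Ok t) {flag : Bool} {e : Ent} (he : e ∈ entries t.code o flag) :
    IsEntry t o flag e := by
  rw [entries, kflat_eq, List.mem_flatMap] at he
  obtain ⟨p, hp, he⟩ := he
  rw [kmap_eq, List.mem_map] at he
  obtain ⟨a, ha, he⟩ := he
  rw [force_eq, kmap_eq, rec_bool] at he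
  obtain ⟨φ, hφ, hh⟩ := ho.trans p hp
  let α : t.El := ofLt (mem_pts.1 ha)
  let u : t.El ≃ t.El := φ.trans (Equiv.mulRight α)
  have hu : Heapish u := (Heapish.mul_right α).comp hh
  have hcu : Codes (code fun x => tmul t.code (app p x) a) u := by
    refine codes_code _ _ (fun x => ?_) fun x => tmul_lt _ _ _
    change val (φ x * α) = _
    rw [val_mul, hφ, val_ofLt]
  generalize (code fun x => tmul t.code (app p x) a) = c at he hcu
  have hmask : e.mask = maskOf e.els := by
    refine Nat.eq_of_testBit_eq fun j => ?_
    rw [testBit_maskOf, ← he, testBit_ksum, Bool.eq_iff_iff]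
    simp [testBit_bit]
  have hels : e.els = o.Dl.map (app c) := by rw [← he]
  have hinj : ∀ x ∈ o.Dl, ∀ y ∈ o.Dl, app c x = app c y → x = y := by
    intro x hx y hy hxy
    obtain ⟨x, rfl⟩ := ho.exists_el hx
    obtain ⟨y, rfl⟩ := ho.exists_el hy
    rw [← hcu, ← hcu, val_inj, u.apply_eq_iff_eq] at hxy
    rw [hxy]
  refine ⟨hmask, ?_, ?_, ?_, c, u, hcu, hu, fun x => ?_, by rw [← he]⟩
  · rw [hels]
    exact ho.nodup.map_on hinj
  · rw [hels, List.length_map, ho.length]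
  · rw [hels]
    intro x hx
    obtain ⟨y, -, rfl⟩ := List.mem_map.1 hx
    exact app_lt _ _
  · rw [pred, pred, hmask, testBit_maskOf, ho.testBit, hels, Bool.eq_iff_iff, decide_eq_true_iff,
      decide_eq_true_iff, List.mem_map]
    refine ⟨fun hx => ⟨_, hx, (hcu x).symm⟩, fun ⟨y, hy, e⟩ => ?_⟩
    obtain ⟨y, rfl⟩ := ho.exists_el hy
    rw [← hcu, val_inj, u.apply_eq_iff_eq] at e
    rwa [← e]

/-- `b` is an image of the difference set of `o`. -/
def InOrbit (t : Table) (o : Orbit) (b : t.El → Bool) : Prop :=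
  ∃ u : t.El ≃ t.El, Heapish u ∧ ∀ x, pred o.D x = b (u x)

theorem IsEntry.inOrbit {flag : Bool} {e : Ent} (he : IsEntry t o flag e) :
    InOrbit t o (pred e.mask) := by
  obtain ⟨c, u, -, hu, h, -⟩ := he.map
  exact ⟨u, hu, h⟩

theorem not_inOrbit_both (ho : o.Ok t) (ho' : o'.Ok t)
    (h : transporters t.code t.inv o o' = []) {b : t.El → Bool} (hb : InOrbit t o b) :
    ¬ InOrbit t o' b := by
  rintro ⟨u', hu', h'⟩
  obtain ⟨u, hu, hb⟩ := hb
  obtain ⟨c, hc, -⟩ := exists_mem_transporters ho ho' (φ := u.trans u'.symm) (hu'.symm.comp hu)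
    (fun x => by rw [hb, h', Equiv.trans_apply, Equiv.apply_symm_apply])
  rw [h] at hc
  exact absurd hc List.not_mem_nil

end GroupCubes

namespace GroupCubes

theorem testBit_exactTwo_aux (j : ℕ) (ws : List ℕ) (a b c n : ℕ) (ha : a.testBit j = decide (1 ≤ n))
    (hb : b.testBit j = decide (2 ≤ n)) (hc : c.testBit j = decide (3 ≤ n)) :
    (@List.rec ℕ (fun _ => ℕ → ℕ → ℕ → ℕ) (fun _ b c => Nat.xor b c)
      (fun w _ ih a b c => force (Nat.lor c (Nat.land b w)) fun c' =>
        force (Nat.lor b (Nat.land a w)) fun b' => force (Nat.lor a w) fun a' => ih a' b' c')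
      ws a b c).testBit j = decide (n + ws.countP (·.testBit j) = 2) := by
  induction ws generalizing a b c n with
  | nil =>
    change (b ^^^ c).testBit j = _
    rw [Nat.testBit_xor, hb, hc, List.countP_nil, Nat.add_zero]
    by_cases h2 : 2 ≤ n <;> by_cases h3 : 3 ≤ n <;>
      simp only [h2, h3, decide_true, decide_false] <;> symm <;> simp <;> omega
  | cons w ws ih =>
    change Nat.testBit (force (Nat.lor c (Nat.land b w)) fun c' => force (Nat.lor b (Nat.land a w))
      fun b' => force (Nat.lor a w) fun a' => _) j = _
    simp only [force_eq] at ih ⊢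
    rw [ih (n := n + (w.testBit j).toNat), List.countP_cons]
    · cases w.testBit j <;> simp [Nat.add_assoc, Nat.add_comm 1]
    · change (a ||| w).testBit j = _
      rw [Nat.testBit_or, ha]
      cases w.testBit j <;> simp
    · change (b ||| (a &&& w)).testBit j = _
      rw [Nat.testBit_or, Nat.testBit_and, ha, hb, Bool.eq_iff_iff]
      cases w.testBit j <;> simp <;> omega
    · change (c ||| (b &&& w)).testBit j = _
      rw [Nat.testBit_or, Nat.testBit_and, hb, hc, Bool.eq_iff_iff]
      cases w.testBit j <;> simp <;> omega

theorem testBit_exactTwo (ws : List ℕ) (j : ℕ) :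
    (exactTwo ws).testBit j = decide (ws.countP (·.testBit j) = 2) := by
  have := testBit_exactTwo_aux j ws 0 0 0 0 (by simp) (by simp) (by simp)
  rwa [Nat.zero_add] at this

theorem nth_eq (l : List ℕ) (n : ℕ) : nth l n = l.getD n 0 := by
  induction l generalizing n with
  | nil => rfl
  | cons a l ih =>
    cases n with
    | zero => rfl
    | succ n =>
      rw [List.getD_cons_succ, ← ih]
      rfl

theorem nth_kmap_pts (f : ℕ → ℕ) {x : ℕ} (hx : x < 16) : nth (kmap f pts) x = f x := by
  have hlen : x < ((List.range 16).map f).length := by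
    rw [List.length_map, List.length_range]
    exact hx
  rw [nth_eq, kmap_eq, show pts = List.range 16 from rfl, List.getD_eq_getElem _ _ hlen,
    List.getElem_map, List.getElem_range]

theorem bitTable_succ (x k : ℕ) : bitTable x (k + 1) =
    bif Nat.beq k x then (2 ^ 2 ^ x - 1) <<< 2 ^ x else bitTable x k ||| bitTable x k <<< 2 ^ k := by
  rw [← rec_bool]
  exact force_eq (bitTable x k) fun w => @Bool.rec (fun _ => ℕ)
    (Nat.lor w (Nat.shiftLeft w (Nat.pow 2 k)))
    (Nat.shiftLeft (Nat.sub (Nat.pow 2 (Nat.pow 2 x)) 1) (Nat.pow 2 x)) (Nat.beq k x)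

theorem testBit_bitTable (x n m : ℕ) :
    (bitTable x n).testBit m = (decide (x < n) && decide (m < 2 ^ n) && m.testBit x) := by
  induction n generalizing m with
  | zero => simp [bitTable]
  | succ k ih =>
    rw [bitTable_succ, pow_succ]
    by_cases hkx : k = x
    · subst hkx
      rw [Nat.beq_refl, cond_true, Nat.testBit_shiftLeft, Nat.testBit_two_pow_sub_one,
        decide_eq_true (Nat.lt_succ_self k), Bool.true_and, Bool.eq_iff_iff]
      simp only [Bool.and_eq_true, decide_eq_true_eq]
      constructor
      · rintro ⟨h1, h2⟩
        refine ⟨by omega, ?_⟩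
        rw [show m = 2 ^ k + (m - 2 ^ k) by omega, Nat.testBit_two_pow_add_eq,
          Nat.testBit_lt_two_pow h2]
        rfl
      · rintro ⟨h1, h2⟩
        have h3 := Nat.ge_two_pow_of_testBit h2
        exact ⟨h3, by omega⟩
    · rw [Bool.eq_false_iff.2 (fun h => hkx (beq_iff.1 h)), cond_false, Nat.testBit_or,
        Nat.testBit_shiftLeft, ih, ih]
      rcases lt_or_gt_of_ne hkx with h | h
      · simp [show ¬ x < k by omega, show ¬ x < k + 1 by omega]
      · simp only [decide_eq_true h, decide_eq_true (show x < k + 1 by omega), Bool.true_and]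
        by_cases h1 : m < 2 ^ k
        · simp [h1, show ¬ 2 ^ k ≤ m by omega, show m < 2 ^ k * 2 by omega]
        · by_cases h2 : m < 2 ^ k * 2
          · rw [show m = 2 ^ k + (m - 2 ^ k) by omega, Nat.testBit_two_pow_add_gt h,
              ← show m = 2 ^ k + (m - 2 ^ k) by omega]
            simp [h1, h2, show 2 ^ k ≤ m by omega, show m - 2 ^ k < 2 ^ k by omega]
          · simp [h1, h2, show ¬ m - 2 ^ k < 2 ^ k by omega]

namespace Table

theorem count_eq (t : Table) (f : ℕ → Bool) : count (fun x : t.El => f (val x)) = pts.countP f := by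
  refine (count_congr t.enum.symm (p := fun x : t.El => f (val x)) (q := fun x : Fin 16 => f x)
    fun _ => rfl).trans ?_
  rw [count,
    show pts = (List.finRange 16).map Fin.val from rfl, List.countP_map]
  have : ((Finset.univ.filter fun x : Fin 16 => f x = true)).card =
      Multiset.countP (fun x : Fin 16 => f x = true) Finset.univ.val := by
    rw [Finset.card, Finset.filter_val, Multiset.countP_eq_card_filter]
  rw [this, show (Finset.univ : Finset (Fin 16)).val = (List.finRange 16 : Multiset (Fin 16)) from rfl,
    Multiset.coe_countP]
  congr 1
  funext x
  simp

theorem count_pred_maskOf (t : Table) {l : List ℕ} (hl : l.Nodup) (hlt : ∀ x ∈ l, x < 16)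
    (f : ℕ → Bool) : count (fun x : t.El => pred (maskOf l) x && f (val x)) = l.countP f := by
  have h : (fun x : t.El => pred (maskOf l) x && f (val x)) =
      fun x : t.El => (fun y => decide (y ∈ l) && f y) (val x) := by
    funext x
    rw [pred, testBit_maskOf]
  rw [h, count_eq t fun y => decide (y ∈ l) && f y, List.countP_eq_length_filter, List.countP_eq_length_filter]
  refine List.Perm.length_eq ?_
  rw [List.perm_ext_iff_of_nodup ((by decide : pts.Nodup).filter _) (hl.filter _)]
  intro y
  simp only [List.mem_filter, mem_pts, Bool.and_eq_true, decide_eq_true_eq]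
  exact ⟨fun h => h.2, fun h => ⟨hlt y h.1, h⟩⟩

theorem exists_mask {t : Table} (b : t.El → Bool) : ∃ m, pred m = b ∧ m < 65536 := by
  refine ⟨maskOf (pts.filter fun x => if hx : x < 16 then b (ofLt hx) else false), ?_, ?_⟩
  · funext x
    rw [pred, testBit_maskOf, Bool.eq_iff_iff, decide_eq_true_iff, List.mem_filter, mem_pts]
    have : ofLt (val_lt x) = x := val_inj.1 (val_ofLt _)
    simp only [val_lt, dif_pos, this, true_and]
  · refine Nat.lt_pow_two_of_testBit (n := 16) _ fun i hi => ?_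
    rw [testBit_maskOf, decide_eq_false]
    simp only [List.mem_filter, mem_pts, not_and]
    omega

end Table

open Table

variable {t : Table}

theorem testBit_sub_one (n i : ℕ) : (Nat.sub (Nat.pow 2 n) 1).testBit i = decide (i < n) :=
  Nat.testBit_two_pow_sub_one n i

theorem testBit_diffSetTable (t : Table) (m : ℕ) : (diffSetTable t.code).testBit m = true ↔
    m < 65536 ∧ ∀ g : t.El, g ≠ 1 → count (fun x : t.El => pred m x && pred m (x * g)) = 2 := by
  have key : ∀ (M : ℕ) (F : ℕ → ℕ) (l : List ℕ), (@List.rec ℕ (fun _ => ℕ) M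
      (fun g _ ih => Nat.land (F g) ih) l).testBit m = true ↔
      M.testBit m = true ∧ ∀ g ∈ l, (F g).testBit m = true := by
    intro M F l
    induction l with
    | nil => simp
    | cons a l ih =>
      change (F a &&& _).testBit m = true ↔ _
      rw [Nat.testBit_and, Bool.and_eq_true, ih, List.forall_mem_cons]
      tauto
  rw [diffSetTable, forceList_eq]
  refine (key (Nat.sub (Nat.pow 2 65536) 1) (fun g => exactTwo (kmap (fun x => Nat.land (nth (kmap (fun x => bitTable x 16) pts) x)
    (nth (kmap (fun x => bitTable x 16) pts) (tmul t.code x g))) pts))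
    [1, 2, 3, 4, 5, 6, 7, 8, 9, 10, 11, 12, 13, 14, 15]).trans ?_
  rw [testBit_sub_one, decide_eq_true_iff]
  refine and_congr_right fun hm => ?_
  have hg : ∀ g : t.El, (exactTwo (kmap (fun x => Nat.land (nth (kmap (fun x => bitTable x 16) pts) x)
      (nth (kmap (fun x => bitTable x 16) pts) (tmul t.code x (val g)))) pts)).testBit m = true ↔
      count (fun x : t.El => pred m x && pred m (x * g)) = 2 := by
    intro g
    have : (fun x : t.El => pred m x && pred m (x * g)) =
        fun x : t.El => (fun y => m.testBit y && m.testBit (tmul t.code y (val g))) (val x) := by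
      funext x
      rw [pred, pred, val_mul]
    rw [testBit_exactTwo, decide_eq_true_iff, this,
      count_eq t fun y => m.testBit y && m.testBit (tmul t.code y (val g)), kmap_eq, List.countP_map]
    have : pts.countP ((fun x => x.testBit m) ∘ fun x => Nat.land
        (nth (kmap (fun x => bitTable x 16) pts) x)
        (nth (kmap (fun x => bitTable x 16) pts) (tmul t.code x (val g)))) =
        pts.countP fun y => m.testBit y && m.testBit (tmul t.code y (val g)) := by
      refine List.countP_congr fun x hx => ?_
      have hx := mem_pts.1 hx
      rw [Function.comp_apply, nth_kmap_pts _ hx, nth_kmap_pts _ (tmul_lt _ _ _)]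
      change (bitTable _ _ &&& bitTable _ _).testBit m = true ↔ _
      rw [Nat.testBit_and, testBit_bitTable, testBit_bitTable]
      simp [hx, hm, tmul_lt]
    rw [this]
  constructor
  · intro h g hg1
    refine (hg g).1 (h _ ?_)
    have h0 : val g ≠ 0 := fun h => hg1 (val_inj.1 (h.trans val_one.symm))
    have h16 := val_lt g
    simp only [List.mem_cons, List.not_mem_nil, or_false]
    omega
  · intro h g hg1
    have h0 : g ≠ 0 ∧ g < 16 := by
      simp only [List.mem_cons, List.not_mem_nil, or_false] at hg1
      omega
    have := (hg (ofLt h0.2)).2 (h _ fun e => h0.1 ?_)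
    · rwa [val_ofLt] at this
    · rw [← val_ofLt (t := t) h0.2, e, val_one]

/-- What `orbitsOk` verifies. -/
structure OrbitsOk (t : Table) (os : List Orbit) : Prop where
  ok : ∀ o ∈ os, o.Ok t
  disjoint : os.Pairwise fun o o' => transporters t.code t.inv o o' = []
  mask_iff : ∀ m, (∃ o ∈ os, ∃ e ∈ entries t.code o false, e.mask = m) ↔
    m < 65536 ∧ ∀ g : t.El, g ≠ 1 → count (fun x : t.El => pred m x && pred m (x * g)) = 2

theorem orbitsOk_ok {os : List Orbit} (h : orbitsOk t.code os = true) : OrbitsOk t os := by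
  have key : ∀ l : List Orbit, @List.rec Orbit (fun _ => Bool) true (fun o os ih =>
      bif kall (fun o' => @List.rec ℕ (fun _ => Bool) true (fun _ _ _ => false)
        (transporters t.code t.inv o o')) os then ih else false) l = true →
      l.Pairwise fun o o' => transporters t.code t.inv o o' = [] := by
    intro l hl
    induction l with
    | nil => exact List.Pairwise.nil
    | cons o l ih =>
      change (bif kall _ l then _ else false) = true at hl
      rw [Bool.cond_false_right, Bool.and_eq_true, kall_eq, List.all_eq_true] at hl
      refine List.Pairwise.cons (fun o' ho' => ?_) (ih hl.2)
      have := hl.1 o' ho'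
      rcases htr : transporters t.code t.inv o o' with _ | ⟨a, l'⟩
      · rfl
      · rw [htr] at this
        exact absurd this (by simp)
  rw [orbitsOk, force_eq] at h
  simp only [rec_bool] at h
  rw [Bool.cond_false_right, Bool.cond_false_right, Bool.and_eq_true, Bool.and_eq_true, kall_eq,
    List.all_eq_true, beq_iff] at h
  refine ⟨fun o ho => orbitOk_ok (h.1 o ho), key os h.2.1, fun m => ?_⟩
  rw [← testBit_diffSetTable, h.2.2, testBit_ksum, List.any_eq_true]
  simp only [testBit_ksum, List.any_eq_true, testBit_bit, decide_eq_true_eq]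

variable {os : List Orbit}

theorem OrbitsOk.exists_inOrbit (h : OrbitsOk t os) {b : t.El → Bool} (hb : IsDiffSet b) :
    ∃ o ∈ os, ∃ e ∈ entries t.code o false, pred e.mask = b := by
  obtain ⟨m, rfl, hm⟩ := exists_mask b
  obtain ⟨o, ho, e, he, rfl⟩ := (h.mask_iff m).2 ⟨hm, hb.right⟩
  exact ⟨o, ho, e, he, rfl⟩

theorem OrbitsOk.isDiffSet_entry (h : OrbitsOk t os) {o : Orbit} (ho : o ∈ os) {e : Ent}
    (he : e ∈ entries t.code o false) : IsDiffSet (pred e.mask : t.El → Bool) := by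
  have hs := isEntry_of_mem (h.ok o ho) he
  refine ⟨?_, ((h.mask_iff e.mask).1 ⟨o, ho, e, he, rfl⟩).2⟩
  have := count_pred_maskOf t hs.nodup hs.lt fun _ => true
  rw [List.countP_true, hs.length, ← hs.mask] at this
  simpa using this

end GroupCubes

namespace GroupCubes

theorem land_bit (c i : ℕ) : Nat.land c (bit i) = 0 ↔ c.testBit i = false := by
  change c &&& (1 <<< i) = 0 ↔ _
  rw [Nat.one_shiftLeft, Nat.and_two_pow]
  cases c.testBit i <;> simp

theorem rec_nat {α : Type} (n : ℕ) (a b : α) :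
    @Nat.rec (fun _ => α) a (fun _ _ => b) n = if n = 0 then a else b := by
  cases n <;> simp

theorem forceEnt_eq {α : Type} (e : Ent) (k : Ent → α) : forceEnt e k = k e := by
  simp only [forceEnt, force_eq, forceList_eq]

theorem forceBEnt_eq {α : Type} (e : BEnt) (k : BEnt → α) : forceBEnt e k = k e := by
  simp only [forceBEnt, force_eq, forceEnt_eq]

theorem forceItem_eq {α : Type} (e : Item) (k : Item → α) : forceItem e k = k e := by
  simp only [forceItem, force_eq, forceAll_eq forceList_eq]

theorem forceS3_eq {α : Type} (e : S3) (k : S3 → α) : forceS3 e k = k e := by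
  simp only [forceS3, force_eq]

/-- The bits of the blocks are distinct powers of two. -/
structure Numbered (V : List BEnt) : Prop where
  bit_eq : ∀ e ∈ V, e.bit = bit e.bit.log2
  inj : ∀ e ∈ V, ∀ e' ∈ V, e.bit = e'.bit → e = e'

theorem enum_cons (a : Ent) (l : List Ent) (s : ℕ) :
    enum (a :: l) (bit s) = ⟨bit s, a⟩ :: enum l (bit (s + 1)) := by
  have : Nat.mul 2 (bit s) = bit (s + 1) := by
    change 2 * (1 <<< s) = 1 <<< (s + 1)
    rw [Nat.one_shiftLeft, Nat.one_shiftLeft, pow_succ, Nat.mul_comm]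
  rw [← this]
  exact congrArg (_ :: ·) (force_eq _ _)

theorem log2_bit (s : ℕ) : (bit s).log2 = s := by
  change (1 <<< s).log2 = s
  rw [Nat.one_shiftLeft, Nat.log2_two_pow]

theorem enum_spec (l : List Ent) (s : ℕ) :
    (∀ e ∈ enum l (bit s), s ≤ e.bit.log2 ∧ e.bit = bit e.bit.log2 ∧ e.ent ∈ l) ∧
      (∀ a ∈ l, ∃ e ∈ enum l (bit s), e.ent = a) ∧
      (enum l (bit s)).Pairwise fun e e' => e.bit ≠ e'.bit := by
  induction l generalizing s with
  | nil =>
    refine ⟨fun e he => ?_, fun a ha => ?_, List.Pairwise.nil⟩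
    · exact absurd he List.not_mem_nil
    · exact absurd ha List.not_mem_nil
  | cons a l ih =>
    obtain ⟨h1, h2, h3⟩ := ih (s + 1)
    rw [enum_cons]
    refine ⟨fun e he => ?_, fun b hb => ?_, List.Pairwise.cons (fun e he h => ?_) h3⟩
    · rcases List.mem_cons.1 he with rfl | he
      · exact ⟨(log2_bit s).ge, by rw [log2_bit], List.mem_cons_self⟩
      · obtain ⟨ha, hb, hc⟩ := h1 e he
        exact ⟨by omega, hb, List.mem_cons_of_mem _ hc⟩
    · rcases List.mem_cons.1 hb with rfl | hb
      · exact ⟨_, List.mem_cons_self, rfl⟩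
      · obtain ⟨e, he, rfl⟩ := h2 b hb
        exact ⟨e, List.mem_cons_of_mem _ he, rfl⟩
    · have := (h1 e he).1
      rw [← h, log2_bit] at this
      omega

theorem numbered_enum (l : List Ent) : Numbered (enum l 1) := by
  obtain ⟨h1, -, h3⟩ := enum_spec l 0
  exact ⟨fun e he => (h1 e he).2.1, fun e he e' he' h =>
    List.inj_on_of_nodup_map (List.pairwise_map.2 h3) he he' h⟩

section

variable {V : List BEnt}

theorem testBit_column (hV : Numbered V) {e : BEnt} (he : e ∈ V) (x : ℕ) :
    (column V x).testBit e.bit.log2 = e.ent.mask.testBit x := by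
  rw [column, testBit_ksum, Bool.eq_iff_iff, List.any_eq_true]
  simp only [rec_bool, mem_eq]
  constructor
  · rintro ⟨e', he', h⟩
    rcases hx : e'.ent.mask.testBit x with _ | _
    · rw [hx, cond_false, Nat.zero_testBit] at h
      exact absurd h (by simp)
    · rw [hx, cond_true, hV.bit_eq e' he', testBit_bit, decide_eq_true_iff] at h
      rwa [← hV.inj e' he' e he (by rw [hV.bit_eq e' he', h, ← hV.bit_eq e he])]
  · intro h
    refine ⟨e, he, ?_⟩
    rw [h, cond_true]
    nth_rw 1 [hV.bit_eq e he]
    rw [testBit_bit, decide_eq_true rfl]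

/-- the word of the blocks meeting the set `els` in two points -/
def neighbours (V : List BEnt) (els : List ℕ) : ℕ :=
  exactTwo (kmap (nth (kmap (column V) pts)) els)

theorem testBit_neighbours (hV : Numbered V) {els : List ℕ} (hlt : ∀ x ∈ els, x < 16) {e : BEnt}
    (he : e ∈ V) : (neighbours V els).testBit e.bit.log2 =
      decide (els.countP (fun x => e.ent.mask.testBit x) = 2) := by
  rw [neighbours, testBit_exactTwo, kmap_eq, List.countP_map]
  have : els.countP ((fun w => w.testBit e.bit.log2) ∘ nth (kmap (column V) pts)) =
      els.countP fun x => e.ent.mask.testBit x :=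
    List.countP_congr fun x hx => by
      rw [Function.comp_apply, nth_kmap_pts _ (hlt x hx), testBit_column hV he]
  rw [this]

end

/-- the incidence word obtained by adding the blocks `es`, with labels from `lab` on -/
def addBlocks : ℕ → List BEnt → ℕ → ℕ
  | _, [], P => P
  | lab, e :: es, P => addBlocks (lab + 1) es (Nat.lor P (contribution lab e.ent.els
      (Nat.shiftLeft (Nat.mod e.ent.mask 16) (Nat.mul 4 lab))))

/-- the list of maps obtained by adding those of the blocks `es` -/
def addMaps : List BEnt → List (List ℕ) → List (List ℕ)
  | [], us => us
  | e :: es, us => addMaps es (kapp (kmap shifts e.ent.us) us)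

theorem mem_addMaps {es : List BEnt} {us : List (List ℕ)} {s : List ℕ} :
    s ∈ addMaps es us ↔ s ∈ us ∨ ∃ e ∈ es, ∃ u ∈ e.ent.us, shifts u = s := by
  induction es generalizing us with
  | nil => simp [addMaps]
  | cons e es ih =>
    rw [addMaps, ih, kapp_eq, kmap_eq, List.mem_append, List.mem_map]
    simp only [List.mem_cons, exists_eq_or_imp]
    rw [or_comm (a := s ∈ us), or_assoc, or_comm (a := s ∈ us), or_assoc]

theorem testBit_contribution {lab l : ℕ} (hlab : lab < 16) (hl : l < 16) (els : List ℕ) (tag x : ℕ) :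
    (contribution lab els tag).testBit (64 + 16 * x + l) = true ↔ l = lab ∧ x ∈ els := by
  change ((tag &&& 2 ^ 64 - 1) ||| (_ <<< 64)).testBit _ = true ↔ _
  rw [Nat.testBit_or, Nat.testBit_and, Nat.testBit_two_pow_sub_one, Nat.testBit_shiftLeft,
    decide_eq_false (by omega), Bool.and_false, Bool.false_or, decide_eq_true (by omega),
    Bool.true_and, testBit_ksum, List.any_eq_true]
  simp only [testBit_bit, decide_eq_true_eq]
  constructor
  · rintro ⟨y, hy, h⟩
    change 16 * y + lab = _ at h
    obtain rfl : y = x := by omega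
    exact ⟨by omega, hy⟩
  · rintro ⟨rfl, hx⟩
    refine ⟨x, hx, ?_⟩
    change 16 * x + l = _
    omega

theorem testBit_addBlocks {lab l : ℕ} {es : List BEnt} (hlab : lab + es.length ≤ 16) (hl : l < 16)
    (P x : ℕ) : (addBlocks lab es P).testBit (64 + 16 * x + l) = true ↔
      P.testBit (64 + 16 * x + l) = true ∨
        ∃ (i : ℕ) (hi : i < es.length), l = lab + i ∧ x ∈ es[i].ent.els := by
  induction es generalizing lab P with
  | nil => simp [addBlocks]
  | cons e es ih =>
    rw [List.length_cons] at hlab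
    rw [addBlocks, ih (by omega)]
    change Nat.testBit (P ||| _) _ = true ∨ _ ↔ _
    rw [Nat.testBit_or, Bool.or_eq_true, testBit_contribution (by omega) hl, or_assoc]
    refine or_congr_right ⟨?_, ?_⟩
    · rintro (⟨rfl, hx⟩ | ⟨i, hi, rfl, hx⟩)
      · exact ⟨0, by simp, rfl, hx⟩
      · exact ⟨i + 1, by simpa using hi, by omega, hx⟩
    · rintro ⟨i, hi, rfl, hx⟩
      rcases i with _ | i
      · exact Or.inl ⟨rfl, hx⟩
      · exact Or.inr ⟨i, by simpa using hi, by omega, hx⟩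

section

variable {β : Type} {lf : ℕ → List (List ℕ) → List β}

theorem mem_dfs_cons {part : List Item} {ps : List (List Item)} {c P : ℕ} {us : List (List ℕ)} {b : β} :
    b ∈ dfs lf (part :: ps) c P us ↔ ∃ it ∈ part, Nat.land c it.bit ≠ 0 ∧
      b ∈ dfs lf ps (Nat.land c it.adj) (Nat.lor P it.contrib) (kapp it.us us) := by
  have key : ∀ (X : Item → List β) (l : List Item), b ∈ @List.rec Item (fun _ => List β) []
      (fun it _ rest => @Nat.rec (fun _ => List β) rest (fun _ _ => kapp (X it) rest)
        (Nat.land c it.bit)) l ↔ ∃ it ∈ l, Nat.land c it.bit ≠ 0 ∧ b ∈ X it := by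
    intro X l
    induction l with
    | nil => simp
    | cons it l ih =>
      simp only [rec_nat] at ih ⊢
      simp only [List.mem_cons, exists_eq_or_imp, ne_eq]
      split_ifs with h
      · simp only [ih, h, ne_eq, not_true_eq_false, false_and, false_or]
      · rw [kapp_eq, List.mem_append, ih]
        simp only [h, ne_eq, not_false_eq_true, true_and]
  refine (key (fun it => force (Nat.land c it.adj) fun c' => force (Nat.lor P it.contrib) fun P' =>
    dfs lf ps c' P' (kapp it.us us)) part).trans ?_
  simp only [force_eq]

theorem parts_cons (V : List BEnt) (cols : List ℕ) (D p : ℕ) (prs : List ℕ) (lab : ℕ) :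
    parts V cols D (p :: prs) lab = (V.filter fun e => Nat.beq (Nat.land e.ent.mask D) p).map
      (mkItem cols lab) :: parts V cols D prs (lab + 1) := by
  rw [← kmap_eq, ← kfilter_eq]
  exact congrArg (_ :: ·) (force_eq _ _)

theorem mem_dfs {V : List BEnt} (hV : Numbered V) {D : ℕ} {prs : List ℕ} {lab c P : ℕ}
    {us : List (List ℕ)} {b : β} :
    b ∈ dfs lf (parts V (kmap (column V) pts) D prs lab) c P us ↔
      ∃ es, List.Forall₂ (fun p e => e ∈ V ∧ Nat.land e.ent.mask D = p) prs es ∧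
        (∀ e ∈ es, c.testBit e.bit.log2 = true) ∧
        es.Pairwise (fun e e' => (neighbours V e.ent.els).testBit e'.bit.log2 = true) ∧
        b ∈ lf (addBlocks lab es P) (addMaps es us) := by
  induction prs generalizing lab c P us with
  | nil =>
    constructor
    · intro h
      exact ⟨[], List.Forall₂.nil, by simp, List.Pairwise.nil, h⟩
    · rintro ⟨es, h, -, -, hb⟩
      cases h
      exact hb
  | cons p prs ih =>
    rw [parts_cons, mem_dfs_cons]
    constructor
    · rintro ⟨it, hit, hc, h⟩
      obtain ⟨e, he, rfl⟩ := List.mem_map.1 hit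
      rw [List.mem_filter, beq_iff] at he
      obtain ⟨es, h1, h2, h3, h4⟩ := ih.1 h
      have hce : c.testBit e.bit.log2 = true := by
        rw [← Bool.not_eq_false]
        intro h0
        refine hc ?_
        change Nat.land c e.bit = 0
        rw [hV.bit_eq e he.1, land_bit]
        exact h0
      have h2' : ∀ e' ∈ es, c.testBit e'.bit.log2 = true ∧
          (neighbours V e.ent.els).testBit e'.bit.log2 = true := fun e' he' => by
        have := h2 e' he'
        change (c &&& neighbours V e.ent.els).testBit _ = true at this
        rwa [Nat.testBit_and, Bool.and_eq_true] at this
      refine ⟨e :: es, List.Forall₂.cons he h1, ?_, ?_, h4⟩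
      · intro e' he'
        rcases List.mem_cons.1 he' with rfl | he'
        · exact hce
        · exact (h2' e' he').1
      · exact List.Pairwise.cons (fun e' he' => (h2' e' he').2) h3
    · rintro ⟨es, h1, h2, h3, h4⟩
      cases h1 with
      | cons he h1 =>
        rename_i e es
        rw [List.pairwise_cons] at h3
        refine ⟨mkItem _ lab e, List.mem_map_of_mem (List.mem_filter.2 ⟨he.1, beq_iff.2 he.2⟩), ?_,
          ih.2 ⟨es, h1, fun e' he' => ?_, h3.2, h4⟩⟩
        · change Nat.land c e.bit ≠ 0
          rw [hV.bit_eq e he.1, ne_eq, land_bit, h2 e List.mem_cons_self]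
          simp
        · change (c &&& neighbours V e.ent.els).testBit _ = true
          rw [Nat.testBit_and, h2 e' (List.mem_cons_of_mem _ he'), h3.1 e' he']
          rfl

end

end GroupCubes

namespace GroupCubes

open Table

variable {t : Table} {o o' : Orbit} {later : List Orbit}

/-- the block with label `l` of the incidence word `P` -/
def fam (t : Table) (P : ℕ) (l : Fin 16) (x : t.El) : Bool := P.testBit (64 + 16 * val x + l)

def elt (t : Table) (n : ℕ) : t.El := t.enum (Fin.ofNat 16 n)

theorem val_elt {n : ℕ} (hn : n < 16) : val (elt t n) = n := by
  rw [elt, val_enum]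
  exact Nat.mod_eq_of_lt hn

/-- whether no block contains the given three points -/
def uncovered (f : Fin 16 → t.El → Bool) (s : S3) : Bool :=
  decide (∀ l, ¬ (f l (elt t s.a) = true ∧ f l (elt t s.b) = true ∧ f l (elt t s.c) = true))

def signature (key : List S3) (f : Fin 16 → t.El → Bool) : List Bool := key.map (uncovered f)

theorem signature_comp_perm (key : List S3) (f : Fin 16 → t.El → Bool) (σ : Equiv.Perm (Fin 16)) :
    signature key (fun l x => f (σ l) x) = signature key f := by
  refine List.map_congr_left fun s _ => ?_
  rw [uncovered, uncovered, decide_eq_decide]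
  exact ⟨fun h l => by simpa using h (σ.symm l), fun h l => h (σ l)⟩

theorem keyBit_eq (Q a b c : ℕ) : keyBit Q ⟨a, b, c⟩ = decide (∀ l : Fin 16,
    ¬ (Q.testBit (a + l) = true ∧ Q.testBit (b + l) = true ∧ Q.testBit (c + l) = true)) := by
  have key : ∀ j, (Nat.land (Nat.land (Nat.shiftRight Q a) (Nat.shiftRight Q b))
      (Nat.land (Nat.shiftRight Q c) 65535)).testBit j = true ↔ j < 16 ∧
      Q.testBit (a + j) = true ∧ Q.testBit (b + j) = true ∧ Q.testBit (c + j) = true := by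
    intro j
    change (((Q >>> a) &&& (Q >>> b)) &&& ((Q >>> c) &&& 2 ^ 16 - 1)).testBit j = true ↔ _
    simp only [Nat.testBit_and, Nat.testBit_shiftRight, Nat.testBit_two_pow_sub_one,
      Bool.and_eq_true, decide_eq_true_eq]
    tauto
  rw [keyBit, Bool.eq_iff_iff, beq_iff, decide_eq_true_iff]
  refine ⟨fun h l hl => ?_, fun h => Nat.eq_of_testBit_eq fun j => ?_⟩
  · have := (key l).2 ⟨l.2, hl⟩
    rw [h, Nat.zero_testBit] at this
    exact absurd this (by simp)
  · rw [Nat.zero_testBit, ← Bool.not_eq_true, key]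
    rintro ⟨hj, hl⟩
    exact h ⟨j, hj⟩ hl

theorem map_keyBit_triples {key : List S3} (hkey : ∀ s ∈ key, s.a < 16 ∧ s.b < 16 ∧ s.c < 16) {k : ℕ}
    {φ : t.El → t.El} (hk : Codes k φ) (Q : ℕ) :
    (triples key k).map (keyBit Q) = signature key fun l x => fam t Q l (φ x) := by
  rw [triples, kmap_eq, List.map_map]
  refine List.map_congr_left fun s hs => ?_
  obtain ⟨ha, hb, hc⟩ := hkey s hs
  rw [Function.comp_apply, keyBit_eq]
  have hpos : ∀ n < 16, position (app k n) = 64 + 16 * val (φ (elt t n)) := fun n hn => by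
    rw [hk, val_elt hn]
    rfl
  rw [uncovered, decide_eq_decide]
  simp only [fam, hpos _ ha, hpos _ hb, hpos _ hc]

theorem codes_identity : Codes identity (id : t.El → t.El) := by
  intro x
  exact (app_code (f := fun x => x % 16) (fun x => Nat.mod_lt x (by norm_num))
    (t.enum.symm x)).symm ▸ (Nat.mod_eq_of_lt (val_lt x)).symm

theorem getElem?_shifts {u x : ℕ} (hx : x < 16) : (shifts u)[x]? = some (position (app u x)) := by
  rw [shifts, kmap_eq, show pts = List.range 16 from rfl, List.getElem?_map, List.getElem?_range hx]
  rfl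

theorem fam_rename {u : ℕ} {φ : t.El → t.El} (hu : Codes u φ) (P : ℕ) (l : Fin 16) (x : t.El) :
    fam t (rename P (shifts u)) l x = fam t P l (φ x) := by
  have key : ∀ (us : List ℕ) (y s : ℕ), us[y]? = some s → (@List.rec ℕ (fun _ => ℕ) 0
      (fun s _ ih => Nat.lor (Nat.land (Nat.shiftRight P s) 65535) (Nat.shiftLeft ih 16)) us).testBit
      (16 * y + l) = P.testBit (s + l) := by
    intro us
    induction us with
    | nil => simp
    | cons a us ih =>
      intro y s h
      change (((P >>> a) &&& 2 ^ 16 - 1) ||| (_ <<< 16)).testBit _ = _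
      rw [Nat.testBit_or, Nat.testBit_and, Nat.testBit_shiftRight, Nat.testBit_two_pow_sub_one,
        Nat.testBit_shiftLeft]
      have hl := l.2
      rcases y with _ | y
      · rw [List.getElem?_cons_zero, Option.some_inj] at h
        subst h
        simp [hl]
      · rw [List.getElem?_cons_succ] at h
        rw [decide_eq_false (by omega), decide_eq_true (by omega), Bool.and_false, Bool.false_or,
          Bool.true_and, show 16 * (y + 1) + l.val - 16 = 16 * y + l by omega, ih y s h]
  rw [fam, fam, hu, rename]
  change ((P &&& 2 ^ 64 - 1) ||| (_ <<< 64)).testBit _ = _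
  rw [Nat.testBit_or, Nat.testBit_and, Nat.testBit_two_pow_sub_one, Nat.testBit_shiftLeft,
    decide_eq_false (by omega), decide_eq_true (by omega), Bool.and_false, Bool.false_or,
    Bool.true_and, show 64 + 16 * val x + l.val - 64 = 16 * val x + l by omega,
    key _ _ _ (getElem?_shifts (val_lt x))]
  rfl

theorem keyLt_eq (Q : ℕ) (ss : List S3) (own : List Bool) (h : own.length = ss.length) :
    keyLt Q ss own = decide (ss.map (keyBit Q) < own) := by
  induction ss generalizing own with
  | nil =>
    rw [List.eq_nil_of_length_eq_zero h]
    simp [keyLt]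
  | cons s ss ih =>
    rcases own with _ | ⟨b, own⟩
    · simp at h
    · have ih := ih own (by simpa using h)
      change @Bool.rec (fun _ => Bool) (@Bool.rec (fun _ => Bool) (keyLt Q ss own) true b)
        (@Bool.rec (fun _ => Bool) false (keyLt Q ss own) b) (keyBit Q s) = _
      rw [ih, List.map_cons, Bool.eq_iff_iff, decide_eq_true_iff, List.cons_lt_cons_iff]
      cases keyBit Q s <;> cases b <;> simp

theorem canonical_iff (keys : List (List S3)) (own : List Bool) (P : ℕ) (us : List (List ℕ))
    (h : ∀ ss ∈ keys, own.length = ss.length) : canonical keys own P us = true ↔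
      ∀ u ∈ us, ∀ ss ∈ keys, ¬ ss.map (keyBit (rename P u)) < own := by
  simp only [canonical, kall_eq, List.all_eq_true, force_eq, rec_bool]
  refine forall₂_congr fun u _ => forall₂_congr fun ss hss => ?_
  rw [keyLt_eq _ _ _ (h ss hss)]
  simp

theorem blockOn_iff (P : ℕ) (l : List ℕ) :
    blockOn P l = true ↔ ∃ i : Fin 16, ∀ s ∈ l, P.testBit (s + i) = true := by
  have key : ∀ j, (@List.rec ℕ (fun _ => ℕ) 65535
      (fun s _ ih => Nat.land (Nat.shiftRight P s) ih) l).testBit j = true ↔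
      j < 16 ∧ ∀ s ∈ l, P.testBit (s + j) = true := by
    intro j
    induction l with
    | nil =>
      change Nat.testBit (2 ^ 16 - 1) j = true ↔ _
      rw [Nat.testBit_two_pow_sub_one]
      simp
    | cons a l ih =>
      change ((P >>> a) &&& _).testBit j = true ↔ _
      rw [Nat.testBit_and, Bool.and_eq_true, ih, Nat.testBit_shiftRight, List.forall_mem_cons]
      tauto
  rw [blockOn, rec_bool, Bool.cond_false_left, Bool.and_true, Bool.not_eq_true', ← Bool.not_eq_true,
    beq_iff]
  constructor
  · intro h
    by_contra! hn
    refine h (Nat.eq_of_testBit_eq fun j => ?_)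
    rw [Nat.zero_testBit, ← Bool.not_eq_true, key]
    rintro ⟨hj, hs⟩
    obtain ⟨s, hsl, hs'⟩ := hn ⟨j, hj⟩
    exact hs' (hs s hsl)
  · rintro ⟨i, hi⟩ h
    have := (key i).2 ⟨i.2, hi⟩
    rw [h, Nat.zero_testBit] at this
    exact absurd this (by simp)

theorem kall_blockOn_iff (ho : o.Ok t) (P : ℕ) (m : ℕ → ℕ → ℕ) (μ : t.El → t.El → t.El)
    (hm : ∀ a d, val (μ a d) = m (val a) (val d)) :
    kall (blockOn P) (kmap (fun a => kmap (fun d => position (m a d)) o.Dl) pts) = true ↔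
      ∀ a, ∃ i, ∀ d, pred o.D d = true → fam t P i (μ a d) = true := by
  rw [kall_eq, List.all_eq_true, kmap_eq, List.forall_mem_map]
  simp only [blockOn_iff, kmap_eq, List.forall_mem_map]
  have hd : ∀ d : t.El, pred o.D d = true ↔ val d ∈ o.Dl := fun d => by
    rw [pred, ho.testBit, decide_eq_true_iff]
  constructor
  · intro h a
    obtain ⟨i, hi⟩ := h (val a) (mem_pts.2 (val_lt a))
    refine ⟨i, fun d hD => ?_⟩
    rw [fam, hm]
    exact hi _ ((hd d).1 hD)
  · intro h a ha
    obtain ⟨i, hi⟩ := h (ofLt (mem_pts.1 ha))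
    refine ⟨i, fun d hD => ?_⟩
    obtain ⟨x, rfl⟩ := ho.exists_el hD
    have := hi x ((hd x).2 hD)
    rw [fam, hm, val_ofLt] at this
    exact this

theorem nondiff_iff (ho : o.Ok t) (P : ℕ) :
    nondiff (kmap (fun a => kmap (fun d => position (tmul t.code d a)) o.Dl) pts)
      (kmap (fun a => kmap (fun d => position (tmul t.code a d)) o.Dl) pts) P = true ↔
      Rigid (fam t P) (pred o.D) := by
  rw [nondiff, rec_bool, rec_bool, Bool.cond_false_left, Bool.cond_false_left, Bool.and_true,
    Bool.and_eq_true, Bool.not_eq_true', Bool.not_eq_true', ← Bool.not_eq_true, ← Bool.not_eq_true,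
    kall_blockOn_iff ho P (fun a d => tmul t.code d a) (fun a d => d * a) fun a d => val_mul d a,
    kall_blockOn_iff ho P (fun a d => tmul t.code a d) (fun a d => a * d) fun a d => val_mul a d,
    Rigid]
  simp only [not_forall, not_exists, Bool.not_eq_true, exists_prop]

/-- the blocks that may occur besides the first difference set -/
def blocks (t : Table) (o : Orbit) (later : List Orbit) : List BEnt :=
  enum (entries t.code o true ++ later.flatMap fun o' => entries t.code o' false) 1

theorem mem_leaf {key : List S3} {keys : List (List S3)} {tr tl : List (List ℕ)} {P P' : ℕ}
    {us : List (List ℕ)} : P' ∈ leaf key keys tr tl P us ↔ P' = P ∧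
      canonical keys (key.map (keyBit P)) P us = true ∧ nondiff tr tl P = true := by
  rw [leaf, kmap_eq, rec_bool, rec_bool]
  cases canonical keys (key.map (keyBit P)) P us <;> cases nondiff tr tl P <;> simp

theorem mem_reps (ho : o.Ok t) {P : ℕ} : P ∈ reps t.code o later ↔
    ∃ es, List.Forall₂ (fun p e => e ∈ blocks t o later ∧ Nat.land e.ent.mask o.D = p) o.pairs es ∧
      es.Pairwise (fun e e' =>
        (neighbours (blocks t o later) e.ent.els).testBit e'.bit.log2 = true) ∧
      P = addBlocks 0 es (contribution 15 o.Dl 0) ∧ Rigid (fam t P) (pred o.D) ∧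
      ∀ u ∈ addMaps es [shifts identity], ∀ k ∈ transporters t.code t.inv o o,
        ¬ (triples o.key k).map (keyBit (rename P u)) < (triples o.key identity).map (keyBit P) := by
  have hV : Numbered (blocks t o later) := numbered_enum _
  have hc : ∀ e ∈ blocks t o later,
      (ksum (fun e => e.bit) (blocks t o later)).testBit e.bit.log2 = true := fun e he => by
    rw [testBit_ksum, List.any_eq_true]
    refine ⟨e, he, ?_⟩
    nth_rw 1 [hV.bit_eq e he]
    rw [testBit_bit, decide_eq_true rfl]
  have hblocks : enum (kapp (entries t.code o true) (kflat (fun o' => entries t.code o' false) later))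
      1 = blocks t o later := by
    rw [blocks, kapp_eq, kflat_eq]
  rw [reps, forceAll_eq forceBEnt_eq, hblocks]
  simp only [forceList_eq, forceAll_eq forceS3_eq, forceAll_eq (forceAll_eq forceS3_eq),
    forceAll_eq (forceAll_eq forceItem_eq), forceAll_eq forceList_eq, force_eq]
  rw [mem_dfs hV]
  refine exists_congr fun es => and_congr_right fun hes => ?_
  have hmem : ∀ e ∈ es, e ∈ blocks t o later := fun e he => by
    obtain ⟨i, hi, rfl⟩ := List.getElem_of_mem he
    exact ((List.forall₂_iff_get.1 hes).2 i (by rwa [(List.forall₂_iff_get.1 hes).1]) hi).1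
  rw [and_iff_right fun e he => hc e (hmem e he)]
  refine and_congr_right fun _ => ?_
  rw [mem_leaf]
  refine and_congr_right fun h => ?_
  subst h
  rw [nondiff_iff ho, canonical_iff, and_comm]
  · simp only [kmap_eq, List.forall_mem_map, Table.inv]
  · simp [triples, kmap_eq]

end GroupCubes

namespace GroupCubes

open Table

variable {t : Table} {os later l : List Orbit} {o : Orbit}

theorem mem_blocks {e : BEnt} (he : e ∈ blocks t o later) :
    e.ent ∈ entries t.code o true ∨ ∃ o' ∈ later, e.ent ∈ entries t.code o' false := by
  have := ((enum_spec _ 0).1 e he).2.2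
  rwa [List.mem_append, List.mem_flatMap] at this

theorem exists_mem_blocks {a : Ent}
    (ha : a ∈ entries t.code o true ∨ ∃ o' ∈ later, a ∈ entries t.code o' false) :
    ∃ e ∈ blocks t o later, e.ent = a :=
  (enum_spec _ 0).2.1 a (by rwa [List.mem_append, List.mem_flatMap])

theorem numbered_blocks : Numbered (blocks t o later) := numbered_enum _

theorem exists_entry {flag : Bool} (flag' : Bool) {e : Ent} (he : e ∈ entries t.code o flag) :
    ∃ e' ∈ entries t.code o flag', e'.mask = e.mask := by
  simp only [entries, kflat_eq, kmap_eq, List.mem_flatMap, List.mem_map, force_eq] at he ⊢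
  obtain ⟨p, hp, a, ha, rfl⟩ := he
  exact ⟨_, ⟨p, hp, a, ha, rfl⟩, rfl⟩

theorem OrbitsOk.exists_entry_of_inOrbit (h : OrbitsOk t os) (hs : l <:+ os) {b : t.El → Bool}
    (hb : IsDiffSet b) (hl : ∃ o ∈ l, InOrbit t o b) :
    ∃ o ∈ l, ∃ e ∈ entries t.code o false, pred e.mask = b := by
  obtain ⟨pre, rfl⟩ := hs
  obtain ⟨o, ho, e, he, rfl⟩ := h.exists_inOrbit hb
  rcases List.mem_append.1 ho with hp | hp
  · obtain ⟨o', ho', hb'⟩ := hl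
    exact absurd hb' (not_inOrbit_both (h.ok o ho) (h.ok o' (List.mem_append_right _ ho'))
      ((List.pairwise_append.1 h.disjoint).2.2 o hp o' ho') (isEntry_of_mem (h.ok o ho) he).inOrbit)
  · exact ⟨o, hp, e, he, rfl⟩

theorem OrbitsOk.not_inOrbit (h : OrbitsOk t os) (hs : o :: later <:+ os) {b : t.El → Bool}
    (hb : InOrbit t o b) {o' : Orbit} (ho' : o' ∈ later) : ¬ InOrbit t o' b :=
  not_inOrbit_both (h.ok o (hs.subset List.mem_cons_self))
    (h.ok o' (hs.subset (List.mem_cons_of_mem _ ho')))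
    ((List.pairwise_cons.1 (h.disjoint.sublist hs.sublist)).1 o' ho') hb

/-- the properties of the blocks used in the search -/
structure IsBlock (t : Table) (o : Orbit) (later : List Orbit) (e : Ent) : Prop where
  mask : e.mask = maskOf e.els
  nodup : e.els.Nodup
  lt : ∀ x ∈ e.els, x < 16
  ds : IsDiffSet (pred e.mask : t.El → Bool)
  inOrbit : ∃ o' ∈ o :: later, InOrbit t o' (pred e.mask)
  us : ∀ c ∈ e.us, ∃ u : t.El ≃ t.El, Codes c u ∧ Heapish u ∧ ∀ x, pred o.D x = pred e.mask (u x)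
  exists_us : InOrbit t o (pred e.mask) →
    ∃ c ∈ e.us, ∃ u : t.El ≃ t.El, Codes c u ∧ Heapish u ∧ ∀ x, pred o.D x = pred e.mask (u x)

theorem OrbitsOk.isBlock (h : OrbitsOk t os) (hs : o :: later <:+ os) {e : BEnt}
    (he : e ∈ blocks t o later) : IsBlock t o later e.ent := by
  rcases mem_blocks he with he | ⟨o', ho', he⟩
  · have ho : o ∈ os := hs.subset List.mem_cons_self
    have hE := isEntry_of_mem (h.ok o ho) he
    obtain ⟨e', he', hm⟩ := exists_entry false he
    obtain ⟨c, u, hc, hu, hD, hus⟩ := hE.map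
    refine ⟨hE.mask, hE.nodup, hE.lt, hm ▸ h.isDiffSet_entry ho he',
      ⟨o, List.mem_cons_self, hE.inOrbit⟩, fun c' hc' => ?_, fun _ => ?_⟩
    · rw [hus, cond_true, List.mem_singleton] at hc'
      exact hc' ▸ ⟨u, hc, hu, hD⟩
    · exact ⟨c, by rw [hus, cond_true, List.mem_singleton], u, hc, hu, hD⟩
  · have ho := hs.subset (List.mem_cons_of_mem _ ho')
    have hE := isEntry_of_mem (h.ok o' ho) he
    obtain ⟨_, _, -, -, -, hus⟩ := hE.map
    refine ⟨hE.mask, hE.nodup, hE.lt, h.isDiffSet_entry ho he,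
      ⟨o', List.mem_cons_of_mem _ ho', hE.inOrbit⟩, fun c' hc' => ?_, fun ho => ?_⟩
    · rw [hus, cond_false] at hc'
      exact absurd hc' List.not_mem_nil
    · exact absurd hE.inOrbit (h.not_inOrbit hs ho ho')

/-- the incidence word of the blocks `es` and the first difference set -/
def word (o : Orbit) (es : List BEnt) : ℕ := addBlocks 0 es (contribution 15 o.Dl 0)

theorem fam_word {es : List BEnt} (hl : es.length = 15)
    (he : ∀ e ∈ es, IsBlock t o later e.ent) {i : ℕ} (hi : i < es.length) (hi' : i < 16) :
    fam t (word o es) ⟨i, hi'⟩ = pred es[i].ent.mask := by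
  funext x
  rw [fam, word, Bool.eq_iff_iff, testBit_addBlocks (by omega) hi',
    testBit_contribution (by norm_num) hi', pred, (he _ (List.getElem_mem hi)).mask, testBit_maskOf,
    decide_eq_true_iff]
  constructor
  · rintro (⟨h, -⟩ | ⟨j, hj, e, hx⟩)
    · omega
    · obtain rfl : i = j := by omega
      exact hx
  · exact fun hx => Or.inr ⟨i, hi, by omega, hx⟩

theorem fam_word_last (ho : o.Ok t) {es : List BEnt} (hl : es.length = 15) :
    fam t (word o es) 15 = pred o.D := by
  funext x
  rw [fam, word, Bool.eq_iff_iff, testBit_addBlocks (by omega) (by decide),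
    testBit_contribution (by norm_num) (by decide), pred, ho.testBit, decide_eq_true_iff]
  constructor
  · rintro (⟨-, h⟩ | ⟨j, hj, e, -⟩)
    · exact h
    · have : ((15 : Fin 16) : ℕ) = 15 := rfl
      omega
  · exact fun hx => Or.inl ⟨rfl, hx⟩

theorem forall_canonical_iff (ho : o.Ok t) {es : List BEnt} (hl : es.length = 15)
    (he : ∀ e ∈ es, IsBlock t o later e.ent) :
    (∀ u ∈ addMaps es [shifts identity], ∀ k ∈ transporters t.code t.inv o o,
      ¬ (triples o.key k).map (keyBit (rename (word o es) u)) <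
        (triples o.key identity).map (keyBit (word o es))) ↔
    ∀ φ : t.El ≃ t.El, Heapish φ → (∃ i, ∀ x, pred o.D x = fam t (word o es) i (φ x)) →
      ¬ signature o.key (fun l x => fam t (word o es) l (φ x)) <
        signature o.key (fam t (word o es)) := by
  have hid : (triples o.key identity).map (keyBit (word o es)) = signature o.key (fam t (word o es)) :=
    map_keyBit_triples ho.key codes_identity _
  have hmap : ∀ {c k : ℕ} {u ψ : t.El ≃ t.El}, Codes c u → Codes k ψ →
      (triples o.key k).map (keyBit (rename (word o es) (shifts c))) =
        signature o.key fun l x => fam t (word o es) l (u (ψ x)) := by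
    intro c k u ψ hc hk
    rw [map_keyBit_triples ho.key hk]
    simp only [fam_rename hc]
  rw [hid]
  constructor
  · rintro h φ hφ ⟨i, hi⟩
    obtain ⟨c, hc, u, hcu, hu, hD⟩ : ∃ c, shifts c ∈ addMaps es [shifts identity] ∧
        ∃ u : t.El ≃ t.El, Codes c u ∧ Heapish u ∧ ∀ x, pred o.D x = fam t (word o es) i (u x) := by
      by_cases hi15 : i.val < es.length
      · have hb := he _ (List.getElem_mem hi15)
        have hf : fam t (word o es) i = pred es[i.val].ent.mask := fam_word hl he hi15 i.2
        rw [hf] at hi ⊢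
        obtain ⟨c, hc, hu⟩ := hb.exists_us ⟨φ, hφ, hi⟩
        exact ⟨c, mem_addMaps.2 (Or.inr ⟨_, List.getElem_mem hi15, c, hc, rfl⟩), hu⟩
      · obtain rfl : i = 15 := Fin.ext (by change i.val = 15; omega)
        exact ⟨identity, mem_addMaps.2 (Or.inl List.mem_cons_self), Equiv.refl _, codes_identity,
          Heapish.id, fun x => by rw [fam_word_last ho hl]; rfl⟩
    obtain ⟨k, hk, hkφ⟩ := exists_mem_transporters ho ho (φ := φ.trans u.symm) (hu.symm.comp hφ)
      (fun x => by rw [hi, hD, Equiv.trans_apply, Equiv.apply_symm_apply])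
    have := h _ hc k hk
    rw [hmap hcu hkφ] at this
    simpa using this
  · intro h u hu k hk
    obtain ⟨ψ, hkψ, hψ, hψD⟩ := of_mem_transporters hk
    obtain ⟨c, u, rfl, hcu, hu, i, hi⟩ : ∃ (c : ℕ) (u' : t.El ≃ t.El), u = shifts c ∧ Codes c u' ∧
        Heapish u' ∧ ∃ i, ∀ x, pred o.D x = fam t (word o es) i (u' x) := by
      rcases mem_addMaps.1 hu with hu | ⟨e, hee, c, hc, rfl⟩
      · exact ⟨identity, Equiv.refl _, List.mem_singleton.1 hu, codes_identity, Heapish.id, 15,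
          fun x => by rw [fam_word_last ho hl]; rfl⟩
      · obtain ⟨u', h1, h2, h3⟩ := (he e hee).us c hc
        obtain ⟨i, hi, rfl⟩ := List.getElem_of_mem hee
        exact ⟨c, u', rfl, h1, h2, ⟨i, by omega⟩, fun x => by rw [h3, fam_word hl he hi]⟩
    rw [hmap hcu hkψ]
    exact h (ψ.trans u) (hu.comp hψ) ⟨i, fun x => by rw [hψD, hi]; rfl⟩

theorem count_inter {e : Ent} (he : IsBlock t o later e) (m : ℕ) :
    e.els.countP (fun x => m.testBit x) = count fun x : t.El => pred e.mask x && pred m x := by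
  rw [he.mask]
  exact (count_pred_maskOf t he.nodup he.lt fun x => m.testBit x).symm

/-- `P` encodes a design without shortcuts to difference cubes, with first block the difference set
of `o`, further blocks in the given orbits and least possible signature. -/
structure IsRep (t : Table) (o : Orbit) (later : List Orbit) (P : ℕ) : Prop where
  design : IsDesign (fam t P)
  rigid : Rigid (fam t P) (pred o.D)
  base : fam t P 15 = pred o.D
  inOrbit : ∀ i, ∃ o' ∈ o :: later, InOrbit t o' (fam t P i)
  canonical : ∀ φ : t.El ≃ t.El, Heapish φ → (∃ i, ∀ x, pred o.D x = fam t P i (φ x)) →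
    ¬ signature o.key (fun l x => fam t P l (φ x)) < signature o.key (fam t P)

theorem Orbit.Ok.inOrbit_self : InOrbit t o (pred o.D) := ⟨Equiv.refl _, Heapish.id, fun _ => rfl⟩

theorem OrbitsOk.isDiffSet (h : OrbitsOk t os) (ho : o ∈ os) (hne : o.trans ≠ []) :
    IsDiffSet (pred o.D : t.El → Bool) := by
  obtain ⟨e, he⟩ : ∃ e, e ∈ entries t.code o false := by
    obtain ⟨p, hp⟩ := List.exists_mem_of_ne_nil _ hne
    simp only [entries, kflat_eq, kmap_eq, List.mem_flatMap, List.mem_map]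
    exact ⟨_, p, hp, 0, mem_pts.2 (by norm_num), rfl⟩
  obtain ⟨u, hu, hD⟩ := (isEntry_of_mem (h.ok o ho) he).inOrbit
  exact (funext hD : (pred o.D : t.El → Bool) = _) ▸ (h.isDiffSet_entry ho he).comp u hu

theorem count_two_points {p : t.El → Bool} {x y : t.El} (hxy : x ≠ y)
    (h : ∀ z, p z = true ↔ z = x ∨ z = y) : count p = 2 := by
  classical
  rw [count, show (Finset.univ.filter fun z => p z = true) = {x, y} by ext z; simp [h],
    Finset.card_pair hxy]

theorem land_eq_iff (ho : o.Ok t) (m : ℕ) (x y : t.El) :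
    Nat.land m o.D = bit (val x) ||| bit (val y) ↔
      ∀ z : t.El, (pred m z && pred o.D z) = true ↔ z = x ∨ z = y := by
  change m &&& o.D = _ ↔ _
  constructor
  · intro h z
    rw [pred, pred, ← Nat.testBit_and, h, Nat.testBit_or, testBit_bit, testBit_bit, Bool.or_eq_true,
      decide_eq_true_iff, decide_eq_true_iff, val_inj, val_inj]
    tauto
  · intro h
    refine Nat.eq_of_testBit_eq fun j => ?_
    rw [Nat.testBit_and, Nat.testBit_or, testBit_bit, testBit_bit, Bool.eq_iff_iff, Bool.or_eq_true,
      decide_eq_true_iff, decide_eq_true_iff]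
    by_cases hj : j < 16
    · obtain ⟨z, rfl⟩ : ∃ z : t.El, val z = j := ⟨ofLt hj, val_ofLt _⟩
      rw [val_inj, val_inj]
      exact (h z).trans (by tauto)
    · have h1 := val_lt x
      have h2 := val_lt y
      rw [ho.testBit, decide_eq_false fun hD => hj (ho.lt j hD), Bool.and_false]
      simp only [Bool.false_eq_true, false_iff]
      omega

theorem OrbitsOk.isRep (h : OrbitsOk t os) (hs : o :: later <:+ os)
    (hD : IsDiffSet (pred o.D : t.El → Bool)) {P : ℕ} (hP : P ∈ reps t.code o later) :
    IsRep t o later P := by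
  have ho : o.Ok t := h.ok o (hs.subset List.mem_cons_self)
  obtain ⟨es, hes, hpw, hP, hr, hc⟩ := (mem_reps ho).1 hP
  obtain ⟨hlen, hes⟩ := List.forall₂_iff_get.1 hes
  have hl : es.length = 15 := hlen.symm.trans ho.pairs_length
  have hmem : ∀ e ∈ es, e ∈ blocks t o later := fun e he => by
    obtain ⟨i, hi, rfl⟩ := List.getElem_of_mem he
    exact (hes i (hlen ▸ hi) hi).1
  have hb : ∀ e ∈ es, IsBlock t o later e.ent := fun e he => h.isBlock hs (hmem e he)
  change P = word o es at hP
  subst hP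
  have hf : ∀ (i : ℕ) (hi : i < es.length), fam t (word o es) ⟨i, by omega⟩ = pred es[i].ent.mask :=
    fun i hi => fam_word hl hb hi _
  have hf15 : fam t (word o es) 15 = pred o.D := fam_word_last ho hl
  have hcases : ∀ i : Fin 16, i.val < es.length ∨ i = 15 := fun i => by
    rcases lt_or_ge i.val es.length with hi | hi
    · exact Or.inl hi
    · exact Or.inr (Fin.ext (by change i.val = 15; omega))
  have hinter : ∀ i j : Fin 16, i < j →
      count (fun x => fam t (word o es) i x && fam t (word o es) j x) = 2 := by
    intro i j hij
    have hi : i.val < es.length := by omega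
    have hi' : fam t (word o es) i = pred es[i.val].ent.mask := hf i hi
    rcases hcases j with hj | rfl
    · have hj' : fam t (word o es) j = pred es[j.val].ent.mask := hf j hj
      have := List.pairwise_iff_getElem.1 hpw i j hi hj hij
      have hB := hb _ (List.getElem_mem hi)
      rw [testBit_neighbours numbered_blocks hB.lt (hmem _ (List.getElem_mem hj)),
        decide_eq_true_iff, count_inter hB] at this
      rw [hi', hj', this]
    · obtain ⟨-, hp⟩ := hes i (hlen ▸ hi) hi
      obtain ⟨a, ha, b, hb, hab, hp'⟩ := ho.pairs _ (List.getElem_mem (hlen ▸ hi : i.val < o.pairs.length))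
      obtain ⟨x, rfl⟩ := ho.exists_el ha
      obtain ⟨y, rfl⟩ := ho.exists_el hb
      rw [hi', hf15]
      exact count_two_points (fun e => hab (by rw [e])) ((land_eq_iff ho _ x y).1 (hp.trans hp'))
  refine ⟨⟨fun i => ?_, fun i j hij => ?_⟩, hr, hf15, fun i => ?_,
    (forall_canonical_iff ho hl hb).1 hc⟩
  · rcases hcases i with hi | rfl
    · exact (hf i hi).symm ▸ (hb _ (List.getElem_mem hi)).ds
    · exact hf15.symm ▸ hD
  · rcases lt_or_gt_of_ne hij with hlt | hlt
    · exact hinter i j hlt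
    · rw [← hinter j i hlt]
      simp only [Bool.and_comm]
  · rcases hcases i with hi | rfl
    · exact (hf i hi).symm ▸ (hb _ (List.getElem_mem hi)).inOrbit
    · exact ⟨o, List.mem_cons_self, hf15.symm ▸ Orbit.Ok.inOrbit_self⟩

end GroupCubes

namespace GroupCubes

open Table

variable {t : Table} {os later : List Orbit} {o : Orbit}

theorem exists_ne_of_count_eq_two {α : Type} [Fintype α] {p : α → Bool} (h : count p = 2) (a : α) :
    ∃ b, p b = true ∧ b ≠ a := by
  have hc : 1 < (Finset.univ.filter fun x => p x = true).card := by
    rw [← count, h]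
    norm_num
  obtain ⟨b, hb, hba⟩ := Finset.exists_mem_ne hc a
  exact ⟨b, (Finset.mem_filter.1 hb).2, hba⟩

theorem iff_of_count_eq_two {α : Type} [Fintype α] {p : α → Bool} (h : count p = 2) {x y : α}
    (hxy : x ≠ y) (hx : p x = true) (hy : p y = true) (z : α) : p z = true ↔ z = x ∨ z = y := by
  classical
  have hs : ({x, y} : Finset α) = Finset.univ.filter fun z => p z = true := by
    refine Finset.eq_of_subset_of_card_le (fun z hz => ?_) ?_
    · rcases Finset.mem_insert.1 hz with rfl | hz
      · simpa using hx
      · simpa [Finset.mem_singleton.1 hz] using hy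
    · rw [← count, h, Finset.card_pair hxy]
  have := Finset.ext_iff.1 hs z
  simpa using this.symm

theorem OrbitsOk.exists_rep_of_minimal (h : OrbitsOk t os) (hs : o :: later <:+ os)
    {g : Fin 16 → t.El → Bool} (hg : IsDesign g) (hr : Rigid g (pred o.D)) {i₀ : Fin 16}
    (h₀ : g i₀ = pred o.D) (horb : ∀ i, ∃ o' ∈ o :: later, InOrbit t o' (g i))
    (hmin : ∀ φ : t.El ≃ t.El, Heapish φ → (∃ i, ∀ x, pred o.D x = g i (φ x)) →
      ¬ signature o.key (fun l x => g l (φ x)) < signature o.key g) :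
    ∃ P ∈ reps t.code o later, ∃ σ : Equiv.Perm (Fin 16), fam t P = fun i => g (σ i) := by
  have ho : o.Ok t := h.ok o (hs.subset List.mem_cons_self)
  have hpair : ∀ j : Fin 15, ∃ i ≠ i₀, ∃ e ∈ blocks t o later, pred e.ent.mask = g i ∧
      Nat.land e.ent.mask o.D = o.pairs[j.val]'(by have := ho.pairs_length; omega) := by
    intro j
    obtain ⟨a, ha, b, hb, hab, hp⟩ := ho.pairs _
      (List.getElem_mem (by have := ho.pairs_length; omega : j.val < o.pairs.length))
    have hbit := ho.testBit
    obtain ⟨x, rfl⟩ := ho.exists_el ha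
    obtain ⟨y, rfl⟩ := ho.exists_el hb
    have hxy : x ≠ y := fun e => hab (by rw [e])
    obtain ⟨i, hi, hi₀⟩ := exists_ne_of_count_eq_two ((hg.cover t.card_el).2 x y hxy) i₀
    rw [Bool.and_eq_true] at hi
    obtain ⟨o', ho', e', he', hm⟩ := h.exists_entry_of_inOrbit hs (hg.ds i) (horb i)
    obtain ⟨e, he, hem⟩ : ∃ e ∈ blocks t o later, e.ent.mask = e'.mask := by
      rcases List.mem_cons.1 ho' with rfl | ho'
      · obtain ⟨e'', he'', hm'⟩ := exists_entry true he'
        obtain ⟨e, he, rfl⟩ := exists_mem_blocks (later := later) (Or.inl he'')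
        exact ⟨e, he, hm'⟩
      · obtain ⟨e, he, rfl⟩ := exists_mem_blocks (o := o) (Or.inr ⟨o', ho', he'⟩)
        exact ⟨e, he, rfl⟩
    have hei : pred e.ent.mask = g i := by rw [hem, hm]
    refine ⟨i, hi₀, e, he, hei, ?_⟩
    rw [hp]
    refine (land_eq_iff ho _ x y).2 ?_
    rw [hei, ← h₀]
    have hx : g i₀ x = true := by rw [h₀, pred, hbit, decide_eq_true ha]
    have hy : g i₀ y = true := by rw [h₀, pred, hbit, decide_eq_true hb]
    exact iff_of_count_eq_two (hg.inter i i₀ hi₀) hxy (by rw [hi.1, hx]; rfl) (by rw [hi.2, hy]; rfl)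
  choose s hs₀ b hbm hbs hbp using hpair
  have hsinj : Function.Injective s := fun j j' e => by
    have hm : Nat.land (b j).ent.mask o.D = Nat.land (b j').ent.mask o.D := by
      refine (Nat.eq_of_testBit_eq fun n => ?_ :
        (b j).ent.mask &&& o.D = (b j').ent.mask &&& o.D)
      rw [Nat.testBit_and, Nat.testBit_and]
      by_cases hn : n ∈ o.Dl
      · obtain ⟨x, rfl⟩ := ho.exists_el hn
        have := congrFun ((hbs j).trans ((congrArg g e).trans (hbs j').symm)) x
        rw [pred, pred] at this
        rw [this]
      · rw [ho.testBit, decide_eq_false hn, Bool.and_false, Bool.and_false]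
    rw [hbp, hbp] at hm
    exact Fin.ext ((ho.pairs_nodup.getElem_inj_iff).1 hm)
  let τ : Fin 16 → Fin 16 := fun i => if hi : i.val < 15 then s ⟨i, hi⟩ else i₀
  have hτ : ∀ (i : Fin 16) (hi : i.val < 15), τ i = s ⟨i, hi⟩ := fun i hi => dif_pos hi
  have hτ15 : ∀ i : Fin 16, ¬ i.val < 15 → τ i = i₀ := fun i hi => dif_neg hi
  have hτinj : Function.Injective τ := by
    intro i j e
    by_cases hi : i.val < 15 <;> by_cases hj : j.val < 15
    · rw [hτ i hi, hτ j hj] at e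
      exact Fin.ext (congrArg Fin.val (hsinj e) :)
    · rw [hτ i hi, hτ15 j hj] at e
      exact absurd e (hs₀ _)
    · rw [hτ15 i hi, hτ j hj] at e
      exact absurd e.symm (hs₀ _)
    · exact Fin.ext (by omega)
  let σ : Equiv.Perm (Fin 16) := Equiv.ofBijective τ (Finite.injective_iff_bijective.1 hτinj)
  have hl : (List.ofFn b).length = 15 := List.length_ofFn
  have hmem : ∀ e ∈ List.ofFn b, e ∈ blocks t o later := fun e he => by
    obtain ⟨j, rfl⟩ := (List.mem_ofFn' _ _).1 he
    exact hbm j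
  have hB : ∀ e ∈ List.ofFn b, IsBlock t o later e.ent := fun e he => h.isBlock hs (hmem e he)
  have hfam : fam t (word o (List.ofFn b)) = fun i => g (σ i) := by
    funext i
    change _ = g (τ i)
    by_cases hi : i.val < 15
    · have := fam_word hl hB (i := i.val) (by omega) i.2
      rw [hτ i hi, ← hbs]
      simpa only [List.getElem_ofFn] using this
    · obtain rfl : i = 15 := Fin.ext (by change i.val = 15; omega)
      rw [hτ15 _ hi, h₀, fam_word_last ho hl]
  refine ⟨word o (List.ofFn b), (mem_reps ho).2 ⟨List.ofFn b, ?_, ?_, rfl, ?_, ?_⟩, σ, hfam⟩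
  · refine List.forall₂_iff_get.2 ⟨by rw [hl, ho.pairs_length], fun i h₁ h₂ => ?_⟩
    simp only [List.get_eq_getElem, List.getElem_ofFn]
    exact ⟨hbm _, hbp _⟩
  · refine List.pairwise_iff_getElem.2 fun i j hi hj hij => ?_
    have hBi := hB _ (List.getElem_mem hi)
    rw [testBit_neighbours numbered_blocks hBi.lt (hmem _ (List.getElem_mem hj)), decide_eq_true_iff,
      count_inter hBi]
    simp only [List.getElem_ofFn, hbs]
    exact hg.inter _ _ fun e => hij.ne (congrArg Fin.val (hsinj e) :)
  · rw [hfam]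
    refine hr.imp ?_ ?_ <;>
    · rintro ⟨a, ha⟩
      exact ⟨a, fun i => ha (σ i)⟩
  · refine (forall_canonical_iff ho hl hB).2 fun φ hφ ⟨i, hi⟩ => ?_
    rw [hfam] at hi ⊢
    rw [signature_comp_perm, signature_comp_perm _ fun l x => g l (φ x)]
    exact hmin φ hφ ⟨σ i, hi⟩

/-- Every design that is not a shortcut to a difference cube has a representative. -/
theorem OrbitsOk.exists_rep (h : OrbitsOk t os) (hs : o :: later <:+ os)
    (hD : IsDiffSet (pred o.D : t.El → Bool)) {f : Fin 16 → t.El → Bool} (hf : IsDesign f)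
    (hd : ¬ IsDifferenceCube 16 6 2 (cubeOf t.enum f))
    (horb : ∀ i, ∃ o' ∈ o :: later, InOrbit t o' (f i)) (hex : ∃ i, InOrbit t o (f i)) :
    ∃ P ∈ reps t.code o later, Paratopic 16 3 (cubeOf t.enum f) (cubeOf t.enum (fam t P)) := by
  let S := {φ : t.El ≃ t.El // Heapish φ ∧ ∃ i, ∀ x, pred o.D x = f i (φ x)}
  have : Nonempty S := by
    obtain ⟨i, φ, hφ, hi⟩ := hex
    exact ⟨⟨φ, hφ, i, hi⟩⟩
  have : Finite S := Subtype.finite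
  obtain ⟨⟨φ, hφ, i₀, hi₀⟩, hmin⟩ :=
    Finite.exists_min fun φ : S => signature o.key fun l x => f l (φ.1 x)
  have hg : IsDesign fun l x => f l (φ x) := hf.comp (Equiv.refl _) φ hφ
  have hp : Paratopic 16 3 (cubeOf t.enum f) (cubeOf t.enum fun l x => f l (φ x)) :=
    paratopic_cubeOf t.enum t.enum φ hφ (Equiv.refl _) fun _ _ => rfl
  have horb' : ∀ i, ∃ o' ∈ o :: later, InOrbit t o' fun x => f i (φ x) := fun i => by
    obtain ⟨o', ho', u, hu, hb⟩ := horb i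
    exact ⟨o', ho', u.trans φ.symm, hφ.symm.comp hu, fun x =>
      (hb x).trans (congrArg (f i) (φ.apply_symm_apply _).symm)⟩
  obtain ⟨P, hP, σ, hfam⟩ := h.exists_rep_of_minimal hs hg
    (hg.rigid t.card_el t.enum (fun hc => hd (IsDifferenceCube.of_paratopic hp hc)) hD)
    (i₀ := i₀) (funext fun x => (hi₀ x).symm) horb'
    fun ψ hψ ⟨i, hi⟩ => not_lt.2 (hmin ⟨ψ.trans φ, hφ.comp hψ, i, hi⟩)
  exact ⟨P, hP, paratopic_cubeOf t.enum t.enum φ hφ σ fun i p => by rw [hfam]⟩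

end GroupCubes

namespace GroupCubes

open Table

variable {t : Table} {os later : List Orbit} {o : Orbit}

theorem keyNum_congr (key : List S3) {P Q : ℕ} (h : key.map (keyBit P) = key.map (keyBit Q)) :
    keyNum key P = keyNum key Q := by
  induction key with
  | nil => rfl
  | cons s l ih =>
    rw [List.map_cons, List.map_cons, List.cons.injEq] at h
    have step : ∀ R, keyNum (s :: l) R = 2 * keyNum l R + bif keyBit R s then 1 else 0 := fun R => by
      rw [← rec_bool]
      rfl
    rw [step, step, ih h.2, h.1]

theorem IsRep.exists_heapish {o' : Orbit} {later' : List Orbit} {P Q : ℕ} (hP : IsRep t o later P)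
    (hQ : IsRep t o' later' Q)
    (hp : Paratopic 16 3 (cubeOf t.enum (fam t P)) (cubeOf t.enum (fam t Q))) :
    ∃ (h : t.El ≃ t.El) (σ : Equiv.Perm (Fin 16)),
      Heapish h ∧ ∀ i p, fam t Q i p = fam t P (σ i) (h p) :=
  exists_heapish_of_paratopic_cubeOf t.card_el t.enum t.enum hP.design hQ.design (i₂ := 15)
    (hQ.base ▸ hQ.rigid) hp

theorem IsRep.not_signature_lt {P Q : ℕ} (hP : IsRep t o later P) (hQ : IsRep t o later Q)
    (hp : Paratopic 16 3 (cubeOf t.enum (fam t P)) (cubeOf t.enum (fam t Q))) :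
    ¬ signature o.key (fam t Q) < signature o.key (fam t P) := by
  obtain ⟨h, σ, hh, hf⟩ := hP.exists_heapish hQ hp
  have := hP.canonical h hh ⟨σ 15, fun x => by rw [← hf, hQ.base]⟩
  rwa [← signature_comp_perm _ _ σ, ← funext fun i => funext (hf i)] at this

/-- Representatives of the same run with different keys are not equivalent. -/
theorem IsRep.keyNum_eq {P Q : ℕ} (ho : o.Ok t) (hP : IsRep t o later P) (hQ : IsRep t o later Q)
    (hp : Paratopic 16 3 (cubeOf t.enum (fam t P)) (cubeOf t.enum (fam t Q))) :
    keyNum (triples o.key identity) P = keyNum (triples o.key identity) Q := by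
  refine keyNum_congr _ ?_
  rw [map_keyBit_triples ho.key codes_identity, map_keyBit_triples ho.key codes_identity]
  exact le_antisymm (not_lt.1 (hP.not_signature_lt hQ hp))
    (not_lt.1 (hQ.not_signature_lt hP (Paratopic.symm hp)))

/-- Representatives of different runs are not equivalent. -/
theorem OrbitsOk.not_paratopic (h : OrbitsOk t os) (hs : o :: later <:+ os) {o' : Orbit}
    {later' : List Orbit} (hs' : o' :: later' <:+ later) {P Q : ℕ} (hP : IsRep t o later P)
    (hQ : IsRep t o' later' Q) :
    ¬ Paratopic 16 3 (cubeOf t.enum (fam t P)) (cubeOf t.enum (fam t Q)) := by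
  intro hp
  obtain ⟨u, σ, hu, hf⟩ := hP.exists_heapish hQ hp
  obtain ⟨a, ha, hQa⟩ := hQ.inOrbit (σ.symm 15)
  refine h.not_inOrbit hs ⟨u.symm, hu.symm, fun x => ?_⟩ (hs'.subset ha) hQa
  rw [hf, σ.apply_symm_apply, hP.base, u.apply_symm_apply]

/-- numbers of solutions of some equations in a group -/
def profile (T : ℕ) : List ℕ :=
  [pts.countP fun x => Nat.beq (tmul T x x) 0,
    pts.countP fun x => Nat.beq (tmul T (tmul T x x) (tmul T x x)) 0,
    (pts.map fun x => pts.countP fun y => Nat.beq (tmul T x y) (tmul T y x)).sum,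
    (pts.map fun x => pts.countP fun y => Nat.beq (tmul T x x) (tmul T y y)).sum]

theorem sum_pts (t : Table) (f : ℕ → ℕ) : (pts.map f).sum = ∑ x : t.El, f (val x) := by
  rw [← Equiv.sum_comp t.enum]
  simp only [val_enum]
  rw [← Fin.sum_ofFn fun x : Fin 16 => f x]
  rfl

theorem profile_eq {t t' : Table} (e : t.El ≃* t'.El) : profile t.code = profile t'.code := by
  have hd : ∀ {t : Table} {x y : t.El}, decide (x = y) = Nat.beq (val x) (val y) := fun {t x y} => by
    rw [Bool.eq_iff_iff, beq_iff, decide_eq_true_iff, val_inj]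
  have key : ∀ t : Table, profile t.code = [count fun x : t.El => decide (x * x = 1),
      count fun x : t.El => decide (x * x * (x * x) = 1),
      ∑ x : t.El, count fun y : t.El => decide (x * y = y * x),
      ∑ x : t.El, count fun y : t.El => decide (x * x = y * y)] := fun t => by
    simp only [hd, val_mul, val_one, profile, sum_pts t, ← count_eq t]
  have h2 : ∀ p : ∀ t : Table, t.El → t.El → Bool, (∀ x y, p t x y = p t' (e x) (e y)) →
      ∑ x, count (p t x) = ∑ x, count (p t' x) := fun p h =>
    Fintype.sum_equiv e.toEquiv _ _ fun x => count_congr e.toEquiv (h x)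
  rw [key, key]
  refine congrArg₂ List.cons ?_ (congrArg₂ List.cons ?_ (congrArg₂ List.cons ?_
    (congrArg₂ List.cons ?_ rfl)))
  · exact count_congr e.toEquiv fun x => by
      rw [decide_eq_decide, MulEquiv.toEquiv_eq_coe, MulEquiv.coe_toEquiv, ← map_mul,
        EmbeddingLike.map_eq_one_iff]
  · exact count_congr e.toEquiv fun x => by
      rw [decide_eq_decide, MulEquiv.toEquiv_eq_coe, MulEquiv.coe_toEquiv, ← map_mul, ← map_mul,
        EmbeddingLike.map_eq_one_iff]
  · exact h2 (fun t x y => decide (x * y = y * x)) fun x y => by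
      rw [decide_eq_decide, ← map_mul, ← map_mul, e.apply_eq_iff_eq]
  · exact h2 (fun t x y => decide (x * x = y * y)) fun x y => by
      rw [decide_eq_decide, ← map_mul, ← map_mul, e.apply_eq_iff_eq]

/-- the orbits together with those that follow in the list -/
def runs (os : List Orbit) : List (Orbit × List Orbit) :=
  match os with
  | [] => []
  | o :: os => (o, os) :: runs os

theorem mem_runs {os : List Orbit} {r : Orbit × List Orbit} : r ∈ runs os ↔ r.1 :: r.2 <:+ os := by
  induction os with
  | nil => simp [runs]
  | cons o os ih => rw [runs, List.mem_cons, List.suffix_cons_iff, ih, Prod.ext_iff, List.cons.injEq]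

theorem pairwise_runs (os : List Orbit) : (runs os).Pairwise fun r r' => r'.1 :: r'.2 <:+ r.2 := by
  induction os with
  | nil => exact List.Pairwise.nil
  | cons o os ih => exact List.Pairwise.cons (fun r hr => mem_runs.1 hr) ih

/-- A group of order 16, its difference sets, and the numbers of designs found. -/
structure Family where
  table : Table
  orbits : List Orbit
  ok : OrbitsOk table orbits
  trans : ∀ o ∈ orbits, o.trans ≠ []
  numbers : List ℕ
  check : List.Forall₂ (fun r n => checkRun table.code r.1 r.2 n = true) (runs orbits) numbers

theorem checkRun_iff {T : ℕ} {n : ℕ} : checkRun T o later n = true ↔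
    (reps T o later).length = n ∧
      ((reps T o later).map (keyNum (triples o.key identity))).Nodup := by
  rw [checkRun, forceList_eq, rec_bool, Bool.cond_false_right, Bool.and_eq_true, beq_iff, kmap_eq,
    klen_eq, distinct_iff, List.length_map]

namespace Family

variable (F F' : Family)

def runCubes (r : Orbit × List Orbit) : List ((Fin 3 → Fin 16) → ℤ) :=
  (reps F.table.code r.1 r.2).map fun P => cubeOf F.table.enum (fam F.table P)

def groupCubes : List ((Fin 3 → Fin 16) → ℤ) := (runs F.orbits).flatMap F.runCubes

def diffCubes : List ((Fin 3 → Fin 16) → ℤ) :=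
  F.orbits.map fun o => diffCube F.table.enum (pred o.D)

theorem length_groupCubes : F.groupCubes.length = F.numbers.sum := by
  have key : ∀ l n, List.Forall₂ (fun r n => checkRun F.table.code r.1 r.2 n = true) l n →
      (l.flatMap F.runCubes).length = n.sum := fun l n h => by
    induction h with
    | nil => rfl
    | cons h _ ih =>
      rw [List.flatMap_cons, List.length_append, ih, List.sum_cons, runCubes, List.length_map,
        (checkRun_iff.1 h).1]
  exact key _ _ F.check

variable {F F'}

theorem isDiffSet {o : Orbit} (ho : o ∈ F.orbits) : IsDiffSet (pred o.D : F.table.El → Bool) :=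
  F.ok.isDiffSet ho (F.trans o ho)

theorem exists_isRep {r : Orbit × List Orbit} (hr : r ∈ runs F.orbits) {C : (Fin 3 → Fin 16) → ℤ}
    (hC : C ∈ F.runCubes r) :
    ∃ P, IsRep F.table r.1 r.2 P ∧ C = cubeOf F.table.enum (fam F.table P) := by
  obtain ⟨P, hP, rfl⟩ := List.mem_map.1 hC
  have hs := mem_runs.1 hr
  exact ⟨P, F.ok.isRep hs (isDiffSet (hs.subset List.mem_cons_self)) hP, rfl⟩

theorem exists_isRep_of_mem {C : (Fin 3 → Fin 16) → ℤ} (hC : C ∈ F.groupCubes) :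
    ∃ o later P, IsRep F.table o later P ∧ C = cubeOf F.table.enum (fam F.table P) := by
  obtain ⟨r, hr, hC⟩ := List.mem_flatMap.1 hC
  exact ⟨_, _, exists_isRep hr hC⟩

theorem pairwise_groupCubes : F.groupCubes.Pairwise fun C C' => ¬ Paratopic 16 3 C C' := by
  refine List.pairwise_flatMap.2 ⟨fun r hr => ?_, (pairwise_runs _).imp_of_mem
    fun {r r'} hr hr' hrr C hC C' hC' => ?_⟩
  · have hs := mem_runs.1 hr
    have ho := hs.subset List.mem_cons_self
    obtain ⟨n, hn⟩ : ∃ n, checkRun F.table.code r.1 r.2 n = true := by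
      obtain ⟨i, hi, rfl⟩ := List.getElem_of_mem hr
      exact ⟨_, (List.forall₂_iff_get.1 F.check).2 i hi
        ((List.forall₂_iff_get.1 F.check).1 ▸ hi)⟩
    refine List.pairwise_map.2 ((List.pairwise_map.1 (checkRun_iff.1 hn).2).imp_of_mem
      fun hP hQ hne hp => hne ?_)
    exact (F.ok.isRep hs (isDiffSet ho) hP).keyNum_eq (F.ok.ok _ ho)
      (F.ok.isRep hs (isDiffSet ho) hQ) hp
  · obtain ⟨P, hP, rfl⟩ := exists_isRep hr hC
    obtain ⟨Q, hQ, rfl⟩ := exists_isRep hr' hC'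
    exact F.ok.not_paratopic (mem_runs.1 hr) hrr hP hQ

theorem profile_eq_of_groupCubes {C C' : (Fin 3 → Fin 16) → ℤ} (hC : C ∈ F.groupCubes)
    (hC' : C' ∈ F'.groupCubes) (h : Paratopic 16 3 C C') :
    profile F.table.code = profile F'.table.code := by
  obtain ⟨o, later, P, hP, rfl⟩ := exists_isRep_of_mem hC
  obtain ⟨o', later', Q, hQ, rfl⟩ := exists_isRep_of_mem hC'
  obtain ⟨u, σ, hu, -⟩ := exists_heapish_of_paratopic_cubeOf F.table.card_el F.table.enum
    F'.table.enum hP.design hQ.design (i₂ := 15) (hQ.base ▸ hQ.rigid) h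
  exact profile_eq hu.symm.mulEquiv.some

theorem exists_mem_groupCubes {f : Fin 16 → F.table.El → Bool} (hf : IsDesign f)
    (hd : ¬ IsDifferenceCube 16 6 2 (cubeOf F.table.enum f)) :
    ∃ C ∈ F.groupCubes, Paratopic 16 3 (cubeOf F.table.enum f) C := by
  have horb : ∀ i, ∃ o ∈ F.orbits, InOrbit F.table o (f i) := fun i => by
    obtain ⟨o, ho, e, he, hb⟩ := F.ok.exists_inOrbit (hf.ds i)
    exact ⟨o, ho, hb ▸ (isEntry_of_mem (F.ok.ok o ho) he).inOrbit⟩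
  have key : ∀ l : List Orbit, l <:+ F.orbits → (∀ i, ∃ o ∈ l, InOrbit F.table o (f i)) →
      ∃ o later, o :: later <:+ F.orbits ∧ (∀ i, ∃ o' ∈ o :: later, InOrbit F.table o' (f i)) ∧
        ∃ i, InOrbit F.table o (f i) := fun l => by
    induction l with
    | nil => exact fun _ h => absurd (h 0) (by simp)
    | cons o l ih =>
      intro hs h
      by_cases hex : ∃ i, InOrbit F.table o (f i)
      · exact ⟨o, l, hs, h, hex⟩
      · refine ih ((List.suffix_cons o l).trans hs) fun i => ?_
        obtain ⟨o', ho', hi⟩ := h i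
        rcases List.mem_cons.1 ho' with rfl | ho'
        · exact absurd ⟨i, hi⟩ hex
        · exact ⟨o', ho', hi⟩
  obtain ⟨o, later, hs, h, hex⟩ := key _ List.suffix_rfl horb
  obtain ⟨P, hP, hp⟩ := F.ok.exists_rep hs (isDiffSet (hs.subset List.mem_cons_self)) hf hd h hex
  exact ⟨_, List.mem_flatMap.2 ⟨(o, later), mem_runs.2 hs, List.mem_map.2 ⟨P, hP, rfl⟩⟩, hp⟩

theorem pairwise_diffCubes : F.diffCubes.Pairwise fun C C' => ¬ Paratopic 16 3 C C' := by
  refine List.pairwise_map.2 (F.ok.disjoint.imp_of_mem fun {o o'} ho ho' h hp => ?_)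
  obtain ⟨u, hu, hb⟩ := exists_heapish_of_paratopic_diffCube _ _ (isDiffSet ho) hp
  exact not_inOrbit_both (F.ok.ok o ho) (F.ok.ok o' ho') h
    ⟨u.symm, hu.symm, fun x => by rw [hb, u.apply_symm_apply]⟩ Orbit.Ok.inOrbit_self

theorem profile_eq_of_diffCubes {C C' : (Fin 3 → Fin 16) → ℤ} (hC : C ∈ F.diffCubes)
    (hC' : C' ∈ F'.diffCubes) (h : Paratopic 16 3 C C') :
    profile F.table.code = profile F'.table.code := by
  obtain ⟨o, ho, rfl⟩ := List.mem_map.1 hC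
  obtain ⟨o', ho', rfl⟩ := List.mem_map.1 hC'
  obtain ⟨u, hu, -⟩ := exists_heapish_of_paratopic_diffCube _ _ (isDiffSet ho) h
  exact profile_eq hu.symm.mulEquiv.some

theorem exists_mem_diffCubes {b : F.table.El → Bool} (hb : IsDiffSet b) :
    ∃ C ∈ F.diffCubes, Paratopic 16 3 (diffCube F.table.enum b) C := by
  obtain ⟨o, ho, e, he, rfl⟩ := F.ok.exists_inOrbit hb
  obtain ⟨u, hu, h⟩ := (isEntry_of_mem (F.ok.ok o ho) he).inOrbit
  exact ⟨_, List.mem_map.2 ⟨o, ho, rfl⟩, paratopic_diffCube _ _ u hu h⟩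

end Family

end GroupCubes

namespace GroupCubes

/-- Lists of representatives, one for each class, give families indexed by `Fin n`. -/
theorem exists_family_of_list {L : List ((Fin 3 → Fin 16) → ℤ)} {n : ℕ} (hn : L.length = n)
    (hL : L.Pairwise fun C C' => ¬ Paratopic 16 3 C C') :
    ∃ c : Fin n → (Fin 3 → Fin 16) → ℤ, (∀ a, c a ∈ L) ∧ (∀ C ∈ L, ∃ a, c a = C) ∧
      ∀ a b, a ≠ b → ¬ Paratopic 16 3 (c a) (c b) := by
  subst hn
  refine ⟨L.get, L.get_mem, fun C hC => List.mem_iff_get.1 hC, fun a b hab hp => ?_⟩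
  rcases lt_or_gt_of_ne hab with h | h
  · exact List.pairwise_iff_get.1 hL a b h hp
  · exact List.pairwise_iff_get.1 hL b a h (Paratopic.symm hp)

theorem pairwise_flatMap_of_profile {Fs : List Family} (hp : (Fs.map fun F => profile F.table.code).Nodup)
    {cubes : Family → List ((Fin 3 → Fin 16) → ℤ)}
    (h : ∀ F, (cubes F).Pairwise fun C C' => ¬ Paratopic 16 3 C C')
    (h' : ∀ F F', ∀ C ∈ cubes F, ∀ C' ∈ cubes F', Paratopic 16 3 C C' →
      profile F.table.code = profile F'.table.code) :
    (Fs.flatMap cubes).Pairwise fun C C' => ¬ Paratopic 16 3 C C' :=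
  List.pairwise_flatMap.2 ⟨fun F _ => h F, (List.pairwise_map.1 hp).imp
    fun hne C hC C' hC' hp => hne (h' _ _ C hC C' hC' hp)⟩

variable {G : Type} [Group G] [Fintype G]

theorem Family.exists_paratopic_of_isDesign {F : Family} (e : G ≃* F.table.El) (g : Fin 16 ≃ G)
    {f : Fin 16 → G → Bool} (hf : IsDesign f) (hd : ¬ IsDifferenceCube 16 6 2 (cubeOf g f)) :
    ∃ C ∈ F.groupCubes, Paratopic 16 3 (cubeOf g f) C := by
  have he : Heapish e.symm.toEquiv := Or.inl fun x y z => by simp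
  have hp : Paratopic 16 3 (cubeOf g f) (cubeOf F.table.enum fun i x => f i (e.symm x)) :=
    paratopic_cubeOf g F.table.enum e.symm.toEquiv he (Equiv.refl _) fun _ _ => rfl
  obtain ⟨C, hC, h⟩ := exists_mem_groupCubes (F := F) (hf.comp (Equiv.refl _) e.symm.toEquiv he)
    fun h => hd (IsDifferenceCube.of_paratopic hp h)
  exact ⟨C, hC, Paratopic.trans hp h⟩

theorem Family.exists_paratopic_of_isDiffSet {F : Family} (e : G ≃* F.table.El) (g : Fin 16 ≃ G)
    {b : G → Bool} (hb : IsDiffSet b) : ∃ C ∈ F.diffCubes, Paratopic 16 3 (diffCube g b) C := by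
  have he : Heapish e.symm.toEquiv := Or.inl fun x y z => by simp
  obtain ⟨C, hC, h⟩ := exists_mem_diffCubes (F := F) (hb.comp e.symm.toEquiv he)
  exact ⟨C, hC, Paratopic.trans (paratopic_diffCube g F.table.enum e.symm.toEquiv he fun _ => rfl) h⟩

/-- The classification, for a list of families that covers all groups of order 16. -/
theorem classification (Fs : List Family)
    (hG : ∀ (G : Type) [Group G] [Fintype G], Fintype.card G = 16 →
      ∃ F ∈ Fs, Nonempty (G ≃* F.table.El))
    (hp : (Fs.map fun F => profile F.table.code).Nodup)
    (hd : (Fs.map fun F => F.orbits.length).sum = 27)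
    (hg : (Fs.map fun F => F.numbers.sum).sum = 946) :
    ∃ (Cd : Fin 27 → (Fin 3 → Fin 16) → ℤ) (Cg : Fin 946 → (Fin 3 → Fin 16) → ℤ),
      (∀ a, IsCubeOfDesigns 16 6 2 3 (Cd a) ∧ IsDifferenceCube 16 6 2 (Cd a)) ∧
      (∀ a b, a ≠ b → ¬ Paratopic 16 3 (Cd a) (Cd b)) ∧
      (∀ C, IsCubeOfDesigns 16 6 2 3 C → IsDifferenceCube 16 6 2 C →
        ∃ a, Paratopic 16 3 C (Cd a)) ∧
      (∀ b, IsCubeOfDesigns 16 6 2 3 (Cg b) ∧ IsGroupCube 16 6 2 (Cg b) ∧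
        ¬ IsDifferenceCube 16 6 2 (Cg b)) ∧
      (∀ a b, a ≠ b → ¬ Paratopic 16 3 (Cg a) (Cg b)) ∧
      (∀ C, IsCubeOfDesigns 16 6 2 3 C → IsGroupCube 16 6 2 C → ¬ IsDifferenceCube 16 6 2 C →
        ∃ b, Paratopic 16 3 C (Cg b)) := by
  obtain ⟨Cd, hd₁, hd₂, hd₃⟩ := exists_family_of_list (L := Fs.flatMap Family.diffCubes)
    (by simpa [List.length_flatMap, Family.diffCubes] using hd)
    (pairwise_flatMap_of_profile hp (fun F => F.pairwise_diffCubes)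
      fun F F' C hC C' hC' => Family.profile_eq_of_diffCubes hC hC')
  obtain ⟨Cg, hg₁, hg₂, hg₃⟩ := exists_family_of_list (L := Fs.flatMap Family.groupCubes)
    (by simpa only [List.length_flatMap, Family.length_groupCubes] using hg)
    (pairwise_flatMap_of_profile hp (fun F => F.pairwise_groupCubes)
      fun F F' C hC C' hC' => Family.profile_eq_of_groupCubes hC hC')
  refine ⟨Cd, Cg, fun a => ?_, hd₃, fun C _ hC => ?_, fun b => ?_, hg₃, fun C _ hC hn => ?_⟩
  · obtain ⟨F, -, hF⟩ := List.mem_flatMap.1 (hd₁ a)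
    obtain ⟨o, ho, h⟩ := List.mem_map.1 hF
    have hb := Family.isDiffSet ho
    rw [← h]
    exact ⟨(hb.translates F.table.enum).isCubeOfDesigns F.table.card_el _,
      hb.isDifferenceCube F.table.card_el _⟩
  · obtain ⟨G, _, _, g, b, hc, hb, h⟩ := exists_diffSet_of_isDifferenceCube hC
    obtain ⟨F, hF, ⟨e⟩⟩ := hG G hc
    obtain ⟨C', hC', h'⟩ := Family.exists_paratopic_of_isDiffSet e g hb
    obtain ⟨a, rfl⟩ := hd₂ C' (List.mem_flatMap.2 ⟨F, hF, hC'⟩)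
    exact ⟨a, Paratopic.trans h h'⟩
  · obtain ⟨F, -, hF⟩ := List.mem_flatMap.1 (hg₁ b)
    obtain ⟨o, later, P, hP, h⟩ := Family.exists_isRep_of_mem hF
    rw [h]
    exact ⟨hP.design.isCubeOfDesigns F.table.card_el _, hP.design.isGroupCube F.table.card_el _,
      IsDesign.not_isDifferenceCube _ hP.design (i₀ := 15) (hP.base ▸ hP.rigid)⟩
  · obtain ⟨G, _, _, g, f, hc, hf, h⟩ := exists_design_of_isGroupCube hC
    obtain ⟨F, hF, ⟨e⟩⟩ := hG G hc
    obtain ⟨C', hC', h'⟩ := Family.exists_paratopic_of_isDesign e g hf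
      fun hd => hn (IsDifferenceCube.of_paratopic h hd)
    obtain ⟨a, rfl⟩ := hg₂ C' (List.mem_flatMap.2 ⟨F, hF, hC'⟩)
    exact ⟨a, Paratopic.trans h h'⟩

end GroupCubes

namespace GroupCubes

/-- The map with values `0`, `a`, `b` and `c` at `0`, `1`, `2` and `4`. -/
def onGens (a b c x : ℕ) : ℕ :=
  bif Nat.beq x 0 then 0 else bif Nat.beq x 1 then a else bif Nat.beq x 2 then b else c

/-- the code of the homomorphism with the given values at the generators `1`, `2` and `4` -/
def homCode (T a b c : ℕ) : ℕ :=
  code fun x => tmul T (tmul T (onGens a b c (Nat.land x 1)) (onGens a b c (Nat.land x 2)))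
    (onGens a b c (Nat.land x 4))

def upto (m : ℕ) : List ℕ := kfilter (fun x => Nat.blt x m) pts

/-- The numbers below `m` are products of the generators `1`, `2` and `4`. -/
def generated (m T : ℕ) : Bool :=
  Nat.beq (tmul T 0 0) 0 && kall (fun x =>
    Nat.beq (tmul T (tmul T (Nat.land x 1) (Nat.land x 2)) (Nat.land x 4)) x) (upto m)

def isHom (m T φ : ℕ) : Bool :=
  kall (fun x => kall (fun y => Nat.beq (app φ (tmul T x y)) (tmul T (app φ x) (app φ y))) (upto m))
    (upto m)

/-- `φ` may be the conjugation by an element with square `s`. -/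
def isTwist (m T φ s : ℕ) : Bool :=
  Nat.beq (app φ s) s && kall (fun x => Nat.beq (tmul T (app φ (app φ x)) s) (tmul T s x)) (upto m)

/-- Multiplication in an extension by an element outside of a subgroup of index two that acts on it
by `φ` and has square `s`. -/
def dbl (m T φ s x y : ℕ) : ℕ :=
  bif Nat.blt x m then (bif Nat.blt y m then tmul T x y else Nat.add m (tmul T x (Nat.sub y m)))
  else bif Nat.blt y m then Nat.add m (tmul T (Nat.sub x m) (app φ y))
  else tmul T (tmul T (Nat.sub x m) (app φ (Nat.sub y m))) s

/-- `p` is an isomorphism from the extension to the group with table `T'`. -/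
def isIso (m T φ s T' p : ℕ) : Bool :=
  kall (fun x => Nat.blt (app p x) (Nat.mul 2 m)) (upto (Nat.mul 2 m)) &&
    kall (fun x => kall (fun y => Nat.beq (app p (dbl m T φ s x y)) (tmul T' (app p x) (app p y)))
      (upto (Nat.mul 2 m))) (upto (Nat.mul 2 m)) && distinct (kmap (app p) (upto (Nat.mul 2 m)))

/-- The extensions of the groups with tables in the first list are isomorphic to groups in the second
list, by maps given there. -/
def extendOk (m : ℕ) (Ts : List ℕ) (L : List (ℕ × List ℕ)) : Bool :=
  kall (fun T => generated m T && kall (fun a => kall (fun b => kall (fun c =>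
    force (homCode T a b c) fun φ => !isHom m T φ || kall (fun s => !isTwist m T φ s ||
      kany (fun r => kany (isIso m T φ s r.1) r.2) L) (upto m))
        (upto m)) (upto m)) (upto m)) Ts

theorem blt_iff {a b : ℕ} : Nat.blt a b = true ↔ a < b := by rw [Nat.blt_eq]

theorem mem_upto {m x : ℕ} (hm : m ≤ 16) : x ∈ upto m ↔ x < m := by
  rw [upto, kfilter_eq, List.mem_filter, mem_pts, blt_iff]
  omega

theorem kall_upto {m : ℕ} (hm : m ≤ 16) {f : ℕ → Bool} :
    kall f (upto m) = true ↔ ∀ x < m, f x = true := by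
  simp only [kall_eq, List.all_eq_true, mem_upto hm]

theorem kany_iff {α : Type} {f : α → Bool} {l : List α} : kany f l = true ↔ ∃ x ∈ l, f x = true := by
  rw [kany_eq, List.any_eq_true]

/-- `T` is a multiplication table of `G`. -/
def Coded (G : Type) [Group G] (m T : ℕ) : Prop :=
  ∃ v : G → ℕ, (∀ g, v g < m) ∧ Function.Injective v ∧ ∀ g h, v (g * h) = tmul T (v g) (v h)

theorem app_homCode (T a b c : ℕ) {x : ℕ} (hx : x < 16) : app (homCode T a b c) x =
    tmul T (tmul T (onGens a b c (x &&& 1)) (onGens a b c (x &&& 2))) (onGens a b c (x &&& 4)) :=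
  app_code (fun _ => tmul_lt _ _ _) ⟨x, hx⟩

theorem onGens_land {f : ℕ → ℕ} (h0 : f 0 = 0) (x : ℕ) :
    onGens (f 1) (f 2) (f 4) (x &&& 1) = f (x &&& 1) ∧
      onGens (f 1) (f 2) (f 4) (x &&& 2) = f (x &&& 2) ∧
      onGens (f 1) (f 2) (f 4) (x &&& 4) = f (x &&& 4) := by
  have key : ∀ k, x &&& 2 ^ k = 0 ∨ x &&& 2 ^ k = 2 ^ k := fun k => by
    rw [Nat.and_two_pow]
    cases x.testBit k <;> simp
  refine ⟨?_, ?_, ?_⟩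
  · rcases show x &&& 1 = 0 ∨ x &&& 1 = 1 from key 0 with h | h <;> rw [h]
    exacts [h0.symm, rfl]
  · rcases show x &&& 2 = 0 ∨ x &&& 2 = 2 from key 1 with h | h <;> rw [h]
    exacts [h0.symm, rfl]
  · rcases show x &&& 4 = 0 ∨ x &&& 4 = 4 from key 2 with h | h <;> rw [h]
    exacts [h0.symm, rfl]

section Extension

variable {G : Type} [Group G] {H : Subgroup G} {m T : ℕ} {v : G → ℕ} {t : G}

/-- the labels of the elements of `H`, then those of its coset -/
noncomputable def cosetLabel (H : Subgroup G) (m : ℕ) (v : G → ℕ) (t : G) (g : G) : ℕ :=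
  open Classical in if g ∈ H then v g else m + v (g * t⁻¹)

theorem cosetLabel_mul (hi : H.index = 2) (ht : t ∉ H) (hv : ∀ h ∈ H, v h < m)
    (hmul : ∀ g ∈ H, ∀ h ∈ H, v (g * h) = tmul T (v g) (v h)) {φ : ℕ}
    (hφ : ∀ h ∈ H, app φ (v h) = v (t * h * t⁻¹)) (g h : G) :
    cosetLabel H m v t (g * h) =
      dbl m T φ (v (t * t)) (cosetLabel H m v t g) (cosetLabel H m v t h) := by
  have mem : ∀ a b : G, a * b ∈ H ↔ (a ∈ H ↔ b ∈ H) := fun a b => Subgroup.mul_mem_iff_of_index_two hi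
  have ht' : t⁻¹ ∉ H := fun h => ht (H.inv_mem_iff.1 h)
  have htt : t * t ∈ H := (mem t t).2 Iff.rfl
  have blt : ∀ h ∈ H, Nat.blt (v h) m = true := fun h hh => blt_iff.2 (hv h hh)
  have nblt : ∀ x, Nat.blt (m + x) m = false := fun x => by
    rw [Bool.eq_false_iff, ne_eq, blt_iff]
    omega
  have sub : ∀ x, Nat.sub (m + x) m = x := fun x => Nat.add_sub_cancel_left m x
  have coset : ∀ g, g ∉ H → g * t⁻¹ ∈ H := fun g hg => (mem g _).2 (by simp [hg, ht])
  have conj : ∀ h ∈ H, t * h * t⁻¹ ∈ H := fun h hh => coset _ fun h' => ht (((mem t h).1 h').2 hh)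
  by_cases hg : g ∈ H <;> by_cases hh : h ∈ H
  · rw [cosetLabel, if_pos ((mem g h).2 (by tauto)), cosetLabel, if_pos hg, cosetLabel, if_pos hh, dbl,
      blt g hg, blt h hh, hmul g hg h hh]
    rfl
  · rw [cosetLabel, if_neg (fun h' => hh (((mem g h).1 h').1 hg)), cosetLabel, if_pos hg, cosetLabel,
      if_neg hh, dbl, blt g hg, nblt, sub, mul_assoc, hmul g hg _ (coset h hh)]
    rfl
  · rw [cosetLabel, if_neg (fun h' => hg (((mem g h).1 h').2 hh)), cosetLabel, if_neg hg, cosetLabel,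
      if_pos hh, dbl, blt h hh, nblt, sub, hφ h hh, ← hmul _ (coset g hg) _ (conj h hh)]
    simp [mul_assoc]
  · rw [cosetLabel, if_pos ((mem g h).2 (by tauto)), cosetLabel, if_neg hg, cosetLabel, if_neg hh, dbl,
      nblt, nblt, sub, sub, hφ _ (coset h hh), ← hmul _ (coset g hg) _ (conj _ (coset h hh)),
      ← hmul _ (H.mul_mem (coset g hg) (conj _ (coset h hh))) _ htt]
    simp [mul_assoc]

theorem cosetLabel_lt (hi : H.index = 2) (ht : t ∉ H) (hv : ∀ h ∈ H, v h < m) (g : G) :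
    cosetLabel H m v t g < 2 * m := by
  rw [cosetLabel]
  split_ifs with hg
  · have := hv g hg
    omega
  · have := hv (g * t⁻¹) ((Subgroup.mul_mem_iff_of_index_two hi).2 (by simp [hg, ht]))
    omega

theorem cosetLabel_injective (hi : H.index = 2) (ht : t ∉ H) (hv : ∀ h ∈ H, v h < m)
    (hinj : ∀ g ∈ H, ∀ h ∈ H, v g = v h → g = h) : Function.Injective (cosetLabel H m v t) := by
  have coset : ∀ g, g ∉ H → g * t⁻¹ ∈ H := fun g hg =>
    (Subgroup.mul_mem_iff_of_index_two hi).2 (by simp [hg, ht])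
  intro g h e
  rw [cosetLabel, cosetLabel] at e
  split_ifs at e with hg hh hh
  · exact hinj g hg h hh e
  · have := hv g hg
    omega
  · have := hv h hh
    omega
  · exact mul_right_cancel (hinj _ (coset g hg) _ (coset h hh) (by omega))

theorem exists_coded_of_labels [Finite G] (hm : 2 * m ≤ 16) (hi : H.index = 2)
    (hv : ∀ h ∈ H, v h < m) (hinj : ∀ g ∈ H, ∀ h ∈ H, v g = v h → g = h)
    (hsurj : ∀ x < m, ∃ h ∈ H, v h = x)
    (hmul : ∀ g ∈ H, ∀ h ∈ H, v (g * h) = tmul T (v g) (v h)) {Ts : List ℕ}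
    {L : List (ℕ × List ℕ)} (hT : T ∈ Ts) (hok : extendOk m Ts L = true) :
    ∃ r ∈ L, Coded G (2 * m) r.1 := by
  have hm' : m ≤ 16 := by omega
  obtain ⟨t, ht⟩ : ∃ t, t ∉ H := by
    by_contra! h
    rw [(Subgroup.eq_top_iff' H).2 h, Subgroup.index_top] at hi
    omega
  have mem : ∀ a b : G, a * b ∈ H ↔ (a ∈ H ↔ b ∈ H) := fun a b => Subgroup.mul_mem_iff_of_index_two hi
  have htt : t * t ∈ H := (mem t t).2 Iff.rfl
  have conj : ∀ h ∈ H, t * h * t⁻¹ ∈ H := fun h hh => (mem _ _).2 (by simp [mem, hh, ht])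
  have h := List.all_eq_true.1 ((kall_eq _ _).symm.trans hok) T hT
  rw [Bool.and_eq_true, kall_upto hm', generated, Bool.and_eq_true, beq_iff, kall_upto hm'] at h
  obtain ⟨⟨h00, hgen⟩, h⟩ := h
  have hv1 : v 1 = 0 := by
    obtain ⟨z, hz, hz0⟩ := hsurj 0 (lt_of_le_of_lt (Nat.zero_le _) (hv 1 H.one_mem))
    have := hinj _ (H.mul_mem hz hz) z hz (by rw [hmul z hz z hz, hz0, h00])
    rw [← hz0, mul_eq_left.1 this]
  have hf : ∃ f : ℕ → ℕ, (∀ h ∈ H, f (v h) = v (t * h * t⁻¹)) ∧ ∀ x, f x < m := by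
    classical
    refine ⟨fun x => if hx : x < m then v (t * (hsurj x hx).choose * t⁻¹) else 0, fun h hh => ?_,
      fun x => ?_⟩
    · have := (hsurj (v h) (hv h hh)).choose_spec
      dsimp only
      rw [dif_pos (hv h hh), hinj _ this.1 h hh this.2]
    · dsimp only
      split_ifs with hx
      · exact hv _ (conj _ (hsurj x hx).choose_spec.1)
      · exact lt_of_le_of_lt (Nat.zero_le _) (hv 1 H.one_mem)
  obtain ⟨f, hf, hflt⟩ := hf
  have hf0 : f 0 = 0 := by rw [← hv1, hf 1 H.one_mem]; simp
  have hfmul : ∀ x < m, ∀ y < m, f (tmul T x y) = tmul T (f x) (f y) := fun x hx y hy => by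
    obtain ⟨a, ha, rfl⟩ := hsurj x hx
    obtain ⟨b, hb, rfl⟩ := hsurj y hy
    rw [← hmul a ha b hb, hf _ (H.mul_mem ha hb), hf a ha, hf b hb,
      ← hmul _ (conj a ha) _ (conj b hb)]
    simp [mul_assoc]
  have hTlt : ∀ x < m, ∀ y < m, tmul T x y < m := fun x hx y hy => by
    obtain ⟨a, ha, rfl⟩ := hsurj x hx
    obtain ⟨b, hb, rfl⟩ := hsurj y hy
    rw [← hmul a ha b hb]
    exact hv _ (H.mul_mem ha hb)
  have hφ : ∀ x < m, app (homCode T (f 1) (f 2) (f 4)) x = f x := fun x hx => by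
    obtain ⟨h1, h2, h4⟩ := onGens_land hf0 x
    have hle : ∀ k, x &&& k < m := fun k => lt_of_le_of_lt Nat.and_le_left hx
    rw [app_homCode _ _ _ _ (by omega), h1, h2, h4, ← hfmul _ (hle 1) _ (hle 2),
      ← hfmul _ (hTlt _ (hle 1) _ (hle 2)) _ (hle 4)]
    exact congrArg f (beq_iff.1 (hgen x hx))
  have h := (kall_upto hm').1 ((kall_upto hm').1 (h _ (hflt 1)) _ (hflt 2)) _ (hflt 4)
  rw [force_eq, Bool.or_eq_true, kall_upto hm'] at h
  set φ := homCode T (f 1) (f 2) (f 4)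
  have hφv : ∀ h ∈ H, app φ (v h) = v (t * h * t⁻¹) := fun h hh => by rw [hφ _ (hv h hh), hf h hh]
  have hhom : isHom m T φ = true := (kall_upto hm').2 fun x hx => (kall_upto hm').2 fun y hy =>
    beq_iff.2 (by rw [hφ _ (hTlt x hx y hy), hφ x hx, hφ y hy, hfmul x hx y hy])
  have htw : isTwist m T φ (v (t * t)) = true := by
    rw [isTwist, Bool.and_eq_true, beq_iff, kall_upto hm']
    refine ⟨by rw [hφv _ htt, ← mul_assoc, mul_inv_cancel_right], fun x hx => beq_iff.2 ?_⟩
    obtain ⟨a, ha, rfl⟩ := hsurj x hx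
    rw [hφv a ha, hφv _ (conj a ha), ← hmul _ (conj _ (conj a ha)) _ htt, ← hmul _ htt a ha]
    simp [mul_assoc]
  rw [hhom] at h
  have h := (h.resolve_left Bool.false_ne_true) _ (hv _ htt)
  rw [htw, Bool.not_true, Bool.false_or, kany_iff] at h
  obtain ⟨r, hr, h⟩ := h
  obtain ⟨p, -, h⟩ := kany_iff.1 h
  rw [isIso, Bool.and_eq_true, Bool.and_eq_true, kall_upto (m := Nat.mul 2 m) hm,
    kall_upto (m := Nat.mul 2 m) hm, distinct_iff, kmap_eq] at h
  obtain ⟨⟨hlt, hiso⟩, hnd⟩ := h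
  have hlab := cosetLabel_lt hi ht hv
  refine ⟨r, hr, fun g => app p (cosetLabel H m v t g), fun g => blt_iff.1 (hlt _ (hlab g)),
    fun g h e => cosetLabel_injective hi ht hv hinj
      (List.inj_on_of_nodup_map hnd ((mem_upto hm).2 (hlab g)) ((mem_upto hm).2 (hlab h)) e),
    fun g h => ?_⟩
  dsimp only
  rw [cosetLabel_mul hi ht hv hmul hφv]
  exact beq_iff.1 ((kall_upto hm).1 (hiso _ (hlab g)) _ (hlab h))

end Extension

theorem Coded.exists_eq {G : Type} [Group G] [Finite G] {m : ℕ} (hG : Nat.card G = m) {v : G → ℕ}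
    (hv : ∀ g, v g < m) (hinj : Function.Injective v) {x : ℕ} (hx : x < m) : ∃ g, v g = x := by
  have := Fintype.ofFinite G
  obtain ⟨g, hg⟩ := ((Fintype.bijective_iff_injective_and_card fun g => (⟨v g, hv g⟩ : Fin m)).2
    ⟨fun g h e => hinj (congrArg Fin.val e :), by
      rw [Fintype.card_fin, ← Nat.card_eq_fintype_card, hG]⟩).2 ⟨x, hx⟩
  exact ⟨g, congrArg Fin.val hg⟩

/-- Tables for the groups of order `2 ^ k` give tables for those of order `2 ^ (k + 1)`. -/
theorem exists_coded_succ {k : ℕ} (hk : k ≤ 3) {Ts : List ℕ} {L : List (ℕ × List ℕ)}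
    (hok : extendOk (2 ^ k) Ts L = true)
    (ih : ∀ (H : Type) [Group H] [Finite H], Nat.card H = 2 ^ k → ∃ T ∈ Ts, Coded H (2 ^ k) T)
    (G : Type) [Group G] [Finite G] (hG : Nat.card G = 2 ^ (k + 1)) :
    ∃ T ∈ L.map Prod.fst, Coded G (2 ^ (k + 1)) T := by
  have : Fact (Nat.Prime 2) := ⟨Nat.prime_two⟩
  obtain ⟨H, hH⟩ := Sylow.exists_subgroup_card_pow_prime 2 (G := G) (n := k)
    (hG ▸ pow_dvd_pow 2 (Nat.le_succ k))
  have hi : H.index = 2 := by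
    have := H.card_mul_index
    rw [hH, hG, pow_succ] at this
    exact Nat.eq_of_mul_eq_mul_left (by positivity) this
  obtain ⟨T, hT, w, hw, hinj, hmul⟩ := ih H hH
  classical
  let v : G → ℕ := fun g => if h : g ∈ H then w ⟨g, h⟩ else 0
  have hv : ∀ h (hh : h ∈ H), v h = w ⟨h, hh⟩ := fun h hh => dif_pos hh
  have h2 : 2 * 2 ^ k ≤ 16 := by
    have := Nat.pow_le_pow_right (n := 2) (by norm_num) hk
    omega
  obtain ⟨r, hr, h⟩ := exists_coded_of_labels (v := v) h2 hi (fun h hh => hv h hh ▸ hw _)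
    (fun g hg h hh e => by
      rw [hv g hg, hv h hh] at e
      exact congrArg Subtype.val (hinj e))
    (fun x hx => by
      obtain ⟨h, e⟩ := Coded.exists_eq hH hw hinj hx
      exact ⟨h, h.2, (hv _ h.2).trans e⟩)
    (fun g hg h hh => by
      rw [hv g hg, hv h hh, hv _ (H.mul_mem hg hh), ← hmul]
      rfl) hT hok
  exact ⟨r.1, List.mem_map_of_mem hr, by rwa [pow_succ']⟩

theorem coded_one (G : Type) [Group G] [Finite G] (hG : Nat.card G = 2 ^ 0) :
    ∃ T ∈ [0], Coded G (2 ^ 0) T := by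
  refine ⟨0, by simp, fun _ => 0, fun _ => by norm_num, fun g h _ => ?_, fun g h => (by decide : (0 : ℕ) = tmul 0 0 0)⟩
  have := (Nat.card_eq_one_iff_unique.1 hG).1
  exact Subsingleton.elim g h

theorem Coded.mulEquiv {G : Type} [Group G] [Fintype G] (hG : Fintype.card G = 16) {t : Table}
    (h : Coded G 16 t.code) : Nonempty (G ≃* t.El) := by
  obtain ⟨v, hv, hinj, hmul⟩ := h
  refine ⟨MulEquiv.ofBijective (MonoidHom.mk' (fun g => Table.ofLt (hv g)) fun g h => ?_)
    ((Fintype.bijective_iff_injective_and_card _).2 ⟨fun g h e => hinj ?_, hG.trans t.card_el.symm⟩)⟩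
  · rw [← Table.val_inj, Table.val_mul, Table.val_ofLt, Table.val_ofLt, Table.val_ofLt, hmul]
  · have := Table.val_inj.2 e
    simpa only [MonoidHom.coe_mk, OneHom.coe_mk, MonoidHom.mk'_apply, Table.val_ofLt] using this

end GroupCubes

namespace GroupCubes

/-- tables of the groups of order 2, with isomorphisms from extensions -/
def tables2 : List (ℕ × List ℕ) :=
  [(18446744073709551632, [16])]

/-- tables of the groups of order 4, with isomorphisms from extensions -/
def tables4 : List (ℕ × List ℕ) :=
  [(25930707268882378235509772511548677134903924244599558937522704, [12816]),
    (1826636604997524103687025415407641796770237830395656339993104, [12816])]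

/-- tables of the groups of order 8, with isomorphisms from extensions -/
def tables8 : List (ℕ × List ℕ) :=
  [(197503903270135919168678527616556322386295218921415388828866790007030591111231483863327069571439367099627250313943394314399399188657676704035344,
      [1985229328]),
    (13874437610526695973432030937281792795046300281928166406832323950005998411423452319621910138842477704678672028888885828991284837249453663728144,
      [1985229328, 1668436288, 908546368, 913446208, 1663505728, 1731351568, 845632528]),
    (426864898520465854988560701069411245014905836128135979571060778012948432152849813264545083538597647435050803634159016834570959092091829573923344,
      [1985229328, 1733567248]),
    (14591740210759544501538462564935208926266299487374810879723531726323050817481197857959050672261983746224479757445233935483054155812611774755344,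
      [1985229328, 1416049168, 893523568, 1396859248, 1412589328]),
    (13874437610526695973432030937281792794508753341615275460032961883811228700950539972536064596195808715573671356327488034696840624189815766921744,
      [1985229328])]

/-- tables of the groups of order 16, with isomorphisms from extensions -/
def tables16 : List (ℕ × List ℕ) :=
  [(table0, [8570161858225608720, 18336085189344794640, 7493520072559990800,
      17250999153872574480, 18335936173180688400, 7493669083925878800, 8570310870094813200,
      17250850137710434320, 8526720153819820560, 7445839750828139280, 18364666994115486480,
      17283819575969329680, 15920148371509355280]),
    (table1, [14843506585022902800, 15920148371191837200, 18360519927167001360,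
      17283878140998066960]),
    (table2, [3632077228031366160, 7432047395683718160, 13474246128301528080,
      17274249281302713360, 12389347153233204240]),
    (table3, [8493767337317214240, 18263581844129425440, 6340483764979345440,
      16093409773188917280, 12389347153233204240, 13474433188703458320]),
    (table4, [12393585770558280720, 17270048774663066640]),
    (table5, [8512853324194137360, 3636357334740518160, 13474262620975940880,
      17274232788628292880, 13460694790660515600, 12384053004994897680, 13474433188451796240,
      12393585770808955920]),
    (table6, [3636357334740518160, 8512853324194137360, 13474262620975940880,
      17274232788628292880, 13460694790912177680, 12384053004743243280, 13474433188704437520,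
      12393585770558280720]),
    (table7, [14791433279095937040, 6110579555451705360, 15876519314568157200,
      5033937769280804880, 6110744995318175760, 15876353869903468560, 14791267834934564880,
      5034103209149241360, 14824253701188253200, 15905101119334410000, 6062932219064248080,
      4982051815569258000, 14824424560150214160, 15905304963645204240, 18345655774360135440,
      17264775370865145360, 3622564914855048720, 17264641748701443600]),
    (table8, [6067191515837003280, 2545811352412911120, 17264641748701443600,
      11024287784985327120, 6067137850788836880, 2545885890432955920, 14824253701188253200,
      14824199969441805840, 11024475137189901840, 14824312783626335760, 11010736739403060240,
      14810574385839494160]),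
    (table9, [18263581844129425440, 8493767337317214240, 16093409773188917280,
      6340483764979345440, 15685685418985469520, 15690451801892857680, 15702639888290702160,
      15707406271196131920, 11379118274562373200, 11383884657467795280, 11362295746652496720,
      11367062129559892560, 12599312298918622800, 13824272706117379920, 16922833913150268240,
      18147794319845716560, 16905879443847001680, 18130839850542442320, 12582489771010712400,
      13807450178209477200, 12592022536825749840, 13812216561117118800, 16932366678965305680,
      18152560702755324240, 16915412209662039120, 18135606233450091600, 12608845064733660240,
      13829039089026995280, 16040410891230012720, 16112732299322422560, 17125496927205549360,
      18282904370266862880, 11159634794181518640, 11231956202307351840, 12244720829655704880,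
      13402128273251792160, 12389363645907617040, 13474449681377871120, 17270139743457461520,
      18355225778426365200, 16067887686813553200, 16135442712000533280, 17148768090811867440,
      18297203518990528800, 17283878141248742160, 18364758544240423440]),
    (table10, [17250833709460527120, 7493669083925878800, 11231956202308461600,
      13402128273252901920, 16112732299607630880, 18282904370552071200, 16135442712284631840,
      18297203519274627360, 18364758544493064720]),
    (table11, [14824329341545117200, 15905176759187957520, 9943627719863592720,
      11024475138009757200, 18345489166847600400]),
    (table12, [2593640914779167760, 18316907652993834000, 8550967893877382160,
      13436206031563971600, 7474454018723339280, 10230748560135497280, 15613908204977071680,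
      10209588458862895680, 15635068306257568320, 15613957488724092480, 10230699274383074880,
      15635018633950224960, 10209638129149108800, 18054345537373677120, 12671087323032659520,
      12649976507512480320, 18075456354907152960, 12671136608785081920, 18054296253626656320,
      18075406682599809600, 12650026177798693440, 18080700831088660800, 12663797560937697600,
      12663714905302651200, 18080783488744837440, 12676463742622766400, 18068034651416827200,
      18068116920512681280, 12676381471521510720, 10006921321764840480, 16107947298017993760,
      12177093392709280800, 18278119368962434080, 16107891440831915040, 10006977176678130720,
      18278063511776355360, 12177149247622571040, 18350912685483643920, 12393585706385429520,
      12393494804539003920, 18351003589602858000, 9996267054096978720, 16135424093601403680,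
      12158027861086974240, 18297184900591399200, 12360690875126526480, 18364741987394138640]),
    (table13, [18364758544493064720])]

theorem extendOk2 : extendOk (2 ^ 0) [0] tables2 = true := by
  decide +kernel

theorem extendOk4 : extendOk (2 ^ 1) (tables2.map Prod.fst) tables4 = true := by
  decide +kernel

theorem extendOk8 : extendOk (2 ^ 2) (tables4.map Prod.fst) tables8 = true := by
  decide +kernel

theorem extendOk16 : extendOk (2 ^ 3) (tables8.map Prod.fst) tables16 = true := by
  decide +kernel

theorem check0 : checkRun table0 orbit0 [orbit1] 68 = true := by
  decide +kernel

theorem check1 : checkRun table0 orbit1 [] 3 = true := by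
  decide +kernel

theorem check2 : checkRun table2 orbit2 [orbit3] 173 = true := by
  decide +kernel

theorem check3 : checkRun table2 orbit3 [] 24 = true := by
  decide +kernel

theorem check4 : checkRun table3 orbit4 [orbit5, orbit6] 41 = true := by
  decide +kernel

theorem check5 : checkRun table3 orbit5 [orbit6] 29 = true := by
  decide +kernel

theorem check6 : checkRun table3 orbit6 [] 11 = true := by
  decide +kernel

theorem check7 : checkRun table4 orbit7 [orbit8, orbit9] 51 = true := by
  decide +kernel

theorem check8 : checkRun table4 orbit8 [orbit9] 2 = true := by
  decide +kernel

theorem check9 : checkRun table4 orbit9 [] 2 = true := by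
  decide +kernel

theorem check10 : checkRun table5 orbit10 [orbit11] 32 = true := by
  decide +kernel

theorem check11 : checkRun table5 orbit11 [] 2 = true := by
  decide +kernel

theorem check12 : checkRun table6 orbit12 [orbit13] 77 = true := by
  decide +kernel

theorem check13 : checkRun table6 orbit13 [] 29 = true := by
  decide +kernel

theorem check14 : checkRun table7 orbit14 [orbit15] 47 = true := by
  decide +kernel

theorem check15 : checkRun table7 orbit15 [] 3 = true := by
  decide +kernel

theorem check16 : checkRun table8 orbit16 [orbit17] 53 = true := by
  decide +kernel

theorem check17 : checkRun table8 orbit17 [] 24 = true := by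
  decide +kernel

theorem check18 : checkRun table9 orbit18 [orbit19, orbit20, orbit21] 46 = true := by
  decide +kernel

theorem check19 : checkRun table9 orbit19 [orbit20, orbit21] 20 = true := by
  decide +kernel

theorem check20 : checkRun table9 orbit20 [orbit21] 15 = true := by
  decide +kernel

theorem check21 : checkRun table9 orbit21 [] 2 = true := by
  decide +kernel

theorem check22 : checkRun table10 orbit22 [orbit23] 121 = true := by
  decide +kernel

theorem check23 : checkRun table10 orbit23 [] 10 = true := by
  decide +kernel

theorem check24 : checkRun table12 orbit24 [orbit25] 37 = true := by
  decide +kernel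

theorem check25 : checkRun table12 orbit25 [] 15 = true := by
  decide +kernel

theorem check26 : checkRun table13 orbit26 [] 9 = true := by
  decide +kernel

def family0 : Family where
  table := ⟨table0, by decide +kernel⟩
  orbits := orbits0
  ok := orbitsOk_ok (by decide +kernel)
  trans := by decide +kernel
  numbers := [68, 3]
  check := .cons check0 (.cons check1 .nil)

def family1 : Family where
  table := ⟨table1, by decide +kernel⟩
  orbits := orbits1
  ok := orbitsOk_ok (by decide +kernel)
  trans := by decide +kernel
  numbers := []
  check := .nil

def family2 : Family where
  table := ⟨table2, by decide +kernel⟩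
  orbits := orbits2
  ok := orbitsOk_ok (by decide +kernel)
  trans := by decide +kernel
  numbers := [173, 24]
  check := .cons check2 (.cons check3 .nil)

def family3 : Family where
  table := ⟨table3, by decide +kernel⟩
  orbits := orbits3
  ok := orbitsOk_ok (by decide +kernel)
  trans := by decide +kernel
  numbers := [41, 29, 11]
  check := .cons check4 (.cons check5 (.cons check6 .nil))

def family4 : Family where
  table := ⟨table4, by decide +kernel⟩
  orbits := orbits4
  ok := orbitsOk_ok (by decide +kernel)
  trans := by decide +kernel
  numbers := [51, 2, 2]
  check := .cons check7 (.cons check8 (.cons check9 .nil))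

def family5 : Family where
  table := ⟨table5, by decide +kernel⟩
  orbits := orbits5
  ok := orbitsOk_ok (by decide +kernel)
  trans := by decide +kernel
  numbers := [32, 2]
  check := .cons check10 (.cons check11 .nil)

def family6 : Family where
  table := ⟨table6, by decide +kernel⟩
  orbits := orbits6
  ok := orbitsOk_ok (by decide +kernel)
  trans := by decide +kernel
  numbers := [77, 29]
  check := .cons check12 (.cons check13 .nil)

def family7 : Family where
  table := ⟨table7, by decide +kernel⟩
  orbits := orbits7
  ok := orbitsOk_ok (by decide +kernel)
  trans := by decide +kernel
  numbers := [47, 3]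
  check := .cons check14 (.cons check15 .nil)

def family8 : Family where
  table := ⟨table8, by decide +kernel⟩
  orbits := orbits8
  ok := orbitsOk_ok (by decide +kernel)
  trans := by decide +kernel
  numbers := [53, 24]
  check := .cons check16 (.cons check17 .nil)

def family9 : Family where
  table := ⟨table9, by decide +kernel⟩
  orbits := orbits9
  ok := orbitsOk_ok (by decide +kernel)
  trans := by decide +kernel
  numbers := [46, 20, 15, 2]
  check := .cons check18 (.cons check19 (.cons check20 (.cons check21 .nil)))

def family10 : Family where
  table := ⟨table10, by decide +kernel⟩
  orbits := orbits10
  ok := orbitsOk_ok (by decide +kernel)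
  trans := by decide +kernel
  numbers := [121, 10]
  check := .cons check22 (.cons check23 .nil)

def family11 : Family where
  table := ⟨table11, by decide +kernel⟩
  orbits := orbits11
  ok := orbitsOk_ok (by decide +kernel)
  trans := by decide +kernel
  numbers := []
  check := .nil

def family12 : Family where
  table := ⟨table12, by decide +kernel⟩
  orbits := orbits12
  ok := orbitsOk_ok (by decide +kernel)
  trans := by decide +kernel
  numbers := [37, 15]
  check := .cons check24 (.cons check25 .nil)

def family13 : Family where
  table := ⟨table13, by decide +kernel⟩
  orbits := orbits13
  ok := orbitsOk_ok (by decide +kernel)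
  trans := by decide +kernel
  numbers := [9]
  check := .cons check26 .nil

def families : List Family :=
  [family0, family1, family2, family3, family4, family5, family6, family7, family8, family9,
    family10, family11, family12, family13]

theorem exists_family (G : Type) [Group G] [Fintype G] (hG : Fintype.card G = 16) :
    ∃ F ∈ families, Nonempty (G ≃* F.table.El) := by
  obtain ⟨T, hT, h⟩ := exists_coded_succ (k := 3) (by norm_num) extendOk16
    (exists_coded_succ (k := 2) (by norm_num) extendOk8 (exists_coded_succ (k := 1) (by norm_num)
      extendOk4 (exists_coded_succ (k := 0) (by norm_num) extendOk2 coded_one))) G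
    (Nat.card_eq_fintype_card.trans hG)
  obtain ⟨F, hF, rfl⟩ : ∃ F ∈ families, F.table.code = T :=
    List.mem_map.1 (show T ∈ families.map fun F => F.table.code from hT)
  exact ⟨F, hF, Coded.mulEquiv hG h⟩

theorem nodup_profile : (families.map fun F => profile F.table.code).Nodup := by
  decide +kernel

end GroupCubes

/-- Proposition 5.1 of the paper. Among the `3`-dimensional cubes of
symmetric `(16,6,2)` designs there are, up to paratopy, exactly `27` difference cubes and
exactly `946` further classes of group cubes that are not difference cubes. -/
theorem group_cubes_16_6_2_classification :
    ∃ (Cd : Fin 27 → ((Fin 3 → Fin 16) → ℤ)) (Cg : Fin 946 → ((Fin 3 → Fin 16) → ℤ)),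
      (∀ a, IsCubeOfDesigns 16 6 2 3 (Cd a) ∧ IsDifferenceCube 16 6 2 (Cd a)) ∧
      (∀ a b, a ≠ b → ¬ Paratopic 16 3 (Cd a) (Cd b)) ∧
      (∀ C : (Fin 3 → Fin 16) → ℤ, IsCubeOfDesigns 16 6 2 3 C → IsDifferenceCube 16 6 2 C →
        ∃ a, Paratopic 16 3 C (Cd a)) ∧
      (∀ b, IsCubeOfDesigns 16 6 2 3 (Cg b) ∧ IsGroupCube 16 6 2 (Cg b) ∧
        ¬ IsDifferenceCube 16 6 2 (Cg b)) ∧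
      (∀ a b, a ≠ b → ¬ Paratopic 16 3 (Cg a) (Cg b)) ∧
      (∀ C : (Fin 3 → Fin 16) → ℤ, IsCubeOfDesigns 16 6 2 3 C → IsGroupCube 16 6 2 C →
        ¬ IsDifferenceCube 16 6 2 C → ∃ b, Paratopic 16 3 C (Cg b)) := by
  exact GroupCubes.classification _ GroupCubes.exists_family GroupCubes.nodup_profile rfl rfl
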